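/- Let 1 < p ≤ q < ∞, α/n = 1/p − 1/q, φ, ψ ∈ Φ_w(ℝⁿ) with φ⁻¹(x,t) ≈ t^{α/n}·ψ⁻¹(x,t), r ∈ (α/n, 1/p], and assume φ satisfies (A0), (A1), (A2), (aInc)_p and (aDec)_{1/r}. If b ∈ L¹_loc(ℝⁿ), then the following are equivalent: (1) b ∈ BMO(ℝⁿ) and b⁻ ∈ L^∞(ℝⁿ); (2) the commutator [M_α, b] : L^φ(ℝⁿ) → L^ψ(ℝⁿ) is bounded; (3) sup_Q ‖(b − |Q|^{−α/n} M_{α,Q} b)·χ_Q‖_{L^η(ℝⁿ)} / ‖χ_Q‖_{L^η(ℝⁿ)} < ∞ holds for some η ∈ Φ_w(ℝⁿ) for which the Hardy–Littlewood maximal operator M is bounded from L^η(ℝⁿ) to L^η(ℝⁿ); (4) the condition in (3) holds for all η ∈ Φ_w(ℝⁿ) satisfying (A0), (A1), (A2), (aInc)_p' for some p' > 1 and (aDec)_q' for some q' < ∞. -/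

import Mathlib

open MeasureTheory NNReal ENNReal Filter Set

noncomputable section

/-- `ℝⁿ` with the Euclidean structure. -/
abbrev RSp (n : ℕ) := EuclideanSpace ℝ (Fin n)

variable {n : ℕ}

/-- A cube in `ℝⁿ` with sides parallel to the coordinate axes,
with center `c` and side length `2r`. -/
structure Cube (n : ℕ) where
  c : RSp n
  r : ℝ
  r_pos : 0 < r

/-- The underlying set of a cube. -/
def Cube.set (Q : Cube n) : Set (RSp n) := {y | ∀ i, |y i - Q.c i| ≤ Q.r}

/-- A weak Φ-function on `Ω` (the class `Φ_w(Ω)`). -/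
structure IsWeakPhi (Ω : Set (RSp n)) (φ : RSp n → ℝ≥0 → ℝ≥0∞) : Prop where
  meas : ∀ f : RSp n → ℝ≥0, Measurable f →
    AEMeasurable (fun x => φ x (f x)) (volume.restrict Ω)
  mono : ∀ x ∈ Ω, Monotone (φ x)
  zero : ∀ x ∈ Ω, φ x 0 = 0
  lim_zero : ∀ x ∈ Ω, Tendsto (fun t : ℝ≥0 => φ x t) (nhdsWithin 0 (Set.Ioi 0)) (nhds 0)
  lim_top : ∀ x ∈ Ω, Tendsto (fun t : ℝ≥0 => φ x t) atTop (nhds ∞)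
  almost_inc : ∃ L : ℝ≥0, 1 ≤ L ∧ ∀ x ∈ Ω, ∀ s t : ℝ≥0, 0 < s → s < t →
    φ x s / (s : ℝ≥0∞) ≤ (L : ℝ≥0∞) * (φ x t / (t : ℝ≥0∞))

/-- A convex Φ-function on `Ω` (the class `Φ_c(Ω)`): a weak Φ-function which is
additionally convex and left-continuous in `t` for a.e. `x ∈ Ω`. -/
structure IsConvexPhi (Ω : Set (RSp n)) (φ : RSp n → ℝ≥0 → ℝ≥0∞)
    extends IsWeakPhi Ω φ : Prop where
  convex : ∀ᵐ x ∂(volume.restrict Ω), ∀ s t a b : ℝ≥0, a + b = 1 →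
    φ x (a * s + b * t) ≤ (a : ℝ≥0∞) * φ x s + (b : ℝ≥0∞) * φ x t
  left_cont : ∀ᵐ x ∂(volume.restrict Ω), ∀ t : ℝ≥0,
    Tendsto (φ x) (nhdsWithin t (Set.Iio t)) (nhds (φ x t))

/-- A strong Φ-function on `Ω` (the class `Φ_s(Ω)`): a weak Φ-function which is
additionally convex and continuous into `[0,∞]` for a.e. `x ∈ Ω`. -/
structure IsStrongPhi (Ω : Set (RSp n)) (φ : RSp n → ℝ≥0 → ℝ≥0∞)
    extends IsWeakPhi Ω φ : Prop where
  convex : ∀ᵐ x ∂(volume.restrict Ω), ∀ s t a b : ℝ≥0, a + b = 1 →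
    φ x (a * s + b * t) ≤ (a : ℝ≥0∞) * φ x s + (b : ℝ≥0∞) * φ x t
  cont : ∀ᵐ x ∂(volume.restrict Ω), Continuous (φ x)

/-- The generalized (left-)inverse `φ⁻¹(x,t) = inf {τ ≥ 0 : φ(x,τ) ≥ t}`. -/
def phiInv (φ : RSp n → ℝ≥0 → ℝ≥0∞) (x : RSp n) (t : ℝ≥0∞) : ℝ≥0∞ :=
  sInf ((fun s : ℝ≥0 => (s : ℝ≥0∞)) '' {s : ℝ≥0 | t ≤ φ x s})

/-- The condition `(aInc)_p` on `Ω`: `t ↦ φ(x,t)/t^p` is almost increasing, uniformly in `x`. -/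
def AInc (p : ℝ) (Ω : Set (RSp n)) (φ : RSp n → ℝ≥0 → ℝ≥0∞) : Prop :=
  ∃ L : ℝ≥0, 1 ≤ L ∧ ∀ x ∈ Ω, ∀ s t : ℝ≥0, 0 < s → s < t →
    φ x s / (s : ℝ≥0∞) ^ p ≤ (L : ℝ≥0∞) * (φ x t / (t : ℝ≥0∞) ^ p)

/-- The condition `(aDec)_q` on `Ω`: `t ↦ φ(x,t)/t^q` is almost decreasing, uniformly in `x`. -/
def ADec (q : ℝ) (Ω : Set (RSp n)) (φ : RSp n → ℝ≥0 → ℝ≥0∞) : Prop :=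
  ∃ L : ℝ≥0, 1 ≤ L ∧ ∀ x ∈ Ω, ∀ s t : ℝ≥0, 0 < s → s < t →
    φ x t / (t : ℝ≥0∞) ^ q ≤ (L : ℝ≥0∞) * (φ x s / (s : ℝ≥0∞) ^ q)

/-- The condition `(A0)` on `Ω`: `β ≤ φ⁻¹(x,1) ≤ 1/β` for a.e. `x ∈ Ω`. -/
def A0 (Ω : Set (RSp n)) (φ : RSp n → ℝ≥0 → ℝ≥0∞) : Prop :=
  ∃ β : ℝ≥0, 0 < β ∧ β ≤ 1 ∧ ∀ᵐ x ∂(volume.restrict Ω),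
    (β : ℝ≥0∞) ≤ phiInv φ x 1 ∧ phiInv φ x 1 ≤ (β : ℝ≥0∞)⁻¹

/-- The condition `(A1)` (on all of `ℝⁿ`). -/
def A1 (φ : RSp n → ℝ≥0 → ℝ≥0∞) : Prop :=
  ∃ β : ℝ≥0, 0 < β ∧ β < 1 ∧ ∀ Q : Cube n, volume Q.set ≤ 1 →
    ∀ᵐ x ∂(volume.restrict Q.set), ∀ᵐ y ∂(volume.restrict Q.set),
      ∀ t : ℝ≥0∞, 1 ≤ t → t ≤ (volume Q.set)⁻¹ →
        (β : ℝ≥0∞) * phiInv φ x t ≤ phiInv φ y t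

/-- The condition `(A2)` (on all of `ℝⁿ`). -/
def A2 (φ : RSp n → ℝ≥0 → ℝ≥0∞) : Prop :=
  ∃ φi : ℝ≥0 → ℝ≥0∞, IsWeakPhi Set.univ (fun _ : RSp n => φi) ∧
  ∃ h : RSp n → ℝ≥0∞, (∫⁻ x, h x) < ∞ ∧ (∃ M : ℝ≥0, ∀ᵐ x ∂(volume : Measure (RSp n)), h x ≤ M) ∧
  ∃ β : ℝ≥0, 0 < β ∧ β ≤ 1 ∧ ∃ s : ℝ≥0, 0 < s ∧
    ∀ᵐ x ∂(volume : Measure (RSp n)), ∀ t : ℝ≥0,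
      (φi t ≤ (s : ℝ≥0∞) → φ x (β * t) ≤ φi t + h x) ∧
      (φ x t ≤ (s : ℝ≥0∞) → φi (β * t) ≤ φ x t + h x)

/-- Membership in the generalized Orlicz space `L^φ(Ω)`. -/
def MemOrlicz (φ : RSp n → ℝ≥0 → ℝ≥0∞) (Ω : Set (RSp n)) (f : RSp n → ℝ) : Prop :=
  AEMeasurable f (volume.restrict Ω) ∧
  ∃ lam : ℝ≥0, 0 < lam ∧ (∫⁻ x in Ω, φ x (lam * ‖f x‖₊) ∂volume) < ∞

/-- The Luxemburg (quasi)norm of `L^φ(Ω)`. -/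
def orliczNorm (φ : RSp n → ℝ≥0 → ℝ≥0∞) (Ω : Set (RSp n)) (f : RSp n → ℝ) : ℝ≥0∞ :=
  sInf ((fun lam : ℝ≥0 => (lam : ℝ≥0∞)) ''
    {lam : ℝ≥0 | 0 < lam ∧ (∫⁻ x in Ω, φ x (‖f x‖₊ / lam) ∂volume) ≤ 1})

/-- The canonical extension of `φ(x,·)` to `[0,∞]`. -/
def phiE (φ : RSp n → ℝ≥0 → ℝ≥0∞) (x : RSp n) (t : ℝ≥0∞) : ℝ≥0∞ :=
  ⨆ (s : ℝ≥0) (_ : (s : ℝ≥0∞) ≤ t), φ x s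

/-- The Luxemburg (quasi)norm for `[0,∞]`-valued functions. -/
def orliczNormE (φ : RSp n → ℝ≥0 → ℝ≥0∞) (Ω : Set (RSp n)) (g : RSp n → ℝ≥0∞) : ℝ≥0∞ :=
  sInf ((fun lam : ℝ≥0 => (lam : ℝ≥0∞)) ''
    {lam : ℝ≥0 | 0 < lam ∧ (∫⁻ x in Ω, phiE φ x (g x / (lam : ℝ≥0∞)) ∂volume) ≤ 1})

/-- The average `b_Q` of `b` over the cube `Q`. -/
def cubeAvg (Q : Cube n) (b : RSp n → ℝ) : ℝ := ⨍ x in Q.set, b x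

/-- The BMO seminorm `‖b‖_*`. -/
def bmoNorm (b : RSp n → ℝ) : ℝ≥0∞ :=
  ⨆ Q : Cube n, (volume Q.set)⁻¹ * ∫⁻ x in Q.set, ‖b x - cubeAvg Q b‖₊

/-- `b ∈ BMO(ℝⁿ)`. -/
def IsBMO (b : RSp n → ℝ) : Prop := LocallyIntegrable b volume ∧ bmoNorm b < ∞

/-- The non-centred Hardy–Littlewood maximal function (over axes-parallel cubes). -/
def maximal (f : RSp n → ℝ) (x : RSp n) : ℝ≥0∞ :=
  ⨆ (Q : Cube n) (_ : x ∈ Q.set), (volume Q.set)⁻¹ * ∫⁻ y in Q.set, (‖f y‖₊ : ℝ≥0∞) ∂volume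

/-- The fractional maximal function `M_α`. -/
def fracMaximal (α : ℝ) (f : RSp n → ℝ) (x : RSp n) : ℝ≥0∞ :=
  ⨆ (Q : Cube n) (_ : x ∈ Q.set),
    volume Q.set ^ (α / (n : ℝ) - 1) * ∫⁻ y in Q.set, (‖f y‖₊ : ℝ≥0∞) ∂volume

/-- The maximal function restricted to subcubes of `Q₀`. -/
def restMaximal (Q₀ : Cube n) (f : RSp n → ℝ) (x : RSp n) : ℝ≥0∞ :=
  ⨆ (Q : Cube n) (_ : x ∈ Q.set) (_ : Q.set ⊆ Q₀.set),
    (volume Q.set)⁻¹ * ∫⁻ y in Q.set, (‖f y‖₊ : ℝ≥0∞) ∂volume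

/-- The fractional maximal function restricted to subcubes of `Q₀`. -/
def restFracMaximal (α : ℝ) (Q₀ : Cube n) (f : RSp n → ℝ) (x : RSp n) : ℝ≥0∞ :=
  ⨆ (Q : Cube n) (_ : x ∈ Q.set) (_ : Q.set ⊆ Q₀.set),
    volume Q.set ^ (α / (n : ℝ) - 1) * ∫⁻ y in Q.set, (‖f y‖₊ : ℝ≥0∞) ∂volume

/-- The sharp maximal function `M♯`. -/
def sharpMaximal (f : RSp n → ℝ) (x : RSp n) : ℝ≥0∞ :=
  ⨆ (Q : Cube n) (_ : x ∈ Q.set),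
    (volume Q.set)⁻¹ * ∫⁻ y in Q.set, (‖f y - ⨍ z in Q.set, f z‖₊ : ℝ≥0∞) ∂volume

/-- The maximal commutator `M_b`. -/
def maximalComm (b f : RSp n → ℝ) (x : RSp n) : ℝ≥0∞ :=
  ⨆ (Q : Cube n) (_ : x ∈ Q.set),
    (volume Q.set)⁻¹ * ∫⁻ y in Q.set, (‖b x - b y‖₊ : ℝ≥0∞) * (‖f y‖₊ : ℝ≥0∞) ∂volume

/-- The fractional maximal commutator `M_{b,α}`. -/
def fracMaximalComm (α : ℝ) (b f : RSp n → ℝ) (x : RSp n) : ℝ≥0∞ :=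
  ⨆ (Q : Cube n) (_ : x ∈ Q.set),
    volume Q.set ^ (α / (n : ℝ) - 1) *
      ∫⁻ y in Q.set, (‖b x - b y‖₊ : ℝ≥0∞) * (‖f y‖₊ : ℝ≥0∞) ∂volume

/-- The commutator `[M,b]f = M(bf) − b·Mf` of the maximal operator. -/
def maximalCommutator (b f : RSp n → ℝ) (x : RSp n) : ℝ :=
  (maximal (fun y => b y * f y) x).toReal - b x * (maximal f x).toReal

/-- The commutator `[M_α,b]f = M_α(bf) − b·M_α f` of the fractional maximal operator. -/
def fracMaximalCommutator (α : ℝ) (b f : RSp n → ℝ) (x : RSp n) : ℝ :=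
  (fracMaximal α (fun y => b y * f y) x).toReal - b x * (fracMaximal α f x).toReal

/-- The Riesz potential `I_α f`. -/
def riesz (α : ℝ) (f : RSp n → ℝ) (x : RSp n) : ℝ :=
  ∫ y, f y / dist x y ^ ((n : ℝ) - α)

/-- The commutator `[I_α, b]f = I_α(bf) − b·I_α f` of the Riesz potential. -/
def rieszCommutator (α : ℝ) (b f : RSp n → ℝ) (x : RSp n) : ℝ :=
  riesz α (fun y => b y * f y) x - b x * riesz α f x

/-- The operator `I_{b,α} f(x) = ∫ |b(x)−b(y)|·|x−y|^{α−n} f(y) dy`. -/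
def rieszAbs (α : ℝ) (b f : RSp n → ℝ) (x : RSp n) : ℝ :=
  ∫ y, |b x - b y| / dist x y ^ ((n : ℝ) - α) * f y

/-- Equivalence `φ ≃ ψ` of Φ-functions. -/
def PhiEquiv (φ ψ : RSp n → ℝ≥0 → ℝ≥0∞) : Prop :=
  ∃ L : ℝ≥0, 1 ≤ L ∧ ∀ x : RSp n, ∀ t : ℝ≥0, ψ x (t / L) ≤ φ x t ∧ φ x t ≤ ψ x (L * t)

/-- Weak equivalence `φ ∼ ψ` of Φ-functions. -/
def PhiWeakEquiv (φ ψ : RSp n → ℝ≥0 → ℝ≥0∞) : Prop :=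
  ∃ L : ℝ≥0, 1 ≤ L ∧ ∃ h : RSp n → ℝ≥0∞, (∫⁻ x, h x) < ∞ ∧
    ∀ᵐ x ∂(volume : Measure (RSp n)), ∀ t : ℝ≥0,
      ψ x t ≤ φ x (L * t) + h x ∧ φ x t ≤ ψ x (L * t) + h x

/-- The relation `φ⁻¹(x,t) ≈ t^{α/n}·ψ⁻¹(x,t)` with constants independent of `x` and `t > 0`. -/
def FracInvRel (α : ℝ) (φ ψ : RSp n → ℝ≥0 → ℝ≥0∞) : Prop :=
  ∃ c₁ c₂ : ℝ≥0, 0 < c₁ ∧ ∀ x : RSp n, ∀ t : ℝ≥0, 0 < t →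
    (c₁ : ℝ≥0∞) * ((t : ℝ≥0∞) ^ (α / (n : ℝ)) * phiInv ψ x t) ≤ phiInv φ x t ∧
    phiInv φ x t ≤ (c₂ : ℝ≥0∞) * ((t : ℝ≥0∞) ^ (α / (n : ℝ)) * phiInv ψ x t)

/-- The characteristic function of a cube, as a real-valued function. -/
def cubeIndicator (Q : Cube n) : RSp n → ℝ := Q.set.indicator 1

end

/-- The function `(b − |Q|^{−α/n}·M_{α,Q}b)·χ_Q`. -/
noncomputable def commTestFn {n : ℕ} (α : ℝ) (Q : Cube n) (b : RSp n → ℝ) : RSp n → ℝ :=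
  Q.set.indicator fun z =>
    b z - (volume Q.set ^ (-(α / (n : ℝ)))).toReal * (restFracMaximal α Q b z).toReal


theorem Cube.set_eq {n : ℕ} (Q : Cube n) :
    Q.set = (@WithLp.ofLp 2 (Fin n → ℝ)) ⁻¹' Metric.closedBall (WithLp.ofLp Q.c) Q.r := by
  ext y
  simp only [Cube.set, mem_ofPred_eq, mem_preimage, Metric.mem_closedBall,
    dist_pi_le_iff Q.r_pos.le, Real.dist_eq]

theorem Cube.isClosed {n : ℕ} (Q : Cube n) : IsClosed Q.set := by
  rw [Cube.set_eq]
  exact Metric.isClosed_closedBall.preimage (PiLp.continuous_ofLp 2 _)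

theorem Cube.measurableSet {n : ℕ} (Q : Cube n) : MeasurableSet Q.set :=
  Q.isClosed.measurableSet

theorem Cube.volume_eq {n : ℕ} (Q : Cube n) :
    volume Q.set = ENNReal.ofReal ((2 * Q.r) ^ n) := by
  rw [Cube.set_eq, (PiLp.volume_preserving_ofLp (Fin n)).measure_preimage
    Metric.isClosed_closedBall.measurableSet.nullMeasurableSet,
    Real.volume_pi_closedBall _ Q.r_pos.le]
  simp

theorem Cube.volume_ne_zero {n : ℕ} (Q : Cube n) : volume Q.set ≠ 0 := by
  rw [Cube.volume_eq]
  have := Q.r_pos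
  simp only [ne_eq, ENNReal.ofReal_eq_zero, not_le]
  positivity

theorem Cube.volume_ne_top {n : ℕ} (Q : Cube n) : volume Q.set ≠ ∞ := by
  rw [Cube.volume_eq]; exact ENNReal.ofReal_ne_top

theorem Cube.isCompact {n : ℕ} (Q : Cube n) : IsCompact Q.set := by
  rw [Cube.set_eq]
  have h := (isCompact_closedBall (WithLp.ofLp Q.c) Q.r).image (PiLp.continuous_toLp 2 (fun _ : Fin n => ℝ))
  convert h using 1
  ext y
  constructor
  · intro hy; exact ⟨WithLp.ofLp y, hy, rfl⟩
  · rintro ⟨z, hz, rfl⟩; exact hz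

/-- Concentric dilate by a positive factor. -/
def Cube.dil {n : ℕ} (Q : Cube n) (k : ℝ) (hk : 0 < k) : Cube n := ⟨Q.c, k * Q.r, mul_pos hk Q.r_pos⟩

theorem Cube.volume_dil {n : ℕ} (Q : Cube n) (k : ℝ) (hk : 0 < k) :
    volume (Q.dil k hk).set = ENNReal.ofReal (k ^ n) * volume Q.set := by
  rw [Cube.volume_eq, Cube.volume_eq, ← ENNReal.ofReal_mul (by positivity)]
  congr 1
  simp only [Cube.dil]
  rw [← mul_pow]; ring

theorem Cube.mem_center {n : ℕ} (Q : Cube n) : Q.c ∈ Q.set := by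
  intro i; simp [Q.r_pos.le]

theorem Cube.subset_of {n : ℕ} (Q Q' : Cube n) (h : ∀ i, |Q.c i - Q'.c i| + Q.r ≤ Q'.r) :
    Q.set ⊆ Q'.set := by
  intro y hy i
  have h1 := hy i
  have h2 := h i
  calc |y i - Q'.c i| = |(y i - Q.c i) + (Q.c i - Q'.c i)| := by ring_nf
    _ ≤ |y i - Q.c i| + |Q.c i - Q'.c i| := abs_add_le _ _
    _ ≤ Q'.r := by linarith

/-- Five times dilate. -/
def Cube.five {n : ℕ} (Q : Cube n) : Cube n := Q.dil 5 (by norm_num)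

theorem Cube.volume_five {n : ℕ} (Q : Cube n) : volume Q.five.set = 5 ^ n * volume Q.set := by
  rw [Cube.five, Cube.volume_dil, ENNReal.ofReal_pow (by norm_num)]
  norm_num

theorem Cube.subset_five {n : ℕ} (Q : Cube n) : Q.set ⊆ Q.five.set := by
  apply Cube.subset_of
  intro i
  have := Q.r_pos
  simp only [Cube.five, Cube.dil, sub_self, abs_zero]
  linarith

theorem Cube.vitali {n : ℕ} (t : Set (Cube n)) (R : ℝ) (hR : ∀ Q ∈ t, Q.r ≤ R) :
    ∃ u ⊆ t, u.Countable ∧ u.PairwiseDisjoint Cube.set ∧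
      ∀ Q ∈ t, ∃ Q' ∈ u, Q.set ⊆ Q'.five.set := by
  obtain ⟨u, hut, hd, hc⟩ := Vitali.exists_disjoint_subfamily_covering_enlargement_closedBall
    t (fun Q : Cube n => (WithLp.ofLp Q.c : Fin n → ℝ)) (fun Q => Q.r) R hR 5 (by norm_num)
  have hd' : u.PairwiseDisjoint (fun Q : Cube n => Q.set) := by
    intro Q hQ Q' hQ' hne
    have := hd hQ hQ' hne
    simp only [Function.onFun] at this ⊢
    rw [Cube.set_eq, Cube.set_eq]
    exact this.preimage _
  refine ⟨u, hut, ?_, hd', ?_⟩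
  · have := Measure.countable_meas_pos_of_disjoint_iUnion (μ := (volume : Measure (RSp n)))
      (As := fun Q : u => (Q : Cube n).set) (fun Q => (Q : Cube n).measurableSet)
      (fun Q Q' hne => hd' Q.2 Q'.2 (fun h => hne (Subtype.ext h)))
    have h2 : {i : u | 0 < volume ((i : Cube n)).set} = Set.univ := by
      ext i; simp [pos_iff_ne_zero, Cube.volume_ne_zero]
    rw [h2] at this
    exact Set.countable_coe_iff.mp (Set.countable_univ_iff.mp this)
  · intro Q hQ
    obtain ⟨Q', hQ', hs⟩ := hc Q hQ
    refine ⟨Q', hQ', ?_⟩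
    rw [Cube.set_eq, Cube.set_eq]
    exact Set.preimage_mono hs

/-- Rational cube majorant. -/
def ratCubes (n : ℕ) : Set (Cube n) :=
  {Q | (∃ v : Fin n → ℚ, ∀ i, Q.c i = v i) ∧ ∃ s : ℚ, Q.r = s}

theorem ratCubes_countable (n : ℕ) : (ratCubes n).Countable := by
  have : ratCubes n ⊆ Set.range (fun p : {p : (Fin n → ℚ) × ℚ // 0 < p.2} =>
    (⟨WithLp.toLp 2 (fun i => (p.1.1 i : ℝ)), (p.1.2 : ℝ), by exact_mod_cast p.2⟩ : Cube n)) := by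
    rintro ⟨c, r, hr⟩ ⟨⟨v, hv⟩, s, hs⟩
    simp only at hv hs
    subst hs
    refine ⟨⟨(v, s), by exact_mod_cast hr⟩, ?_⟩
    have : c = WithLp.toLp 2 (fun i => (v i : ℝ)) := by
      ext i
      simp [hv i]
    subst this
    rfl
  exact (Set.countable_range _).mono this

theorem exists_ratCube {n : ℕ} (Q : Cube n) :
    ∃ Q' ∈ ratCubes n, Q.set ⊆ Q'.set ∧ volume Q'.set ≤ 2 ^ n * volume Q.set := by
  have hr := Q.r_pos
  obtain ⟨s, hs1, hs2⟩ := exists_rat_btwn (show Q.r * 3 / 2 < 2 * Q.r by linarith)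
  have : ∀ i, ∃ v : ℚ, |Q.c i - v| < Q.r / 2 := fun i => by
    obtain ⟨v, h1, h2⟩ := exists_rat_btwn (show Q.c i - Q.r / 2 < Q.c i + Q.r/2 by linarith)
    exact ⟨v, by rw [abs_lt]; constructor <;> linarith⟩
  choose v hv using this
  refine ⟨⟨WithLp.toLp 2 (fun i => (v i : ℝ)), s, by linarith⟩, ⟨⟨v, fun i => rfl⟩, s, rfl⟩, ?_, ?_⟩
  · apply Cube.subset_of
    intro i
    have := hv i
    simp only
    linarith
  · rw [Cube.volume_eq, Cube.volume_eq]
    rw [show (2 : ℝ≥0∞) ^ n = ENNReal.ofReal (2 ^ n) by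
      rw [ENNReal.ofReal_pow (by norm_num)]; norm_num, ← ENNReal.ofReal_mul (by positivity), ← mul_pow]
    apply ENNReal.ofReal_le_ofReal
    simp only
    gcongr
    linarith

theorem volume_cube_ineq {n : ℕ} {Q Q' : Cube n} (h : Q.set ⊆ Q'.set) :
    volume Q.set ≤ volume Q'.set := measure_mono h

theorem Cube.integrableOn {n : ℕ} (Q : Cube n) {b : RSp n → ℝ} (hb : LocallyIntegrable b volume) :
    IntegrableOn b Q.set volume := hb.integrableOn_isCompact Q.isCompact

/-- Lebesgue differentiation theorem for cubes centred at the point. -/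
theorem cube_lebesgue {n : ℕ} (F : RSp n → ℝ) (hF : LocallyIntegrable F volume) :
    ∀ᵐ x ∂(volume : Measure (RSp n)), ∀ δ : ℕ → ℝ, (hδ : ∀ k, 0 < δ k) → Tendsto δ atTop (nhds 0) →
      Tendsto (fun k => ⨍ y in (Cube.mk x (δ k) (hδ k)).set, F y) atTop (nhds (F x)) := by
  have hmp := PiLp.volume_preserving_toLp (Fin n)
  have hme : MeasurableEmbedding (@WithLp.toLp 2 (Fin n → ℝ)) :=
    (MeasurableEquiv.toLp 2 (Fin n → ℝ)).measurableEmbedding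
  have hF' : LocallyIntegrable (fun z : Fin n → ℝ => F (WithLp.toLp 2 z)) volume := by
    intro z
    obtain ⟨U, hU, hi⟩ := hF (WithLp.toLp 2 z)
    refine ⟨_, (PiLp.continuous_toLp 2 (fun _ : Fin n => ℝ)).continuousAt.preimage_mem_nhds hU, ?_⟩
    exact (hmp.integrableOn_comp_preimage hme).2 hi
  have key := IsUnifLocDoublingMeasure.ae_tendsto_average (μ := (volume : Measure (Fin n → ℝ))) hF' 1
  have := (PiLp.volume_preserving_ofLp (Fin n)).quasiMeasurePreserving.ae key
  filter_upwards [this] with x hx δ hδ hlim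
  have h1 := hx (fun _ : ℕ => WithLp.ofLp x) δ
    (tendsto_nhdsWithin_iff.2 ⟨hlim, Eventually.of_forall hδ⟩)
    (Eventually.of_forall fun k => by simp [(hδ k).le])
  refine h1.congr fun k => ?_
  rw [setAverage_eq, setAverage_eq]
  have e : Metric.closedBall (WithLp.ofLp x) (δ k) =
      (@WithLp.toLp 2 (Fin n → ℝ)) ⁻¹' (Cube.mk x (δ k) (hδ k)).set := by
    rw [Cube.set_eq]; rfl
  rw [e, hmp.setIntegral_preimage_emb hme]
  congr 2
  rw [measureReal_def, measureReal_def, hmp.measure_preimage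
    (Cube.measurableSet _).nullMeasurableSet]



/-- Countable maximal operator relative to a measure. -/
noncomputable def maxOp {n : ℕ} (μ : Measure (RSp n)) (f : RSp n → ℝ≥0∞) (x : RSp n) : ℝ≥0∞ :=
  ⨆ Q ∈ ratCubes n, Q.set.indicator (fun _ => (μ Q.set)⁻¹ * ∫⁻ y in Q.set, f y ∂μ) x

theorem measurable_maxOp {n : ℕ} (μ : Measure (RSp n)) (f : RSp n → ℝ≥0∞) :
    Measurable (maxOp μ f) :=
  Measurable.biSup _ (ratCubes_countable n) fun Q _ => measurable_const.indicator Q.measurableSet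

theorem le_maxOp {n : ℕ} (μ : Measure (RSp n)) (f : RSp n → ℝ≥0∞) {x : RSp n} {Q : Cube n}
    (hQ : Q ∈ ratCubes n) (hx : x ∈ Q.set) :
    (μ Q.set)⁻¹ * ∫⁻ y in Q.set, f y ∂μ ≤ maxOp μ f x := by
  refine le_trans ?_ (le_iSup₂ (f := fun (Q : Cube n) (_ : Q ∈ ratCubes n) =>
    Q.set.indicator (fun _ => (μ Q.set)⁻¹ * ∫⁻ y in Q.set, f y ∂μ) x) Q hQ)
  simp [hx]

theorem lt_maxOp {n : ℕ} (μ : Measure (RSp n)) (f : RSp n → ℝ≥0∞) {x : RSp n} {t : ℝ≥0∞}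
    (h : t < maxOp μ f x) : ∃ Q ∈ ratCubes n, x ∈ Q.set ∧ t < (μ Q.set)⁻¹ * ∫⁻ y in Q.set, f y ∂μ := by
  simp only [maxOp, lt_iSup_iff] at h
  obtain ⟨Q, hQ, h⟩ := h
  by_cases hx : x ∈ Q.set
  · exact ⟨Q, hQ, hx, by simpa [hx] using h⟩
  · simp [hx] at h

theorem maxOp_weak {n : ℕ} (μ : Measure (RSp n)) (D : ℝ≥0∞)
    (hD : ∀ Q : Cube n, μ Q.five.set ≤ D * μ Q.set)
    (f : RSp n → ℝ≥0∞) (t : ℝ≥0∞) :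
    t * μ {x | t < maxOp μ f x} ≤ D * ∫⁻ x, f x ∂μ := by
  set E : ℕ → Set (RSp n) := fun R => {x | ∃ Q ∈ ratCubes n, Q.r ≤ R ∧ x ∈ Q.set ∧
    t < (μ Q.set)⁻¹ * ∫⁻ y in Q.set, f y ∂μ} with hE
  have hsub : {x | t < maxOp μ f x} ⊆ ⋃ R, E R := by
    intro x hx
    obtain ⟨Q, hQ, hxQ, h⟩ := lt_maxOp μ f hx
    obtain ⟨R, hR⟩ := exists_nat_ge Q.r
    exact mem_iUnion.2 ⟨R, Q, hQ, hR, hxQ, h⟩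
  have hmono : Monotone E := by
    rintro R R' hRR x ⟨Q, hQ, hR, h⟩
    exact ⟨Q, hQ, hR.trans (by exact_mod_cast hRR), h⟩
  have hER : ∀ R, t * μ (E R) ≤ D * ∫⁻ x, f x ∂μ := by
    intro R
    obtain ⟨u, hut, huc, hud, hcov⟩ := Cube.vitali
      {Q : Cube n | Q ∈ ratCubes n ∧ Q.r ≤ R ∧ t < (μ Q.set)⁻¹ * ∫⁻ y in Q.set, f y ∂μ} R
      (fun Q hQ => hQ.2.1)
    have h1 : E R ⊆ ⋃ Q ∈ u, Q.five.set := by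
      rintro x ⟨Q, hQ, hR, hx, h⟩
      obtain ⟨Q', hQ', hs⟩ := hcov Q ⟨hQ, hR, h⟩
      exact mem_biUnion hQ' (hs hx)
    have := huc.to_subtype
    calc t * μ (E R) ≤ t * ∑' Q : u, μ (Q : Cube n).five.set := by
          gcongr
          exact (measure_mono h1).trans (measure_biUnion_le μ huc _)
      _ ≤ t * ∑' Q : u, D * μ (Q : Cube n).set := by
          gcongr
          exact hD _
      _ = ∑' Q : u, D * (t * μ (Q : Cube n).set) := by
          rw [← ENNReal.tsum_mul_left]
          congr 1; ext Q; ring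
      _ ≤ ∑' Q : u, D * ∫⁻ y in (Q : Cube n).set, f y ∂μ := by
          gcongr with Q
          have := (hut Q.2).2.2
          calc t * μ (Q : Cube n).set ≤ ((μ (Q : Cube n).set)⁻¹ * ∫⁻ y in (Q : Cube n).set, f y ∂μ) * μ (Q : Cube n).set := by
                gcongr
            _ = ((μ (Q : Cube n).set)⁻¹ * μ (Q : Cube n).set) * ∫⁻ y in (Q : Cube n).set, f y ∂μ := by ring
            _ ≤ 1 * _ := by gcongr; exact ENNReal.inv_mul_le_one _
            _ = _ := one_mul _
      _ = D * ∑' Q : u, ∫⁻ y in (Q : Cube n).set, f y ∂μ := ENNReal.tsum_mul_left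
      _ = D * ∫⁻ y in ⋃ Q ∈ u, Q.set, f y ∂μ := by
          rw [lintegral_biUnion huc (fun Q _ => Q.measurableSet) hud]
      _ ≤ _ := by
          exact mul_le_mul_right (setLIntegral_le_lintegral _ _) D
  calc t * μ {x | t < maxOp μ f x} ≤ t * μ (⋃ R, E R) := by gcongr
    _ = ⨆ R, t * μ (E R) := by rw [hmono.measure_iUnion, ENNReal.mul_iSup]
    _ ≤ _ := iSup_le hER

theorem maxOp_weak2 {n : ℕ} (μ : Measure (RSp n)) (D : ℝ≥0∞)
    (hD : ∀ Q : Cube n, μ Q.five.set ≤ D * μ Q.set)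
    (f : RSp n → ℝ≥0∞) (t : ℝ≥0∞) (ht : t ≠ ∞) :
    t * μ {x | 2 * t < maxOp μ f x} ≤ D * ∫⁻ x, {x | t < f x}.indicator f x ∂μ := by
  refine le_trans ?_ (maxOp_weak μ D hD _ t)
  refine mul_le_mul_right (measure_mono ?_) t
  intro x hx
  obtain ⟨Q, hQ, hxQ, h⟩ := lt_maxOp μ f hx
  refine lt_of_lt_of_le ?_ (le_maxOp μ _ hQ hxQ)
  have h1 : ∫⁻ y in Q.set, f y ∂μ ≤ ∫⁻ y in Q.set, {x | t < f x}.indicator f y ∂μ + t * μ Q.set := by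
    calc _ ≤ ∫⁻ y in Q.set, ({x | t < f x}.indicator f y + t) ∂μ := by
          apply lintegral_mono
          intro y
          by_cases hy : t < f y
          · simp [indicator, hy]
          · show f y ≤ {x | t < f x}.indicator f y + t
            rw [indicator_of_notMem (by exact hy), zero_add]; exact not_lt.1 hy
      _ = _ := by
          rw [lintegral_add_right _ measurable_const]; simp
  have h2 : 2 * t < (μ Q.set)⁻¹ * ∫⁻ y in Q.set, {x | t < f x}.indicator f y ∂μ + t := by
    refine h.trans_le ?_
    calc _ ≤ (μ Q.set)⁻¹ * (∫⁻ y in Q.set, {x | t < f x}.indicator f y ∂μ + t * μ Q.set) := by gcongr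
      _ = (μ Q.set)⁻¹ * ∫⁻ y in Q.set, {x | t < f x}.indicator f y ∂μ + t * ((μ Q.set)⁻¹ * μ Q.set) := by ring
      _ ≤ _ := by
        gcongr
        calc t * ((μ Q.set)⁻¹ * μ Q.set) ≤ t * 1 := by gcongr; exact ENNReal.inv_mul_le_one _
          _ = t := mul_one t
  rw [two_mul] at h2
  exact (ENNReal.add_lt_add_iff_right ht).1 h2

theorem exists_dyadic {v : ℝ≥0∞} (h0 : v ≠ 0) (h1 : v ≠ ∞) :
    ∃ k : ℤ, (2 : ℝ≥0∞) ^ (k : ℝ) < v ∧ v ≤ (2 : ℝ≥0∞) ^ ((k : ℝ) + 1) := by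
  obtain ⟨k, hk⟩ := ENNReal.exists_mem_Ioc_zpow h0 h1 (y := 2) (by norm_num) (by norm_num)
  refine ⟨k, ?_, ?_⟩
  · rw [ENNReal.rpow_intCast]; exact hk.1
  · have := hk.2
    rw [← ENNReal.rpow_intCast] at this
    simpa using this

theorem rpow_le_dyadic_sum (v : ℝ≥0∞) (s : ℝ) (hs : 0 < s) :
    v ^ s ≤ ∑' k : ℤ, {v | (2 : ℝ≥0∞) ^ ((k : ℝ) + 1) < v}.indicator
      (fun _ => (2 : ℝ≥0∞) ^ (((k : ℝ) + 2) * s)) v := by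
  by_cases h0 : v = 0
  · simp [h0, hs]
  by_cases h1 : v = ∞
  · subst h1
    have : ∀ k : ℤ, (2 : ℝ≥0∞) ^ (((k : ℝ) + 2) * s) ≤ ∑' k : ℤ, {v | (2 : ℝ≥0∞) ^ ((k : ℝ) + 1) < v}.indicator
      (fun _ => (2 : ℝ≥0∞) ^ (((k : ℝ) + 2) * s)) ∞ := by
      intro k
      refine le_trans ?_ (ENNReal.le_tsum k)
      rw [indicator_of_mem]
      show (2 : ℝ≥0∞) ^ ((k : ℝ) + 1) < ∞
      exact lt_top_iff_ne_top.2 (by simp)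
    have h2 : ∑' k : ℤ, {v | (2 : ℝ≥0∞) ^ ((k : ℝ) + 1) < v}.indicator
      (fun _ => (2 : ℝ≥0∞) ^ (((k : ℝ) + 2) * s)) ∞ = ∞ := by
      apply ENNReal.eq_top_of_forall_nnreal_le
      intro r
      obtain ⟨k, hk⟩ := pow_unbounded_of_one_lt (r : ℝ) (show (1 : ℝ) < 2 ^ s from
        Real.one_lt_rpow (by norm_num) hs)
      refine le_trans ?_ (this k)
      rw [show (2 : ℝ≥0∞) = ((2 : ℝ≥0) : ℝ≥0∞) by norm_num, ← ENNReal.coe_rpow_of_ne_zero (by norm_num)]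
      rw [ENNReal.coe_le_coe, ← NNReal.coe_le_coe, NNReal.coe_rpow]
      refine hk.le.trans ?_
      rw [← Real.rpow_natCast, ← Real.rpow_mul (by norm_num)]
      simp only [NNReal.coe_ofNat]
      apply Real.rpow_le_rpow_of_exponent_le (by norm_num)
      push_cast
      nlinarith
    rw [h2]; exact le_top
  obtain ⟨k, hk1, hk2⟩ := exists_dyadic h0 h1
  refine le_trans ?_ (ENNReal.le_tsum (k - 1))
  rw [indicator_of_mem (by simpa using hk1)]
  rw [ENNReal.rpow_mul]
  apply ENNReal.rpow_le_rpow _ hs.le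
  refine hk2.trans (le_of_eq ?_)
  push_cast; ring_nf

theorem dyadic_sum_le (s : ℝ) (hs : 0 < s) : ∃ C : ℝ≥0, ∀ v : ℝ≥0∞,
    ∑' k : ℤ, {v | (2 : ℝ≥0∞) ^ (k : ℝ) < v}.indicator
      (fun _ => (2 : ℝ≥0∞) ^ ((k : ℝ) * s)) v ≤ C * v ^ s := by
  set q : ℝ≥0 := (2 : ℝ≥0) ^ (-s) with hq
  have hq1 : q < 1 := NNReal.rpow_lt_one_of_one_lt_of_neg (by norm_num) (by linarith)
  refine ⟨(1 - q)⁻¹, fun v => ?_⟩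
  have hCpos : ((1 - q)⁻¹ : ℝ≥0) ≠ 0 := by
    rw [ne_eq, inv_eq_zero]; exact (tsub_pos_of_lt hq1).ne'
  by_cases h0 : v = 0
  · simp [h0, hs]
  by_cases h1 : v = ∞
  · subst h1
    rw [ENNReal.top_rpow_of_pos hs, ENNReal.mul_top (by exact_mod_cast hCpos)]
    exact le_top
  obtain ⟨K, hk1, hk2⟩ := exists_dyadic h0 h1
  have hinj : Function.Injective (fun j : ℕ => K - (j : ℤ)) := fun a b h => by simpa using h
  rw [← hinj.tsum_eq]
  · calc ∑' j : ℕ, {v | (2 : ℝ≥0∞) ^ ((K - (j : ℤ) : ℤ) : ℝ) < v}.indicator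
            (fun _ => (2 : ℝ≥0∞) ^ (((K - (j : ℤ) : ℤ) : ℝ) * s)) v
          ≤ ∑' j : ℕ, v ^ s * (q : ℝ≥0∞) ^ j := by
          gcongr with j
          refine (indicator_le_self' (fun _ _ => by simp) v).trans ?_
          have : (2 : ℝ≥0∞) ^ (((K - (j : ℤ) : ℤ) : ℝ) * s) = ((2 : ℝ≥0∞) ^ (K : ℝ)) ^ s * (q : ℝ≥0∞) ^ j := by
            rw [hq, ENNReal.coe_rpow_of_ne_zero (by norm_num), ← ENNReal.rpow_natCast, ← ENNReal.rpow_mul,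
              ← ENNReal.rpow_mul]
            rw [show ((2 : ℝ≥0) : ℝ≥0∞) = 2 by norm_num, ← ENNReal.rpow_add _ _ (by norm_num) (by norm_num)]
            push_cast; ring_nf
          rw [this]
          gcongr
      _ = ((1 - q)⁻¹ : ℝ≥0) * v ^ s := by
          rw [ENNReal.tsum_mul_left, ENNReal.tsum_geometric, mul_comm]
          congr 1
          rw [ENNReal.coe_inv (tsub_pos_of_lt hq1).ne']
          push_cast; rfl
  · intro k hk
    simp only [Function.mem_support, ne_eq, indicator_apply_eq_zero, not_forall] at hk
    obtain ⟨hk, -⟩ := hk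
    have hk' : (2 : ℝ≥0∞) ^ (k : ℝ) < (2 : ℝ≥0∞) ^ ((K : ℝ) + 1) := lt_of_lt_of_le hk hk2
    have : k < K + 1 := by
      by_contra hcon
      push Not at hcon
      have : ((K : ℝ) + 1) ≤ k := by exact_mod_cast hcon
      exact absurd (ENNReal.rpow_le_rpow_of_exponent_le (show (1 : ℝ≥0∞) ≤ 2 by norm_num) this) (not_le.2 hk')
    exact ⟨(K - k).toNat, by simp; omega⟩

theorem maxOp_strong {n : ℕ} (D : ℝ≥0) (s : ℝ) (hs : 1 < s) : ∃ C : ℝ≥0,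
    ∀ μ : Measure (RSp n), (∀ Q : Cube n, μ Q.five.set ≤ D * μ Q.set) →
    ∀ f : RSp n → ℝ≥0∞, AEMeasurable f μ →
    ∫⁻ x, maxOp μ f x ^ s ∂μ ≤ C * ∫⁻ x, f x ^ s ∂μ := by
  obtain ⟨C, hC⟩ := dyadic_sum_le (s - 1) (by linarith)
  refine ⟨2 ^ (2 * s) * D * C, fun μ hD f hf => ?_⟩
  have hm := measurable_maxOp μ f
  have hmeas : ∀ t : ℝ≥0∞, NullMeasurableSet {x | t < f x} μ := fun t =>
    nullMeasurableSet_lt aemeasurable_const hf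
  calc ∫⁻ x, maxOp μ f x ^ s ∂μ ≤ ∫⁻ x, ∑' k : ℤ, {v | (2 : ℝ≥0∞) ^ ((k : ℝ) + 1) < v}.indicator
          (fun _ => (2 : ℝ≥0∞) ^ (((k : ℝ) + 2) * s)) (maxOp μ f x) ∂μ :=
        lintegral_mono fun x => rpow_le_dyadic_sum _ _ (by linarith)
    _ = ∑' k : ℤ, ∫⁻ x, {v | (2 : ℝ≥0∞) ^ ((k : ℝ) + 1) < v}.indicator
          (fun _ => (2 : ℝ≥0∞) ^ (((k : ℝ) + 2) * s)) (maxOp μ f x) ∂μ := by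
        apply lintegral_tsum
        intro k
        exact ((measurable_const.indicator measurableSet_Ioi).comp hm).aemeasurable
    _ = ∑' k : ℤ, (2 : ℝ≥0∞) ^ (((k : ℝ) + 2) * s) * μ {x | (2 : ℝ≥0∞) ^ ((k : ℝ) + 1) < maxOp μ f x} := by
        congr 1; ext k
        exact lintegral_indicator_const (μ := μ)
          (s := {x | (2 : ℝ≥0∞) ^ ((k : ℝ) + 1) < maxOp μ f x})
          (measurableSet_lt measurable_const hm) ((2 : ℝ≥0∞) ^ (((k : ℝ) + 2) * s))
    _ ≤ ∑' k : ℤ, (2 : ℝ≥0∞) ^ (2 * s) * D * ∫⁻ x, (2 : ℝ≥0∞) ^ ((k : ℝ) * (s - 1)) * {x | (2 : ℝ≥0∞) ^ (k : ℝ) < f x}.indicator f x ∂μ := by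
        refine ENNReal.tsum_le_tsum fun k => ?_
        have h := maxOp_weak2 μ D hD f ((2 : ℝ≥0∞) ^ (k : ℝ))
          (ENNReal.rpow_ne_top_of_ne_zero (by norm_num) (by norm_num))
        rw [show 2 * (2 : ℝ≥0∞) ^ (k : ℝ) = (2 : ℝ≥0∞) ^ ((k : ℝ) + 1) by
          rw [ENNReal.rpow_add _ _ (by norm_num) (by norm_num), ENNReal.rpow_one, mul_comm]] at h
        rw [lintegral_const_mul' _ _ (by simp)]
        calc (2 : ℝ≥0∞) ^ (((k : ℝ) + 2) * s) * μ {x | (2 : ℝ≥0∞) ^ ((k : ℝ) + 1) < maxOp μ f x}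
            = (2 : ℝ≥0∞) ^ (2 * s) * (2 : ℝ≥0∞) ^ ((k : ℝ) * (s - 1)) * ((2 : ℝ≥0∞) ^ (k : ℝ) * μ {x | (2 : ℝ≥0∞) ^ ((k : ℝ) + 1) < maxOp μ f x}) := by
              rw [← mul_assoc, ← ENNReal.rpow_add _ _ (by norm_num) (by norm_num), ← ENNReal.rpow_add _ _ (by norm_num) (by norm_num)]
              ring_nf
          _ ≤ (2 : ℝ≥0∞) ^ (2 * s) * (2 : ℝ≥0∞) ^ ((k : ℝ) * (s - 1)) * (D * ∫⁻ x, {x | (2 : ℝ≥0∞) ^ (k : ℝ) < f x}.indicator f x ∂μ) := by gcongr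
          _ = _ := by ring
    _ = (2 : ℝ≥0∞) ^ (2 * s) * D * ∫⁻ x, ∑' k : ℤ, (2 : ℝ≥0∞) ^ ((k : ℝ) * (s - 1)) * {x | (2 : ℝ≥0∞) ^ (k : ℝ) < f x}.indicator f x ∂μ := by
        rw [ENNReal.tsum_mul_left, lintegral_tsum]
        intro k
        exact (hf.indicator₀ (hmeas _)).const_mul _
    _ ≤ (2 : ℝ≥0∞) ^ (2 * s) * D * ∫⁻ x, C * f x ^ s ∂μ := by
        gcongr with x
        have : ∀ k : ℤ, (2 : ℝ≥0∞) ^ ((k : ℝ) * (s - 1)) * {x | (2 : ℝ≥0∞) ^ (k : ℝ) < f x}.indicator f x =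
          f x * {v | (2 : ℝ≥0∞) ^ (k : ℝ) < v}.indicator (fun _ => (2 : ℝ≥0∞) ^ ((k : ℝ) * (s - 1))) (f x) := by
          intro k
          by_cases h : (2 : ℝ≥0∞) ^ (k : ℝ) < f x
          · rw [indicator_of_mem (by exact h), indicator_of_mem (by exact h), mul_comm]
          · rw [indicator_of_notMem (by exact h), indicator_of_notMem (by exact h), mul_zero,
              mul_zero]
        simp_rw [this]
        rw [ENNReal.tsum_mul_left]
        calc f x * _ ≤ f x * (C * f x ^ (s - 1)) := by gcongr; exact hC _
          _ = C * (f x * f x ^ (s - 1)) := by ring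
          _ = C * f x ^ s := by
            congr 1
            nth_rw 1 [← ENNReal.rpow_one (f x)]
            rw [← ENNReal.rpow_add_of_nonneg _ _ (by norm_num) (by linarith)]
            congr 1; ring
    _ = _ := by
        rw [lintegral_const_mul' _ _ (by simp)]
        push_cast
        rw [ENNReal.coe_rpow_of_ne_zero (by norm_num)]
        push_cast; ring



theorem Cube.real_pos {n : ℕ} (Q : Cube n) : 0 < volume.real Q.set :=
  ENNReal.toReal_pos Q.volume_ne_zero Q.volume_ne_top

theorem Cube.ofReal_real {n : ℕ} (Q : Cube n) : ENNReal.ofReal (volume.real Q.set) = volume Q.set :=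
  ENNReal.ofReal_toReal Q.volume_ne_top

theorem Cube.real_dil {n : ℕ} (Q : Cube n) (k : ℝ) (hk : 0 < k) :
    volume.real (Q.dil k hk).set = k ^ n * volume.real Q.set := by
  rw [Measure.real, Cube.volume_dil, ENNReal.toReal_mul, ENNReal.toReal_ofReal (by positivity)]
  rfl

theorem Cube.integrableOn_abs_sub {n : ℕ} (Q : Cube n) {b : RSp n → ℝ}
    (hb : LocallyIntegrable b volume) (c : ℝ) :
    IntegrableOn (fun y => |b y - c|) Q.set volume :=
  ((Q.integrableOn hb).sub (integrableOn_const Q.volume_ne_top)).abs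

theorem cubeAvg_mul {n : ℕ} (Q : Cube n) (b : RSp n → ℝ) :
    cubeAvg Q b * volume.real Q.set = ∫ y in Q.set, b y := by
  rw [cubeAvg, setAverage_eq, smul_eq_mul]
  have := Q.real_pos.ne'
  field_simp

theorem abs_avg_sub_le {n : ℕ} (Q : Cube n) {b : RSp n → ℝ}
    (hb : LocallyIntegrable b volume) (c : ℝ) :
    |cubeAvg Q b - c| * volume.real Q.set ≤ ∫ y in Q.set, |b y - c| := by
  have h0 : |cubeAvg Q b - c| * volume.real Q.set =
      |cubeAvg Q b * volume.real Q.set - c * volume.real Q.set| := by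
    rw [← sub_mul, abs_mul, abs_of_pos Q.real_pos]
  rw [h0, cubeAvg_mul]
  have h1 : c * volume.real Q.set = ∫ y in Q.set, c := by
    rw [setIntegral_const, smul_eq_mul, mul_comm]
  rw [h1, ← integral_sub (Q.integrableOn hb) (integrableOn_const Q.volume_ne_top)]
  exact abs_integral_le_integral_abs

theorem osc_le {n : ℕ} {b : RSp n → ℝ} (hb : LocallyIntegrable b volume) {K : ℝ}
    (hK : ∀ Q : Cube n, ∫ y in Q.set, |b y - cubeAvg Q b| ≤ K * volume.real Q.set)
    {Q Q' : Cube n} (h : Q.set ⊆ Q'.set) :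
    |cubeAvg Q b - cubeAvg Q' b| * volume.real Q.set ≤ K * volume.real Q'.set := by
  refine (abs_avg_sub_le Q hb _).trans (le_trans ?_ (hK Q'))
  exact setIntegral_mono_set (Q'.integrableOn_abs_sub hb _) (by filter_upwards with x; positivity)
    h.eventuallyLE

theorem osc_dil_le {n : ℕ} {b : RSp n → ℝ} (hb : LocallyIntegrable b volume) {K : ℝ}
    (hK : ∀ Q : Cube n, ∫ y in Q.set, |b y - cubeAvg Q b| ≤ K * volume.real Q.set)
    (Q : Cube n) (k : ℝ) (hk : 1 ≤ k) (hk0 : 0 < k) :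
    |cubeAvg Q b - cubeAvg (Q.dil k hk0) b| ≤ K * k ^ n := by
  have hs : Q.set ⊆ (Q.dil k hk0).set := by
    apply Cube.subset_of
    intro i
    have := Q.r_pos
    simp only [Cube.dil, sub_self, abs_zero]
    nlinarith
  have := osc_le hb hK hs
  rw [Cube.real_dil] at this
  have h2 := Q.real_pos
  rw [← mul_assoc] at this
  exact le_of_mul_le_mul_right this h2

/-- The distribution function of the oscillation. -/
noncomputable def jnF {n : ℕ} (b : RSp n → ℝ) (lam : ℝ) : ℝ≥0∞ :=
  ⨆ Q : Cube n, (volume Q.set)⁻¹ * volume (Q.set ∩ {x | lam < |b x - cubeAvg Q b|})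

theorem le_jnF {n : ℕ} (b : RSp n → ℝ) (lam : ℝ) (Q : Cube n) :
    volume (Q.set ∩ {x | lam < |b x - cubeAvg Q b|}) ≤ jnF b lam * volume Q.set := by
  have := le_iSup (fun Q : Cube n => (volume Q.set)⁻¹ * volume (Q.set ∩ {x | lam < |b x - cubeAvg Q b|})) Q
  rw [← ENNReal.div_eq_inv_mul] at this
  rw [mul_comm]
  exact (ENNReal.div_le_iff' Q.volume_ne_zero Q.volume_ne_top).1 this

theorem jnF_le_one {n : ℕ} (b : RSp n → ℝ) (lam : ℝ) : jnF b lam ≤ 1 := by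
  refine iSup_le fun Q => ?_
  rw [← ENNReal.div_eq_inv_mul]
  refine ENNReal.div_le_of_le_mul ?_
  rw [one_mul]
  exact measure_mono inter_subset_left

theorem jn_step {n : ℕ} {b : RSp n → ℝ} (hb : LocallyIntegrable b volume) {K : ℝ} (hK0 : 0 ≤ K)
    (hK : ∀ Q : Cube n, ∫ y in Q.set, |b y - cubeAvg Q b| ≤ K * volume.real Q.set)
    (A : ℝ) (hA : 4 * 20 ^ n * (K + 1) ≤ A) (lam : ℝ) (hl : 0 ≤ lam) :
    jnF b (lam + A) ≤ jnF b lam / 2 := by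
  have hApos : 0 < A := lt_of_lt_of_le (by positivity) hA
  refine iSup_le fun B => ?_
  rw [← ENNReal.div_eq_inv_mul]
  refine ENNReal.div_le_of_le_mul ?_
  set c := cubeAvg B b with hc
  have hBr := B.r_pos
  set B2 := B.dil 2 (by norm_num) with hB2
  have hBv := B.real_pos
  -- integral over the double
  have hI2 : ∫ y in B2.set, |b y - c| ≤ 2 * 4 ^ n * K * volume.real B.set := by
    have h1 : ∫ y in B2.set, |b y - c| ≤ ∫ y in B2.set, (|b y - cubeAvg B2 b| + |cubeAvg B2 b - c|) := by
      apply setIntegral_mono (B2.integrableOn_abs_sub hb _)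
        ((B2.integrableOn_abs_sub hb _).add (integrableOn_const B2.volume_ne_top))
      intro y
      exact abs_sub_le _ _ _
    have h2 : ∫ y in B2.set, (|b y - cubeAvg B2 b| + |cubeAvg B2 b - c|) =
        (∫ y in B2.set, |b y - cubeAvg B2 b|) + |cubeAvg B2 b - c| * volume.real B2.set := by
      rw [integral_add (B2.integrableOn_abs_sub hb _) (integrableOn_const B2.volume_ne_top),
        setIntegral_const, smul_eq_mul]
      ring
    have h3 := hK B2
    have h4 := osc_dil_le hb hK B 2 (by norm_num) (by norm_num)
    rw [abs_sub_comm] at h4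
    have h5 : volume.real B2.set = 2 ^ n * volume.real B.set := Cube.real_dil _ _ _
    rw [h2] at h1
    rw [h5] at h1 h3
    have h6 : |cubeAvg B2 b - c| * (2 ^ n * volume.real B.set) ≤ K * 2 ^ n * (2 ^ n * volume.real B.set) := by
      apply mul_le_mul_of_nonneg_right h4; positivity
    have h7 : (4 : ℝ) ^ n = 2 ^ n * 2 ^ n := by rw [← mul_pow]; norm_num
    have h8 : (1 : ℝ) ≤ 2 ^ n := one_le_pow₀ (by norm_num)
    have h9 : K * (2 ^ n * volume.real B.set) ≤ K * (4 ^ n * volume.real B.set) := by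
      rw [h7]; gcongr; nlinarith
    rw [h7] at *
    nlinarith
  set t : Set (Cube n) := {Q | Q.set ⊆ B2.set ∧ A * volume.real Q.set < ∫ y in Q.set, |b y - c| ∧
    |cubeAvg Q.five b - c| ≤ A ∧ Q.r ≤ B.r} with ht
  obtain ⟨u, hut, huc, hud, hcov⟩ := Cube.vitali t B.r (fun Q hQ => hQ.2.2.2)
  have hloc : LocallyIntegrable (fun y => |b y - c|) volume :=
    fun x => (hb.sub (locallyIntegrable_const c) x).norm
  have hcover : ∀ᵐ x ∂(volume : Measure (RSp n)), x ∈ B.set ∩ {x | lam + A < |b x - c|} →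
      x ∈ ⋃ Q ∈ u, (Q.five.set ∩ {x | lam < |b x - cubeAvg Q.five b|}) := by
    filter_upwards [cube_lebesgue _ hloc] with x hx hxB
    obtain ⟨hxB, hxl⟩ := hxB
    have hxl : lam + A < |b x - c| := hxl
    set δ : ℕ → ℝ := fun k => B.r * (1 / 5) ^ k with hδ
    have hδpos : ∀ k, 0 < δ k := fun k => by positivity
    have hδle : ∀ k, δ k ≤ B.r := fun k => by
      have : ((1 : ℝ) / 5) ^ k ≤ 1 := pow_le_one₀ (by norm_num) (by norm_num)
      simp only [hδ]; nlinarith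
    have hδlim : Tendsto δ atTop (nhds 0) := by
      have := (_root_.tendsto_pow_atTop_nhds_zero_of_lt_one (r := (1 : ℝ) / 5) (by norm_num) (by norm_num)).const_mul B.r
      simpa [hδ] using this
    have hlim := hx δ hδpos hδlim
    have hex : ∃ k, A < ⨍ y in (Cube.mk x (δ k) (hδpos k)).set, |b y - c| :=
      ((hlim.eventually (lt_mem_nhds (show A < |b x - c| by linarith))).exists)
    classical
    set k := Nat.find hex with hk
    have hk1 := Nat.find_spec hex
    rw [← hk] at hk1
    have hsub : ∀ k, (Cube.mk x (δ k) (hδpos k)).set ⊆ B2.set := fun k => by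
      apply Cube.subset_of
      intro i
      have h1 := hxB i
      have h2 := hδle k
      simp only [hB2, Cube.dil]
      linarith
    have havg : ∀ Q : Cube n, (⨍ y in Q.set, |b y - c|) * volume.real Q.set = ∫ y in Q.set, |b y - c| :=
      fun Q => cubeAvg_mul Q _
    have hk0 : k ≠ 0 := by
      intro h0
      rw [h0] at hk1
      set Q0 := Cube.mk x (δ 0) (hδpos 0)
      have h1 : volume.real Q0.set = volume.real B.set := by
        rw [Measure.real, Measure.real, Cube.volume_eq, Cube.volume_eq]
        simp [Q0, hδ]
      have h2 : ∫ y in Q0.set, |b y - c| ≤ ∫ y in B2.set, |b y - c| :=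
        setIntegral_mono_set (B2.integrableOn_abs_sub hb _) (by filter_upwards with x; positivity)
          (hsub 0).eventuallyLE
      rw [← havg, h1] at h2
      have h3 : (⨍ y in Q0.set, |b y - c|) ≤ 2 * 4 ^ n * K := by
        exact le_of_mul_le_mul_right (h2.trans hI2) hBv
      have h4 : (4 : ℝ) ^ n ≤ 20 ^ n := by gcongr; norm_num
      have : 2 * 4 ^ n * K ≤ 4 * 20 ^ n * (K + 1) := by
        have : (0 : ℝ) < 4 ^ n := by positivity
        nlinarith
      linarith
    obtain ⟨j, hj⟩ := Nat.exists_eq_succ_of_ne_zero hk0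
    have hj1 : (⨍ y in (Cube.mk x (δ j) (hδpos j)).set, |b y - c|) ≤ A := by
      have := Nat.find_min hex (m := j) (by rw [← hk]; omega)
      exact not_lt.1 this
    set Q := Cube.mk x (δ k) (hδpos k) with hQ
    have hQ5 : Q.five = Cube.mk x (δ j) (hδpos j) := by
      simp only [Cube.five, Cube.dil, hQ, Cube.mk.injEq, true_and, hδ, hj, pow_succ]
      ring
    have hQt : Q ∈ t := by
      refine ⟨hsub k, ?_, ?_, hδle k⟩
      · rw [← havg]
        exact mul_lt_mul_of_pos_right hk1 Q.real_pos
      · have h1 := abs_avg_sub_le Q.five hb c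
        rw [← havg] at h1
        rw [hQ5] at h1 ⊢
        exact (le_of_mul_le_mul_right h1 (Cube.real_pos _)).trans hj1
    obtain ⟨Q', hQ'u, hQQ'⟩ := hcov Q hQt
    refine mem_biUnion hQ'u ⟨hQQ' Q.mem_center, ?_⟩
    have h2 := (hut hQ'u).2.2.1
    show lam < |b x - cubeAvg Q'.five b|
    have := abs_sub_le (b x) (cubeAvg Q'.five b) c
    linarith
  have hsum : ∑' Q : u, volume (Q : Cube n).set ≤
      ENNReal.ofReal ((5 ^ n)⁻¹ / 2) * volume B.set := by
    have h1 : ∀ Q : u, volume (Q : Cube n).set ≤ ENNReal.ofReal A⁻¹ * ∫⁻ y in (Q : Cube n).set, ENNReal.ofReal |b y - c| := by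
      intro Q
      have h2 := (hut Q.2).2.1
      rw [← ofReal_integral_eq_lintegral_ofReal ((Q : Cube n).integrableOn_abs_sub hb _)
        (by filter_upwards with x; positivity), ← ENNReal.ofReal_mul (by positivity),
        ← Cube.ofReal_real]
      apply ENNReal.ofReal_le_ofReal
      rw [inv_mul_eq_div, le_div_iff₀ hApos, mul_comm]
      exact h2.le
    have := huc.to_subtype
    calc ∑' Q : u, volume (Q : Cube n).set ≤ ∑' Q : u, ENNReal.ofReal A⁻¹ * ∫⁻ y in (Q : Cube n).set, ENNReal.ofReal |b y - c| :=
          ENNReal.tsum_le_tsum h1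
      _ = ENNReal.ofReal A⁻¹ * ∑' Q : u, ∫⁻ y in (Q : Cube n).set, ENNReal.ofReal |b y - c| := ENNReal.tsum_mul_left
      _ = ENNReal.ofReal A⁻¹ * ∫⁻ y in ⋃ Q ∈ u, Q.set, ENNReal.ofReal |b y - c| := by
          rw [lintegral_biUnion huc (fun Q _ => Q.measurableSet) hud]
      _ ≤ ENNReal.ofReal A⁻¹ * ∫⁻ y in B2.set, ENNReal.ofReal |b y - c| := by
          refine mul_le_mul_right (lintegral_mono_set ?_) _
          exact iUnion₂_subset fun Q hQ => (hut hQ).1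
      _ ≤ _ := by
          rw [← ofReal_integral_eq_lintegral_ofReal (B2.integrableOn_abs_sub hb _)
            (by filter_upwards with x; positivity), ← ENNReal.ofReal_mul (by positivity),
            ← Cube.ofReal_real, ← ENNReal.ofReal_mul (by positivity)]
          apply ENNReal.ofReal_le_ofReal
          rw [inv_mul_eq_div, div_le_iff₀ hApos]
          refine hI2.trans ?_
          have h20 : (20 : ℝ) ^ n = 5 ^ n * 4 ^ n := by rw [← mul_pow]; norm_num
          have h5 : (0 : ℝ) < 5 ^ n := by positivity
          have h4 : (0 : ℝ) < 4 ^ n := by positivity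
          have : 2 * 4 ^ n * K ≤ (5 ^ n)⁻¹ / 2 * A := by
            calc 2 * 4 ^ n * K ≤ (5 ^ n)⁻¹ / 2 * (4 * (5 ^ n * 4 ^ n) * (K + 1)) := by
                  field_simp; nlinarith
              _ ≤ _ := by rw [h20] at hA; gcongr
          calc 2 * 4 ^ n * K * volume.real B.set ≤ (5 ^ n)⁻¹ / 2 * A * volume.real B.set := by gcongr
            _ = _ := by ring
  have := huc.to_subtype
  calc volume (B.set ∩ {x | lam + A < |b x - c|})
      ≤ volume (⋃ Q ∈ u, (Q.five.set ∩ {x | lam < |b x - cubeAvg Q.five b|})) := measure_mono_ae hcover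
    _ ≤ ∑' Q : u, volume ((Q : Cube n).five.set ∩ {x | lam < |b x - cubeAvg (Q : Cube n).five b|}) :=
        measure_biUnion_le _ huc _
    _ ≤ ∑' Q : u, jnF b lam * 5 ^ n * volume (Q : Cube n).set := by
        refine ENNReal.tsum_le_tsum fun Q => (le_jnF b lam _).trans ?_
        rw [Cube.volume_five, mul_assoc]
    _ = jnF b lam * 5 ^ n * ∑' Q : u, volume (Q : Cube n).set := ENNReal.tsum_mul_left
    _ ≤ jnF b lam * 5 ^ n * (ENNReal.ofReal ((5 ^ n)⁻¹ / 2) * volume B.set) := by gcongr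
    _ = jnF b lam / 2 * volume B.set := by
        have : (5 : ℝ≥0∞) ^ n * ENNReal.ofReal ((5 ^ n)⁻¹ / 2) = 2⁻¹ := by
          rw [show (5 : ℝ≥0∞) ^ n = ENNReal.ofReal (5 ^ n) by
            rw [ENNReal.ofReal_pow (by norm_num)]; norm_num, ← ENNReal.ofReal_mul (by positivity)]
          rw [show (5 : ℝ) ^ n * ((5 ^ n)⁻¹ / 2) = 2⁻¹ by field_simp, ENNReal.ofReal_inv_of_pos (by norm_num)]
          norm_num
        rw [ENNReal.div_eq_inv_mul, ← this]
        ring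

theorem jn_decay {n : ℕ} {b : RSp n → ℝ} (hb : LocallyIntegrable b volume) {K : ℝ} (hK0 : 0 ≤ K)
    (hK : ∀ Q : Cube n, ∫ y in Q.set, |b y - cubeAvg Q b| ≤ K * volume.real Q.set)
    (k : ℕ) : jnF b (k * (4 * 20 ^ n * (K + 1))) ≤ 2⁻¹ ^ k := by
  induction k with
  | zero => simpa using jnF_le_one b 0
  | succ k ih =>
    have := jn_step hb hK0 hK _ le_rfl (k * (4 * 20 ^ n * (K + 1))) (by positivity)
    rw [show (k : ℝ) * (4 * 20 ^ n * (K + 1)) + 4 * 20 ^ n * (K + 1) =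
      (k + 1 : ℕ) * (4 * 20 ^ n * (K + 1)) by push_cast; ring] at this
    refine this.trans ?_
    rw [pow_succ, div_eq_mul_inv]
    gcongr

theorem bmo_real {n : ℕ} {b : RSp n → ℝ} (hb : IsBMO b) : ∃ K : ℝ, 0 ≤ K ∧
    ∀ Q : Cube n, ∫ y in Q.set, |b y - cubeAvg Q b| ≤ K * volume.real Q.set := by
  refine ⟨(bmoNorm b).toReal, ENNReal.toReal_nonneg, fun Q => ?_⟩
  have h1 : (volume Q.set)⁻¹ * ∫⁻ x in Q.set, ‖b x - cubeAvg Q b‖₊ ≤ bmoNorm b :=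
    le_iSup (fun Q : Cube n => (volume Q.set)⁻¹ * ∫⁻ x in Q.set, (‖b x - cubeAvg Q b‖₊ : ℝ≥0∞)) Q
  rw [← ENNReal.div_eq_inv_mul, ENNReal.div_le_iff' Q.volume_ne_zero Q.volume_ne_top, mul_comm] at h1
  have h2 := ENNReal.toReal_mono (ENNReal.mul_ne_top hb.2.ne Q.volume_ne_top) h1
  rw [ENNReal.toReal_mul] at h2
  refine le_trans (le_of_eq ?_) h2
  exact integral_norm_eq_lintegral_enorm (f := fun y => b y - cubeAvg Q b)
    ((Q.integrableOn hb.1).sub (integrableOn_const Q.volume_ne_top)).aestronglyMeasurable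

theorem john_nirenberg {n : ℕ} {b : RSp n → ℝ} (hb : IsBMO b) : ∃ κ : ℝ, 0 < κ ∧
    ∀ Q : Cube n, ∫⁻ y in Q.set, ENNReal.ofReal (Real.exp (κ * |b y - cubeAvg Q b|)) ≤ 8 * volume Q.set := by
  obtain ⟨K, hK0, hK⟩ := bmo_real hb
  set A := 4 * 20 ^ n * (K + 1) with hA
  have hApos : 0 < A := by positivity
  have hlog : 0 < Real.log (3 / 2) := Real.log_pos (by norm_num)
  refine ⟨Real.log (3 / 2) / A, by positivity, fun Q => ?_⟩
  set u : RSp n → ℝ := fun y => |b y - cubeAvg Q b| with hu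
  have hum : AEMeasurable u (volume.restrict Q.set) :=
    (Q.integrableOn_abs_sub hb.1 _).aestronglyMeasurable.aemeasurable
  have hpt : ∀ y, ENNReal.ofReal (Real.exp (Real.log (3 / 2) / A * u y)) ≤
      ENNReal.ofReal (3 / 2) * (1 + ∑' k : ℕ, ENNReal.ofReal (3 / 2) ^ k * {y | k * A < u y}.indicator 1 y) := by
    intro y
    have hu0 : 0 ≤ u y := abs_nonneg _
    by_cases h0 : u y = 0
    · rw [h0, mul_zero, Real.exp_zero, ENNReal.ofReal_one]
      calc (1 : ℝ≥0∞) ≤ ENNReal.ofReal (3 / 2) * (1 + 0) := by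
            rw [add_zero, mul_one, ← ENNReal.ofReal_one]
            exact ENNReal.ofReal_le_ofReal (by norm_num)
        _ ≤ _ := by gcongr; exact zero_le
    · have hupos : 0 < u y := lt_of_le_of_ne hu0 (Ne.symm h0)
      set k := ⌈u y / A⌉₊ - 1 with hk
      have hc : 0 < ⌈u y / A⌉₊ := Nat.ceil_pos.2 (by positivity)
      have hk1 : (k : ℝ) * A < u y := by
        rw [← lt_div_iff₀ hApos]
        exact Nat.lt_ceil.1 (by omega)
      have hk2 : u y / A ≤ k + 1 := by
        have := Nat.le_ceil (u y / A)
        have h3 : (⌈u y / A⌉₊ : ℝ) = k + 1 := by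
          rw [hk, Nat.cast_sub (by omega)]; simp
        linarith
      calc ENNReal.ofReal (Real.exp (Real.log (3 / 2) / A * u y))
          ≤ ENNReal.ofReal ((3 / 2) ^ (k + 1)) := by
            apply ENNReal.ofReal_le_ofReal
            rw [← Real.exp_log (show (0 : ℝ) < 3 / 2 by norm_num), ← Real.exp_nat_mul]
            rw [Real.exp_log (by norm_num)]
            apply Real.exp_le_exp.2
            rw [div_mul_eq_mul_div, mul_div_assoc, mul_comm]
            push_cast
            gcongr
        _ = ENNReal.ofReal (3 / 2) * (ENNReal.ofReal (3 / 2) ^ k * {y | k * A < u y}.indicator 1 y) := by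
            rw [indicator_of_mem (by exact hk1), ENNReal.ofReal_pow (by norm_num), pow_succ]
            simp [mul_comm]
        _ ≤ _ := by
            gcongr
            refine le_trans ?_ le_add_self
            exact ENNReal.le_tsum (f := fun k : ℕ => ENNReal.ofReal (3 / 2) ^ k * {y | k * A < u y}.indicator 1 y) k
  calc ∫⁻ y in Q.set, ENNReal.ofReal (Real.exp (Real.log (3 / 2) / A * u y))
      ≤ ∫⁻ y in Q.set, ENNReal.ofReal (3 / 2) * (1 + ∑' k : ℕ, ENNReal.ofReal (3 / 2) ^ k * {y | k * A < u y}.indicator 1 y) :=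
        lintegral_mono hpt
    _ = ENNReal.ofReal (3 / 2) * (volume Q.set + ∑' k : ℕ, ENNReal.ofReal (3 / 2) ^ k * volume (Q.set ∩ {y | k * A < u y})) := by
        rw [lintegral_const_mul' _ _ ENNReal.ofReal_ne_top, lintegral_add_left measurable_const, lintegral_tsum]
        · congr 2
          · simp
          · congr 1; ext k
            rw [lintegral_const_mul' _ _ (by simp)]
            congr 1
            rw [lintegral_indicator_one₀ (nullMeasurableSet_lt aemeasurable_const hum)]
            rw [Measure.restrict_apply₀ (nullMeasurableSet_lt aemeasurable_const hum), inter_comm]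
        · intro k
          exact (aemeasurable_const.indicator₀ (nullMeasurableSet_lt aemeasurable_const hum)).const_mul _
    _ ≤ ENNReal.ofReal (3 / 2) * (volume Q.set + ∑' k : ℕ, ENNReal.ofReal (3 / 4) ^ k * volume Q.set) := by
        refine mul_le_mul_right (add_le_add_right (ENNReal.tsum_le_tsum fun k => ?_) _) _
        have h1 := le_jnF b (k * A) Q
        have h2 := jn_decay hb.1 hK0 hK k
        calc ENNReal.ofReal (3 / 2) ^ k * volume (Q.set ∩ {y | k * A < u y})
            ≤ ENNReal.ofReal (3 / 2) ^ k * (2⁻¹ ^ k * volume Q.set) := by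
              refine mul_le_mul_right (h1.trans ?_) _
              gcongr
          _ = _ := by
              rw [← mul_assoc, ← mul_pow]
              congr 2
              rw [show (2⁻¹ : ℝ≥0∞) = ENNReal.ofReal (2⁻¹) by
                rw [ENNReal.ofReal_inv_of_pos (by norm_num)]; norm_num, ← ENNReal.ofReal_mul (by norm_num)]
              norm_num
    _ = ENNReal.ofReal (3 / 2) * (1 + 4) * volume Q.set := by
        rw [ENNReal.tsum_mul_right, ENNReal.tsum_geometric]
        have : (1 - ENNReal.ofReal (3 / 4))⁻¹ = 4 := by
          rw [← ENNReal.ofReal_one, ← ENNReal.ofReal_sub _ (by norm_num)]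
          rw [show (1 : ℝ) - 3 / 4 = 4⁻¹ by norm_num, ENNReal.ofReal_inv_of_pos (by norm_num), inv_inv]
          norm_num
        rw [this]; ring
    _ ≤ _ := by
        gcongr
        rw [show (1 + 4 : ℝ≥0∞) = ENNReal.ofReal 5 by norm_num, ← ENNReal.ofReal_mul (by norm_num),
          show (8 : ℝ≥0∞) = ENNReal.ofReal 8 by norm_num]
        exact ENNReal.ofReal_le_ofReal (by norm_num)



/-- Exponential with values in `ℝ≥0∞`. -/
noncomputable def eexp (z : ℝ) : ℝ≥0∞ := ENNReal.ofReal (Real.exp z)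

theorem eexp_add (a b : ℝ) : eexp (a + b) = eexp a * eexp b := by
  rw [eexp, Real.exp_add, ENNReal.ofReal_mul (Real.exp_pos a).le]; rfl

theorem eexp_zero : eexp 0 = 1 := by simp [eexp]

theorem eexp_rpow (a r : ℝ) : eexp a ^ r = eexp (a * r) := by
  rw [eexp, ENNReal.ofReal_rpow_of_pos (Real.exp_pos a), ← Real.exp_mul]; rfl

theorem eexp_ne_top (a : ℝ) : eexp a ≠ ∞ := ENNReal.ofReal_ne_top

theorem eexp_ne_zero (a : ℝ) : eexp a ≠ 0 := by
  simp [eexp, Real.exp_pos]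

theorem eexp_mono : Monotone eexp := fun _ _ h => ENNReal.ofReal_le_ofReal (Real.exp_le_exp.2 h)

theorem measurable_eexp : Measurable eexp := by unfold eexp; fun_prop

theorem expW {n : ℕ} (v : RSp n → ℝ) (hv : AEMeasurable v volume) (m : Cube n → ℝ) (R s : ℝ) (hs : 1 < s)
    (hJ : ∀ Q : Cube n, ∫⁻ y in Q.set, eexp |v y - m Q| ≤ 8 * volume Q.set)
    (hR : ∀ Q : Cube n, m Q.five ≤ m Q + R) :
    ∃ C : ℝ≥0, ∀ G : RSp n → ℝ≥0∞, AEMeasurable G volume →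
      ∫⁻ x, ⨆ Q ∈ ratCubes n, Q.set.indicator
        (fun x => eexp (v x - m Q) * ((volume Q.set)⁻¹ * ∫⁻ y in Q.set, G y) ^ s) x ≤ C * ∫⁻ x, G x ^ s := by
  set w : RSp n → ℝ≥0∞ := fun x => eexp (v x) with hw
  have hwm : AEMeasurable w volume := measurable_eexp.comp_aemeasurable hv
  set μ : Measure (RSp n) := volume.withDensity w with hμ
  have hμint : ∀ (S : Set (RSp n)), MeasurableSet S → ∀ f : RSp n → ℝ≥0∞, AEMeasurable f volume →
      ∫⁻ y in S, f y ∂μ = ∫⁻ y in S, w y * f y := by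
    intro S hS f hf
    rw [hμ, restrict_withDensity hS, lintegral_withDensity_eq_lintegral_mul₀ hwm.restrict hf.restrict]
    rfl
  have hμQ : ∀ Q : Cube n, μ Q.set = ∫⁻ y in Q.set, w y := fun Q => withDensity_apply _ Q.measurableSet
  have hsplit : ∀ (Q : Cube n) y, w y = eexp (m Q) * eexp (v y - m Q) := fun Q y => by
    rw [← eexp_add]; simp [hw]
  have hup : ∀ Q : Cube n, μ Q.set ≤ 8 * eexp (m Q) * volume Q.set := by
    intro Q
    rw [hμQ]
    simp_rw [hsplit Q]
    rw [lintegral_const_mul' _ _ (eexp_ne_top _), mul_comm 8, mul_assoc]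
    refine mul_le_mul_right (le_trans (lintegral_mono fun y => eexp_mono (le_abs_self _)) (hJ Q)) _
  have hlow : ∀ Q : Cube n, eexp (m Q) * volume Q.set ≤ 8 * μ Q.set := by
    intro Q
    have h1 : ∫⁻ y in Q.set, (2 : ℝ≥0∞) ≤ ∫⁻ y in Q.set, (8 * eexp (v y - m Q) + 8⁻¹ * eexp |v y - m Q|) := by
      refine lintegral_mono fun y => ?_
      have : (8 : ℝ≥0∞) * eexp (v y - m Q) + 8⁻¹ * eexp |v y - m Q| = ENNReal.ofReal (8 * Real.exp (v y - m Q) + 8⁻¹ * Real.exp |v y - m Q|) := by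
        rw [ENNReal.ofReal_add (by positivity) (by positivity), ENNReal.ofReal_mul (by positivity), ENNReal.ofReal_mul (by positivity), ENNReal.ofReal_inv_of_pos (by norm_num)]
        norm_num [eexp]
      rw [this, show (2 : ℝ≥0∞) = ENNReal.ofReal 2 by norm_num]
      apply ENNReal.ofReal_le_ofReal
      set u := v y - m Q
      have h2 : Real.exp (-u) ≤ Real.exp |u| := Real.exp_le_exp.2 (neg_le_abs u)
      have h3 : Real.exp u * Real.exp (-u) = 1 := by rw [← Real.exp_add]; simp
      have h4 := Real.exp_pos u
      have h5 := Real.exp_pos (-u)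
      nlinarith [sq_nonneg (8 * Real.exp u - 8⁻¹ * Real.exp (-u))]
    rw [lintegral_add_right', lintegral_const_mul' _ _ (by norm_num), lintegral_const_mul' _ _ (by simp)] at h1
    · have h2 : (2 : ℝ≥0∞) * volume Q.set ≤ 8 * (∫⁻ y in Q.set, eexp (v y - m Q)) + volume Q.set := by
        calc (2 : ℝ≥0∞) * volume Q.set = ∫⁻ y in Q.set, (2 : ℝ≥0∞) := by simp
          _ ≤ _ := h1
          _ ≤ 8 * (∫⁻ y in Q.set, eexp (v y - m Q)) + 8⁻¹ * (8 * volume Q.set) := by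
              gcongr; exact hJ Q
          _ = _ := by
              rw [← mul_assoc, ENNReal.inv_mul_cancel (by norm_num) (by norm_num), one_mul]
      rw [two_mul] at h2
      have h3 := (ENNReal.add_le_add_iff_right Q.volume_ne_top).1 h2
      rw [hμQ]
      simp_rw [hsplit Q]
      rw [lintegral_const_mul' _ _ (eexp_ne_top _)]
      calc eexp (m Q) * volume Q.set ≤ eexp (m Q) * (8 * (∫⁻ y in Q.set, eexp (v y - m Q))) := by gcongr
        _ = _ := by ring
    · exact ((measurable_eexp.comp_aemeasurable ((hv.sub_const _).abs)).const_mul _).restrict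
  -- doubling
  set D : ℝ≥0 := 64 * 5 ^ n * (Real.exp R).toNNReal with hD
  have hdoub : ∀ Q : Cube n, μ Q.five.set ≤ D * μ Q.set := by
    intro Q
    calc μ Q.five.set ≤ 8 * eexp (m Q.five) * volume Q.five.set := hup _
      _ ≤ 8 * eexp (m Q + R) * (5 ^ n * volume Q.set) := by
          rw [Cube.volume_five]; gcongr; exact eexp_mono (hR Q)
      _ = 8 * 5 ^ n * eexp R * (eexp (m Q) * volume Q.set) := by rw [eexp_add]; ring
      _ ≤ 8 * 5 ^ n * eexp R * (8 * μ Q.set) := mul_le_mul_right (hlow Q) _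
      _ = _ := by
          rw [hD]; push_cast
          rw [show ((Real.exp R).toNNReal : ℝ≥0∞) = eexp R from rfl]; ring
  set s1 := Real.sqrt s with hs1
  have hs1s : s1 * s1 = s := Real.mul_self_sqrt (by linarith)
  have hs11 : 1 < s1 := by rw [hs1]; exact Real.lt_sqrt_of_sq_lt (by linarith)
  have hconj := Real.HolderConjugate.conjExponent hs11
  set s' := s1.conjExponent with hs'
  have hs'inv : s'⁻¹ = 1 - s1⁻¹ := by have := hconj.inv_add_inv_eq_one; linarith
  have hs'pos : 0 < s' := hconj.symm.pos
  obtain ⟨C, hC⟩ := maxOp_strong (n := n) D s1 hs11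
  refine ⟨64 ^ s * C, fun G hG => ?_⟩
  set H : RSp n → ℝ≥0∞ := fun x => (G x * eexp (v x * (-1 / s))) ^ s1 with hH
  have hHm : AEMeasurable H volume :=
    (hG.mul (measurable_eexp.comp_aemeasurable (hv.mul_const _))).pow_const _
  have hkey : ∀ Q : Cube n, ∀ x, Q ∈ ratCubes n → x ∈ Q.set →
      (volume Q.set)⁻¹ * ∫⁻ y in Q.set, G y ≤ 64 * eexp (m Q * s⁻¹) * maxOp μ H x ^ (s1⁻¹) := by
    intro Q x hQ hx
    have hM : ∫⁻ y in Q.set, H y * w y ≤ 8 * eexp (m Q) * volume Q.set * maxOp μ H x := by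
      have h1 := le_maxOp μ H hQ hx
      have h2 : ∫⁻ y in Q.set, H y ∂μ ≤ μ Q.set * maxOp μ H x := by
        have hne : μ Q.set ≠ 0 := by
          intro h0
          have := hlow Q
          rw [h0, mul_zero] at this
          exact mul_ne_zero (eexp_ne_zero _) Q.volume_ne_zero (le_antisymm this zero_le)
        have hnt : μ Q.set ≠ ∞ := ne_top_of_le_ne_top
          (ENNReal.mul_ne_top (ENNReal.mul_ne_top (by norm_num) (eexp_ne_top _)) Q.volume_ne_top) (hup Q)
        rw [← ENNReal.div_eq_inv_mul] at h1
        exact (ENNReal.div_le_iff' hne hnt).1 h1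
      rw [hμint _ Q.measurableSet _ hHm] at h2
      calc ∫⁻ y in Q.set, H y * w y = ∫⁻ y in Q.set, w y * H y := by simp_rw [mul_comm]
        _ ≤ _ := h2
        _ ≤ _ := mul_le_mul_left (hup Q) _
    have hhol := ENNReal.lintegral_mul_le_Lp_mul_Lq (volume.restrict Q.set) hconj
      (f := fun y => G y * eexp (v y * (s1⁻¹ - s⁻¹)))
      (g := fun y => eexp (v y * (s⁻¹ - s1⁻¹)))
      (hG.mul (measurable_eexp.comp_aemeasurable (hv.mul_const _))).restrict
      (measurable_eexp.comp_aemeasurable (hv.mul_const _)).restrict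
    have e1 : ∀ y, ((fun y => G y * eexp (v y * (s1⁻¹ - s⁻¹))) * fun y => eexp (v y * (s⁻¹ - s1⁻¹))) y = G y := by
      intro y
      simp only [Pi.mul_apply]
      rw [mul_assoc, ← eexp_add]
      ring_nf
      rw [eexp_zero, mul_one]
    have e2 : ∀ y, (G y * eexp (v y * (s1⁻¹ - s⁻¹))) ^ s1 = H y * w y := by
      intro y
      simp only [hH, hw]
      rw [ENNReal.mul_rpow_of_nonneg _ _ (by linarith), ENNReal.mul_rpow_of_nonneg _ _ (by linarith),
        mul_assoc, eexp_rpow, eexp_rpow, ← eexp_add]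
      congr 2
      field_simp
      ring
    have e3 : ∀ y, (eexp (v y * (s⁻¹ - s1⁻¹))) ^ s' = eexp (m Q * (-s1⁻¹)) * eexp ((v y - m Q) * (-s1⁻¹)) := by
      intro y
      rw [eexp_rpow, ← eexp_add]
      congr 1
      have : (s⁻¹ - s1⁻¹) * s' = -s1⁻¹ := by
        have : s⁻¹ - s1⁻¹ = - s1⁻¹ * s'⁻¹ := by rw [hs'inv, ← hs1s, mul_inv]; ring
        rw [this]; field_simp
      rw [mul_assoc, this]; ring
    simp_rw [e1, e2, e3] at hhol
    rw [lintegral_const_mul' _ _ (eexp_ne_top _)] at hhol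
    have h4 : ∫⁻ y in Q.set, eexp ((v y - m Q) * (-s1⁻¹)) ≤ 8 * volume Q.set := by
      refine le_trans (lintegral_mono fun y => eexp_mono ?_) (hJ Q)
      have h5 : s1⁻¹ ≤ 1 := inv_le_one_of_one_le₀ hs11.le
      have h6 : 0 < s1⁻¹ := by positivity
      have := neg_le_abs (v y - m Q)
      have := abs_nonneg (v y - m Q)
      nlinarith
    have h7 : ∫⁻ y in Q.set, G y ≤ (8 * eexp (m Q) * volume Q.set * maxOp μ H x) ^ s1⁻¹ *
        (eexp (m Q * (-s1⁻¹)) * (8 * volume Q.set)) ^ s'⁻¹ := by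
      refine hhol.trans ?_
      rw [one_div, one_div]
      gcongr
    have h8 : (8 * eexp (m Q) * volume Q.set * maxOp μ H x) ^ s1⁻¹ *
        (eexp (m Q * (-s1⁻¹)) * (8 * volume Q.set)) ^ s'⁻¹ ≤
        64 * eexp (m Q * s⁻¹) * maxOp μ H x ^ (s1⁻¹) * volume Q.set := by
      have p1 : 0 ≤ s1⁻¹ := by positivity
      have p2 : 0 ≤ s'⁻¹ := by positivity
      rw [ENNReal.mul_rpow_of_nonneg _ _ p1, ENNReal.mul_rpow_of_nonneg _ _ p1, ENNReal.mul_rpow_of_nonneg _ _ p1,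
        ENNReal.mul_rpow_of_nonneg _ _ p2, ENNReal.mul_rpow_of_nonneg _ _ p2, eexp_rpow, eexp_rpow]
      have q1 : (8 : ℝ≥0∞) ^ s1⁻¹ ≤ 8 := by
        conv_rhs => rw [← ENNReal.rpow_one 8]
        exact ENNReal.rpow_le_rpow_of_exponent_le (by norm_num) (inv_le_one_of_one_le₀ hs11.le)
      have q2 : (8 : ℝ≥0∞) ^ s'⁻¹ ≤ 8 := by
        conv_rhs => rw [← ENNReal.rpow_one 8]
        exact ENNReal.rpow_le_rpow_of_exponent_le (by norm_num) (by rw [hs'inv]; linarith)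
      have q3 : volume Q.set ^ s1⁻¹ * volume Q.set ^ s'⁻¹ = volume Q.set := by
        rw [← ENNReal.rpow_add _ _ Q.volume_ne_zero Q.volume_ne_top, hs'inv]; simp
      have q4 : eexp (m Q * s1⁻¹) * eexp (m Q * (-s1⁻¹) * s'⁻¹) = eexp (m Q * s⁻¹) := by
        rw [← eexp_add, hs'inv, ← hs1s, mul_inv]; ring_nf
      calc _ = ((8 : ℝ≥0∞) ^ s1⁻¹ * (8 : ℝ≥0∞) ^ s'⁻¹) * (eexp (m Q * s1⁻¹) * eexp (m Q * (-s1⁻¹) * s'⁻¹)) *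
            maxOp μ H x ^ s1⁻¹ * (volume Q.set ^ s1⁻¹ * volume Q.set ^ s'⁻¹) := by ring
        _ ≤ (8 * 8) * eexp (m Q * s⁻¹) * maxOp μ H x ^ s1⁻¹ * volume Q.set := by
            rw [q3, q4]; gcongr
        _ = _ := by norm_num
    rw [← ENNReal.div_eq_inv_mul]
    exact ENNReal.div_le_of_le_mul (h7.trans h8)
  calc _ ≤ ∫⁻ x, 64 ^ s * (w x * maxOp μ H x ^ s1) := by
        refine lintegral_mono fun x => iSup₂_le fun Q hQ => ?_
        by_cases hx : x ∈ Q.set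
        · rw [indicator_of_mem hx]
          calc eexp (v x - m Q) * ((volume Q.set)⁻¹ * ∫⁻ y in Q.set, G y) ^ s
              ≤ eexp (v x - m Q) * (64 * eexp (m Q * s⁻¹) * maxOp μ H x ^ (s1⁻¹)) ^ s := by
                exact mul_le_mul_right (ENNReal.rpow_le_rpow (hkey Q x hQ hx) (by linarith)) _
            _ = _ := by
                rw [ENNReal.mul_rpow_of_nonneg _ _ (by linarith), ENNReal.mul_rpow_of_nonneg _ _ (by linarith),
                  eexp_rpow, ← ENNReal.rpow_mul, hsplit Q x]
                rw [show s1⁻¹ * s = s1 by rw [← hs1s]; field_simp, show m Q * s⁻¹ * s = m Q by field_simp]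
                ring
        · rw [indicator_of_notMem hx]; exact zero_le
    _ = 64 ^ s * ∫⁻ x, maxOp μ H x ^ s1 ∂μ := by
        rw [lintegral_const_mul' _ _ (ENNReal.rpow_ne_top_of_nonneg (by linarith) (by norm_num))]
        congr 1
        have := hμint univ MeasurableSet.univ (fun x => maxOp μ H x ^ s1) ((measurable_maxOp μ H).pow_const _).aemeasurable
        simpa using this.symm
    _ ≤ 64 ^ s * (C * ∫⁻ x, H x ^ s1 ∂μ) := by
        gcongr
        exact hC μ hdoub H (hHm.mono_ac (withDensity_absolutelyContinuous _ _))
    _ = 64 ^ s * (C * ∫⁻ x, G x ^ s) := by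
        congr 2
        have := hμint univ MeasurableSet.univ (fun x => H x ^ s1) (hHm.pow_const _)
        simp only [Measure.restrict_univ] at this
        rw [this]
        congr 1; ext x
        simp only [hH, hw]
        rw [← ENNReal.rpow_mul, hs1s, ENNReal.mul_rpow_of_nonneg _ _ (by linarith), eexp_rpow,
          mul_left_comm, ← eexp_add, show v x + v x * (-1 / s) * s = 0 by field_simp; ring, eexp_zero, mul_one]
    _ = _ := by
        push_cast
        rw [ENNReal.coe_rpow_of_ne_zero (by norm_num)]
        push_cast; ring

theorem poly_le_exp (N ε : ℝ) (hN : 0 < N) (hε : 0 < ε) : ∃ c : ℝ≥0, ∀ u : ℝ,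
    ENNReal.ofReal ((1 + |u|) ^ N) ≤ c * (eexp (ε * u) + eexp (-ε * u)) := by
  refine ⟨((1 + N / ε) ^ N).toNNReal, fun u => ?_⟩
  have h1 : 1 + |u| ≤ (1 + N / ε) * Real.exp (ε * |u| / N) := by
    have h2 := Real.add_one_le_exp (ε * |u| / N)
    have h3 : 0 ≤ |u| := abs_nonneg u
    calc 1 + |u| ≤ (1 + N / ε) * (ε * |u| / N + 1) := by
          have : (1 + N / ε) * (ε * |u| / N + 1) = 1 + |u| + ε * |u| / N + N / ε := by field_simp; ring
          rw [this]
          have : 0 ≤ ε * |u| / N := by positivity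
          have : 0 ≤ N / ε := by positivity
          linarith
      _ ≤ _ := by gcongr
  have h2 : (1 + |u|) ^ N ≤ (1 + N / ε) ^ N * Real.exp (ε * |u|) := by
    calc (1 + |u|) ^ N ≤ ((1 + N / ε) * Real.exp (ε * |u| / N)) ^ N :=
          Real.rpow_le_rpow (by positivity) h1 hN.le
      _ = _ := by
        rw [Real.mul_rpow (by positivity) (Real.exp_pos _).le, ← Real.exp_mul]
        congr 2; field_simp
  calc ENNReal.ofReal ((1 + |u|) ^ N) ≤ ENNReal.ofReal ((1 + N / ε) ^ N * Real.exp (ε * |u|)) :=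
        ENNReal.ofReal_le_ofReal h2
    _ = ((1 + N / ε) ^ N).toNNReal * eexp (ε * |u|) := by
        rw [ENNReal.ofReal_mul (by positivity)]; rfl
    _ ≤ _ := by
        gcongr
        rcases abs_cases u with ⟨h, _⟩ | ⟨h, _⟩
        · rw [h]; exact le_self_add
        · rw [h, show ε * -u = -ε * u by ring]; exact le_add_self

theorem lemmaW {n : ℕ} {b : RSp n → ℝ} (hb : IsBMO b) (N s : ℝ) (hN : 0 < N) (hs : 1 < s) :
    ∃ C : ℝ≥0, ∀ G : RSp n → ℝ≥0∞, AEMeasurable G volume →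
      ∫⁻ x, ⨆ Q ∈ ratCubes n, Q.set.indicator
        (fun x => ENNReal.ofReal ((1 + |b x - cubeAvg Q b|) ^ N) *
          ((volume Q.set)⁻¹ * ∫⁻ y in Q.set, G y) ^ s) x ≤ C * ∫⁻ x, G x ^ s := by
  obtain ⟨κ, hκ, hJ⟩ := john_nirenberg hb
  obtain ⟨K, hK0, hK⟩ := bmo_real hb
  have hbm : AEMeasurable b volume := hb.1.aestronglyMeasurable.aemeasurable
  have hosc : ∀ Q : Cube n, |cubeAvg Q b - cubeAvg Q.five b| ≤ K * 5 ^ n := fun Q =>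
    osc_dil_le hb.1 hK Q 5 (by norm_num) (by norm_num)
  have key : ∀ θ : ℝ, |θ| = κ → ∃ C : ℝ≥0, ∀ G : RSp n → ℝ≥0∞, AEMeasurable G volume →
      ∫⁻ x, ⨆ Q ∈ ratCubes n, Q.set.indicator
        (fun x => eexp (θ * b x - θ * cubeAvg Q b) * ((volume Q.set)⁻¹ * ∫⁻ y in Q.set, G y) ^ s) x ≤ C * ∫⁻ x, G x ^ s := by
    intro θ hθ
    apply expW (fun x => θ * b x) (hbm.const_mul θ) (fun Q => θ * cubeAvg Q b) (κ * (K * 5 ^ n)) s hs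
    · intro Q
      refine le_trans (le_of_eq ?_) (hJ Q)
      congr 1; ext y
      rw [← mul_sub, abs_mul, hθ]; rfl
    · intro Q
      have h1 : θ * cubeAvg Q.five b - θ * cubeAvg Q b ≤ κ * (K * 5 ^ n) := by
        rw [← mul_sub]
        refine (le_abs_self _).trans ?_
        rw [abs_mul, hθ, abs_sub_comm]
        exact mul_le_mul_of_nonneg_left (hosc Q) hκ.le
      linarith
  obtain ⟨C1, hC1⟩ := key κ (abs_of_pos hκ)
  obtain ⟨C2, hC2⟩ := key (-κ) (by rw [abs_neg, abs_of_pos hκ])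
  obtain ⟨c, hc⟩ := poly_le_exp N κ hN hκ
  refine ⟨c * (C1 + C2), fun G hG => ?_⟩
  have hmeas : ∀ θ : ℝ, AEMeasurable (fun x => ⨆ Q ∈ ratCubes n, Q.set.indicator
        (fun x => eexp (θ * b x - θ * cubeAvg Q b) * ((volume Q.set)⁻¹ * ∫⁻ y in Q.set, G y) ^ s) x) volume := by
    intro θ
    refine AEMeasurable.biSup _ (ratCubes_countable n) fun Q _ => ?_
    exact ((measurable_eexp.comp_aemeasurable ((hbm.const_mul θ).sub_const _)).mul_const _).indicator Q.measurableSet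
  calc _ ≤ ∫⁻ x, c * ((⨆ Q ∈ ratCubes n, Q.set.indicator
        (fun x => eexp (κ * b x - κ * cubeAvg Q b) * ((volume Q.set)⁻¹ * ∫⁻ y in Q.set, G y) ^ s) x) +
        (⨆ Q ∈ ratCubes n, Q.set.indicator
        (fun x => eexp ((-κ) * b x - (-κ) * cubeAvg Q b) * ((volume Q.set)⁻¹ * ∫⁻ y in Q.set, G y) ^ s) x)) := by
        refine lintegral_mono fun x => iSup₂_le fun Q hQ => ?_
        by_cases hx : x ∈ Q.set
        · rw [indicator_of_mem hx]
          calc ENNReal.ofReal ((1 + |b x - cubeAvg Q b|) ^ N) * ((volume Q.set)⁻¹ * ∫⁻ y in Q.set, G y) ^ s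
              ≤ c * (eexp (κ * (b x - cubeAvg Q b)) + eexp (-κ * (b x - cubeAvg Q b))) * ((volume Q.set)⁻¹ * ∫⁻ y in Q.set, G y) ^ s :=
                mul_le_mul_left (hc _) _
            _ = c * (eexp (κ * b x - κ * cubeAvg Q b) * ((volume Q.set)⁻¹ * ∫⁻ y in Q.set, G y) ^ s +
                  eexp ((-κ) * b x - (-κ) * cubeAvg Q b) * ((volume Q.set)⁻¹ * ∫⁻ y in Q.set, G y) ^ s) := by
                rw [mul_sub, mul_sub]; ring
            _ ≤ _ := by
                refine mul_le_mul_right (add_le_add ?_ ?_) _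
                · refine le_trans ?_ (le_iSup₂ (f := fun (Q : Cube n) (_ : Q ∈ ratCubes n) => Q.set.indicator
                    (fun x => eexp (κ * b x - κ * cubeAvg Q b) * ((volume Q.set)⁻¹ * ∫⁻ y in Q.set, G y) ^ s) x) Q hQ)
                  rw [indicator_of_mem hx]
                · refine le_trans ?_ (le_iSup₂ (f := fun (Q : Cube n) (_ : Q ∈ ratCubes n) => Q.set.indicator
                    (fun x => eexp ((-κ) * b x - (-κ) * cubeAvg Q b) * ((volume Q.set)⁻¹ * ∫⁻ y in Q.set, G y) ^ s) x) Q hQ)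
                  rw [indicator_of_mem hx]
        · rw [indicator_of_notMem hx]; exact zero_le
    _ = c * (_ + _) := by
        rw [lintegral_const_mul' _ _ ENNReal.coe_ne_top, lintegral_add_left' (hmeas κ)]
    _ ≤ c * ((C1 * ∫⁻ x, G x ^ s) + C2 * ∫⁻ x, G x ^ s) :=
        mul_le_mul_right (add_le_add (hC1 G hG) (hC2 G hG)) _
    _ = _ := by push_cast; ring



section inverse
variable {n : ℕ} {φ : RSp n → ℝ≥0 → ℝ≥0∞} {x : RSp n}

theorem phiInv_mono : Monotone (phiInv φ x) := by
  intro s t hst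
  apply sInf_le_sInf
  rintro _ ⟨τ, hτ, rfl⟩
  exact ⟨τ, hst.trans hτ, rfl⟩

theorem phiInv_le {t : ℝ≥0∞} {s : ℝ≥0} (h : t ≤ φ x s) : phiInv φ x t ≤ s :=
  sInf_le ⟨s, h, rfl⟩

theorem lt_phiInv {t : ℝ≥0∞} {s : ℝ≥0} (h : (s : ℝ≥0∞) < phiInv φ x t) : φ x s < t := by
  by_contra hc
  exact absurd (phiInv_le (not_lt.1 hc)) (not_le.2 h)

theorem le_phiInv (hm : Monotone (φ x)) {t : ℝ≥0∞} {s : ℝ≥0} (h : φ x s < t) :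
    (s : ℝ≥0∞) ≤ phiInv φ x t := by
  apply le_sInf
  rintro _ ⟨τ, hτ, rfl⟩
  rw [ENNReal.coe_le_coe]
  by_contra hc
  exact absurd (h.trans_le hτ) (not_lt.2 (hm (not_le.1 hc).le))

theorem phiInv_pos (hφ : IsWeakPhi univ φ) {t : ℝ≥0∞} (ht : 0 < t) : 0 < phiInv φ x t := by
  have h1 := (hφ.lim_zero x (mem_univ x)).eventually (gt_mem_nhds ht)
  have h2 : ∀ᶠ s : ℝ≥0 in nhdsWithin 0 (Ioi 0), 0 < s := self_mem_nhdsWithin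
  obtain ⟨s, hs1, hs2⟩ := (h1.and h2).exists
  exact lt_of_lt_of_le (ENNReal.coe_pos.2 hs2) (le_phiInv (hφ.mono x (mem_univ x)) hs1)

theorem phiInv_ne_top (hφ : IsWeakPhi univ φ) {t : ℝ≥0∞} (ht : t ≠ ∞) : phiInv φ x t ≠ ∞ := by
  have h1 := (hφ.lim_top x (mem_univ x)).eventually (lt_mem_nhds (lt_top_iff_ne_top.2 ht))
  obtain ⟨s, hs⟩ := h1.exists
  exact ne_top_of_le_ne_top ENNReal.coe_ne_top (phiInv_le hs.le)

theorem phiInv_le_mul {t s : ℝ≥0∞} {M : ℝ≥0} (hM : M ≠ 0)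
    (h : ∀ τ : ℝ≥0, s ≤ φ x τ → phiInv φ x t ≤ M * τ) : phiInv φ x t ≤ M * phiInv φ x s := by
  rw [← ENNReal.div_le_iff' (by exact_mod_cast hM) ENNReal.coe_ne_top]
  apply le_sInf
  rintro _ ⟨τ, hτ, rfl⟩
  rw [ENNReal.div_le_iff' (by exact_mod_cast hM) ENNReal.coe_ne_top]
  exact h τ hτ

theorem scale_aux {f1 f2 : ℝ≥0∞} {a b L : ℝ≥0} (p : ℝ) (ha : 0 < a) (hb : 0 < b)
    (h : f1 / (a : ℝ≥0∞) ^ p ≤ L * (f2 / (b : ℝ≥0∞) ^ p)) :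
    f1 * ((b / a) ^ p : ℝ≥0) ≤ L * f2 := by
  rw [← ENNReal.coe_rpow_of_ne_zero ha.ne', ← ENNReal.coe_rpow_of_ne_zero hb.ne'] at h
  have ha' : (a ^ p) ≠ 0 := (NNReal.rpow_pos ha).ne'
  have hb' : (b ^ p) ≠ 0 := (NNReal.rpow_pos hb).ne'
  rw [NNReal.div_rpow, ENNReal.coe_div ha']
  calc f1 * (((b ^ p : ℝ≥0) : ℝ≥0∞) / ((a ^ p : ℝ≥0) : ℝ≥0∞)) = f1 / ((a ^ p : ℝ≥0) : ℝ≥0∞) * ((b ^ p : ℝ≥0) : ℝ≥0∞) := by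
        simp only [div_eq_mul_inv]; ring
    _ ≤ L * (f2 / ((b ^ p : ℝ≥0) : ℝ≥0∞)) * ((b ^ p : ℝ≥0) : ℝ≥0∞) := by gcongr
    _ = L * f2 := by
        rw [mul_assoc, ENNReal.div_mul_cancel (by exact_mod_cast hb') ENNReal.coe_ne_top]

theorem phiInv_inc (hφ : IsWeakPhi univ φ) {p : ℝ} (hp : 0 < p) {L : ℝ≥0} (hL1 : 1 ≤ L)
    (hL : ∀ s t : ℝ≥0, 0 < s → s < t →
      φ x s / (s : ℝ≥0∞) ^ p ≤ (L : ℝ≥0∞) * (φ x t / (t : ℝ≥0∞) ^ p)) {s t : ℝ≥0} (hs : 0 < s) (hst : s ≤ t) :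
    phiInv φ x t ≤ ((L * t / s) ^ (1 / p) : ℝ≥0) * phiInv φ x s := by
  have ht : 0 < t := hs.trans_le hst
  have hbase : 1 ≤ L * t / s := by
    rw [le_div_iff₀ hs, one_mul]
    calc s ≤ t := hst
      _ = 1 * t := (one_mul t).symm
      _ ≤ L * t := by gcongr
  have hM1 : 1 ≤ (L * t / s) ^ (1 / p) := NNReal.one_le_rpow hbase (by positivity)
  apply phiInv_le_mul (by positivity)
  intro τ hτ
  have hτ0 : 0 < τ := by
    by_contra h0
    rw [not_lt, nonpos_iff_eq_zero] at h0
    rw [h0, hφ.zero x (mem_univ x)] at hτ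
    exact absurd hτ (not_le.2 (by exact_mod_cast hs))
  rw [← ENNReal.coe_mul]
  apply phiInv_le
  set M := (L * t / s) ^ (1 / p) with hM
  rcases eq_or_lt_of_le hM1 with h1 | h1
  · have : L * t / s = 1 := by
      have := congrArg (fun z => z ^ p) h1
      simp only [NNReal.one_rpow, hM] at this
      rw [← NNReal.rpow_mul, one_div_mul_cancel hp.ne', NNReal.rpow_one] at this
      exact this.symm
    have h3 : t ≤ s := by
      rw [div_eq_iff hs.ne', one_mul] at this
      rw [← this]
      calc t = 1 * t := (one_mul t).symm
        _ ≤ L * t := by gcongr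
    rw [← h1, one_mul]
    exact le_trans (by exact_mod_cast h3) hτ
  · have h2 := hL τ (M * τ) hτ0 (by
      calc τ = 1 * τ := (one_mul τ).symm
        _ < M * τ := by gcongr)
    have h3 := scale_aux p hτ0 (by positivity) h2
    rw [mul_div_cancel_right₀ _ hτ0.ne', hM, ← NNReal.rpow_mul, one_div_mul_cancel hp.ne', NNReal.rpow_one] at h3
    have h4 : (L : ℝ≥0∞) * t ≤ L * φ x (M * τ) := by
      refine le_trans ?_ h3
      calc (L : ℝ≥0∞) * t = s * ((L * t / s : ℝ≥0) : ℝ≥0∞) := by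
            norm_cast; field_simp
        _ ≤ _ := by gcongr
    exact (ENNReal.mul_le_mul_iff_right (by positivity) ENNReal.coe_ne_top).1 h4

theorem phiInv_dec (hφ : IsWeakPhi univ φ) {r : ℝ} (hr : 0 < r) {L : ℝ≥0} (hL1 : 1 ≤ L)
    (hL : ∀ s t : ℝ≥0, 0 < s → s < t →
      φ x t / (t : ℝ≥0∞) ^ (1 / r) ≤ (L : ℝ≥0∞) * (φ x s / (s : ℝ≥0∞) ^ (1 / r))) {s t : ℝ≥0} (hs : 0 < s) (hst : s ≤ t) :
    phiInv φ x s ≤ ((L * s / t) ^ r : ℝ≥0) * phiInv φ x t := by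
  have ht : 0 < t := hs.trans_le hst
  have hLpos : 0 < L := by positivity
  by_cases hc : 1 ≤ L * s / t
  · calc phiInv φ x s ≤ 1 * phiInv φ x t := by rw [one_mul]; exact phiInv_mono (by exact_mod_cast hst)
      _ ≤ _ := by
        gcongr
        exact_mod_cast NNReal.one_le_rpow hc hr.le
  · rw [not_le] at hc
    apply phiInv_le_mul (by positivity)
    intro τ hτ
    have hτ0 : 0 < τ := by
      by_contra h0
      rw [not_lt, nonpos_iff_eq_zero] at h0
      rw [h0, hφ.zero x (mem_univ x)] at hτ
      exact absurd hτ (not_le.2 (by exact_mod_cast ht))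
    rw [← ENNReal.coe_mul]
    apply phiInv_le
    set M := (L * s / t) ^ r with hM
    have hM0 : 0 < M := by positivity
    have hM1 : M < 1 := NNReal.rpow_lt_one hc hr
    have h2 := hL (M * τ) τ (by positivity) (by
      calc M * τ < 1 * τ := by gcongr
        _ = τ := one_mul τ)
    have h3 := scale_aux (1 / r) hτ0 (by positivity) h2
    rw [mul_div_cancel_right₀ _ hτ0.ne', hM, ← NNReal.rpow_mul, mul_one_div_cancel hr.ne', NNReal.rpow_one] at h3
    have h4 : (L : ℝ≥0∞) * s ≤ L * φ x (M * τ) := by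
      refine le_trans ?_ h3
      calc (L : ℝ≥0∞) * s = t * ((L * s / t : ℝ≥0) : ℝ≥0∞) := by
            norm_cast; field_simp
        _ ≤ _ := by gcongr
    exact (ENNReal.mul_le_mul_iff_right (by positivity) ENNReal.coe_ne_top).1 h4

end inverse

/-- Real-valued inverse. -/
noncomputable def rInv {n : ℕ} (φ : RSp n → ℝ≥0 → ℝ≥0∞) (x : RSp n) (t : ℝ) : ℝ :=
  (phiInv φ x (ENNReal.ofReal t)).toReal

theorem ofReal_rInv {n : ℕ} {φ : RSp n → ℝ≥0 → ℝ≥0∞} (hφ : IsWeakPhi univ φ) (x : RSp n) (t : ℝ) :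
    ENNReal.ofReal (rInv φ x t) = phiInv φ x (ENNReal.ofReal t) :=
  ENNReal.ofReal_toReal (phiInv_ne_top hφ ENNReal.ofReal_ne_top)

/-- Power-type growth control of an increasing function. -/
structure JGood (C κ σ : ℝ) (j : ℝ → ℝ) : Prop where
  pos : ∀ t, 0 < t → 0 < j t
  mono : ∀ s t, 0 < s → s ≤ t → j s ≤ j t
  up : ∀ s t, 0 < s → s ≤ t → j t ≤ C * (t / s) ^ κ * j s
  low : ∀ s t, 0 < s → s ≤ t → j s ≤ C * (s / t) ^ σ * j t

theorem rInv_of_le {n : ℕ} {φ : RSp n → ℝ≥0 → ℝ≥0∞} (hφ : IsWeakPhi univ φ) {x y : RSp n} {t s : ℝ} {M : ℝ≥0}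
    (h : phiInv φ x (ENNReal.ofReal t) ≤ M * phiInv φ y (ENNReal.ofReal s)) :
    rInv φ x t ≤ M * rInv φ y s := by
  have := ENNReal.toReal_mono (ENNReal.mul_ne_top ENNReal.coe_ne_top (phiInv_ne_top hφ ENNReal.ofReal_ne_top)) h
  rwa [ENNReal.toReal_mul, ENNReal.coe_toReal] at this

theorem jgood_phi {n : ℕ} {φ : RSp n → ℝ≥0 → ℝ≥0∞} (hφ : IsWeakPhi univ φ) {p r : ℝ} (hp : 0 < p) (hr : 0 < r)
    (hinc : AInc p univ φ) (hdec : ADec (1 / r) univ φ) :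
    ∃ C : ℝ, 1 ≤ C ∧ ∀ x, JGood C (1 / p) r (rInv φ x) := by
  obtain ⟨L1, hL1, hinc⟩ := hinc
  obtain ⟨L2, hL2, hdec⟩ := hdec
  refine ⟨max ((L1 : ℝ) ^ (1 / p)) ((L2 : ℝ) ^ r), le_max_of_le_left (Real.one_le_rpow (by exact_mod_cast hL1) (by positivity)), fun x => ?_⟩
  have hpos : ∀ t, 0 < t → 0 < rInv φ x t := fun t ht =>
    ENNReal.toReal_pos (phiInv_pos hφ (ENNReal.ofReal_pos.2 ht)).ne' (phiInv_ne_top hφ ENNReal.ofReal_ne_top)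
  refine ⟨hpos, ?_, ?_, ?_⟩
  · intro s t hs hst
    exact ENNReal.toReal_mono (phiInv_ne_top hφ ENNReal.ofReal_ne_top) (phiInv_mono (ENNReal.ofReal_le_ofReal hst))
  · intro s t hs hst
    have ht : 0 < t := hs.trans_le hst
    have h := phiInv_inc (x := x) hφ hp hL1 (fun s t => hinc x (mem_univ x) s t) (s := s.toNNReal) (t := t.toNNReal)
      (Real.toNNReal_pos.2 hs) (Real.toNNReal_le_toNNReal hst)
    have h2 := rInv_of_le (t := t) (s := s) hφ h
    refine h2.trans ?_
    rw [NNReal.coe_rpow, NNReal.coe_div, NNReal.coe_mul, Real.coe_toNNReal _ ht.le, Real.coe_toNNReal _ hs.le]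
    rw [mul_div_assoc, Real.mul_rpow (by positivity) (by positivity)]
    have := (hpos s hs).le
    gcongr
    exact le_max_left _ _
  · intro s t hs hst
    have ht : 0 < t := hs.trans_le hst
    have h := phiInv_dec (x := x) hφ hr hL2 (fun s t => hdec x (mem_univ x) s t) (s := s.toNNReal) (t := t.toNNReal)
      (Real.toNNReal_pos.2 hs) (Real.toNNReal_le_toNNReal hst)
    have h2 := rInv_of_le (t := s) (s := t) hφ h
    refine h2.trans ?_
    rw [NNReal.coe_rpow, NNReal.coe_div, NNReal.coe_mul, Real.coe_toNNReal _ ht.le, Real.coe_toNNReal _ hs.le]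
    rw [mul_div_assoc, Real.mul_rpow (by positivity) (by positivity)]
    have := (hpos t ht).le
    gcongr
    exact le_max_right _ _

/-- Regularised version of condition (A2), with a measurable bounded positive `h`. -/
theorem a2_comp {n : ℕ} {φ : RSp n → ℝ≥0 → ℝ≥0∞} (hφ : IsWeakPhi univ φ) {C κ σ : ℝ} (hC : 1 ≤ C) (hκ : 0 ≤ κ)
    (hJ : ∀ x, JGood C κ σ (rInv φ x)) (h2 : A2 φ) :
    ∃ h : RSp n → ℝ, Measurable h ∧ (∀ x, 0 < h x ∧ h x ≤ 1) ∧ (∫⁻ x, ENNReal.ofReal (h x)) < ∞ ∧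
    ∃ K s0 : ℝ, 0 < K ∧ 0 < s0 ∧ s0 ≤ 1 ∧ ∃ P : RSp n → Prop, (∀ᵐ x ∂(volume : Measure (RSp n)), P x) ∧ ∀ x y, P x → P y → ∀ t,
      h x ≤ t → h y ≤ t → t ≤ s0 → rInv φ x t ≤ K * rInv φ y t := by
  obtain ⟨φi, hφi, h0, h0int, -, β, hβ0, hβ1, s, hs0, hA⟩ := h2
  have hm : ∀ x, Monotone (φ x) := fun x => hφ.mono x (mem_univ x)
  have hmi : Monotone φi := hφi.mono 0 (mem_univ _)
  have hφz : ∀ x, φ x 0 = 0 := fun x => hφ.zero x (mem_univ x)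
  have hφiz : φi 0 = 0 := hφi.zero 0 (mem_univ _)
  have hmeas : ∀ c : ℝ≥0, AEMeasurable (fun x => φ x c) volume := fun c => by
    have := hφ.meas (fun _ => c) measurable_const
    rwa [Measure.restrict_univ] at this
  -- measurable replacement
  set q : ℤ → ℝ≥0 := fun k => 2 ^ k with hq
  set h1 : RSp n → ℝ≥0∞ := fun x => ⨆ k : ℤ, max (if φi (q k) ≤ s then φ x (β * q k) - φi (q k) else 0)
    ({z : ℝ≥0∞ | z ≤ s}.indicator (fun z => φi (β * q k) - z) (φ x (q k))) with hh1
  have h1m : AEMeasurable h1 volume := by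
    refine AEMeasurable.iSup fun k => AEMeasurable.max ?_ ?_
    · split_ifs
      · exact (hmeas _).sub_const _
      · exact aemeasurable_const
    · exact ((measurable_const.sub measurable_id).indicator measurableSet_Iic).comp_aemeasurable (hmeas _)
  have h1le : ∀ᵐ x ∂(volume : Measure (RSp n)), h1 x ≤ h0 x := by
    filter_upwards [hA] with x hx
    refine iSup_le fun k => max_le ?_ ?_
    · split_ifs with hc
      · rw [tsub_le_iff_left]; exact (hx _).1 hc
      · exact zero_le
    · by_cases hc : φ x (q k) ≤ s
      · rw [indicator_of_mem (by exact hc), tsub_le_iff_left]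
        exact (hx _).2 hc
      · rw [indicator_of_notMem (by exact hc)]; exact zero_le
  have h1int : ∫⁻ x, h1 x < ∞ := (lintegral_mono_ae h1le).trans_lt h0int
  have hdy : ∀ t : ℝ≥0, t ≠ 0 → ∃ k : ℤ, q k ≤ t ∧ t ≤ 2 * q k := by
    intro t ht
    obtain ⟨k, hk⟩ := exists_mem_Ico_zpow (y := (2 : ℝ≥0)) (x := t) (pos_iff_ne_zero.2 ht) (by norm_num)
    refine ⟨k, hk.1, hk.2.le.trans (le_of_eq ?_)⟩
    rw [hq, zpow_add_one₀ (by norm_num), mul_comm]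
  set β' := β / 2 with hβ'
  have hext1 : ∀ x t, φi t ≤ s → φ x (β' * t) ≤ φi t + h1 x := by
    intro x t ht
    by_cases h0 : t = 0
    · rw [h0, mul_zero, hφz]; exact zero_le
    obtain ⟨k, hk1, hk2⟩ := hdy t h0
    have e1 : φi (q k) ≤ s := (hmi hk1).trans ht
    have e2 : φ x (β * q k) - φi (q k) ≤ h1 x := by
      refine le_trans ?_ (le_iSup _ k)
      refine le_trans ?_ (le_max_left _ _)
      rw [if_pos e1]
    rw [tsub_le_iff_left] at e2
    calc φ x (β' * t) ≤ φ x (β * q k) := hm x (by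
          rw [hβ']
          calc β / 2 * t ≤ β / 2 * (2 * q k) := by gcongr
            _ = β * q k := by field_simp)
      _ ≤ _ := e2
      _ ≤ _ := by gcongr; exact hmi hk1
  have hext2 : ∀ x t, φ x t ≤ s → φi (β' * t) ≤ φ x t + h1 x := by
    intro x t ht
    by_cases h0 : t = 0
    · rw [h0, mul_zero, hφiz]; exact zero_le
    obtain ⟨k, hk1, hk2⟩ := hdy t h0
    have e1 : φ x (q k) ≤ s := (hm x hk1).trans ht
    have e2 : φi (β * q k) - φ x (q k) ≤ h1 x := by
      refine le_trans ?_ (le_iSup _ k)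
      refine le_trans ?_ (le_max_right _ _)
      rw [indicator_of_mem (by exact e1)]
    rw [tsub_le_iff_left] at e2
    calc φi (β' * t) ≤ φi (β * q k) := hmi (by
          rw [hβ']
          calc β / 2 * t ≤ β / 2 * (2 * q k) := by gcongr
            _ = β * q k := by field_simp)
      _ ≤ _ := e2
      _ ≤ _ := by gcongr; exact hm x hk1
  obtain ⟨e, he0, hem, heint⟩ := exists_pos_lintegral_lt_of_sigmaFinite (volume : Measure (RSp n)) (ε := 1) (by norm_num)
  set h : RSp n → ℝ := fun x => (min (h1m.mk h1 x + e x) 1).toReal with hh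
  have hfin : ∀ x, min (h1m.mk h1 x + e x) 1 ≠ ∞ := fun x => ne_top_of_le_ne_top ENNReal.one_ne_top (min_le_right _ _)
  refine ⟨h, ?_, ?_, ?_, ?_⟩
  · exact ((h1m.measurable_mk.add hem.coe_nnreal_ennreal).min measurable_const).ennreal_toReal
  · intro x
    constructor
    · apply ENNReal.toReal_pos _ (hfin x)
      have := he0 x
      have : (0 : ℝ≥0∞) < min (h1m.mk h1 x + e x) 1 := by
        apply lt_min _ one_pos
        exact lt_of_lt_of_le (ENNReal.coe_pos.2 this) le_add_self
      exact this.ne'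
    · have := ENNReal.toReal_mono ENNReal.one_ne_top (min_le_right (h1m.mk h1 x + e x) 1)
      simpa using this
  · calc ∫⁻ x, ENNReal.ofReal (h x) ≤ ∫⁻ x, (h1m.mk h1 x + e x) := by
          refine lintegral_mono fun x => ?_
          rw [hh]; simp only
          rw [ENNReal.ofReal_toReal (hfin x)]
          exact min_le_left _ _
      _ = (∫⁻ x, h1m.mk h1 x) + ∫⁻ x, e x := lintegral_add_left h1m.measurable_mk _
      _ = (∫⁻ x, h1 x) + ∫⁻ x, e x := by rw [lintegral_congr_ae h1m.ae_eq_mk]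
      _ < ∞ := ENNReal.add_lt_top.2 ⟨h1int, heint.trans ENNReal.one_lt_top⟩
  set s0 : ℝ := min (s / 2) (1 / 2) with hs0'
  have hs0pos : 0 < s0 := lt_min (by positivity) (by norm_num)
  have hβ'0 : 0 < β' := by positivity
  refine ⟨(β' * β')⁻¹ * (C * 3 ^ κ), s0, by positivity, hs0pos, (min_le_right _ _).trans (by norm_num), ?_⟩
  have hgood : ∀ x t, h1 x = h1m.mk h1 x → h x ≤ t → t ≤ s0 → h1 x ≤ ENNReal.ofReal t := by
    intro x t hx hxt hts
    have e1 : min (h1m.mk h1 x + e x) 1 ≤ ENNReal.ofReal t := by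
      rw [← ENNReal.ofReal_toReal (hfin x)]; exact ENNReal.ofReal_le_ofReal hxt
    have e2 : ENNReal.ofReal t < 1 := by
      rw [← ENNReal.ofReal_one]
      exact (ENNReal.ofReal_lt_ofReal_iff (by norm_num)).2 (by
        have := min_le_right ((s : ℝ) / 2) (1 / 2)
        linarith)
    rcases min_le_iff.1 e1 with e3 | e3
    · rw [hx]; exact le_self_add.trans e3
    · exact absurd e3 (not_le.2 e2)
  refine ⟨fun x => h1 x = h1m.mk h1 x, h1m.ae_eq_mk, ?_⟩
  intro x y hx hy t hxt hyt hts
  have ht0 : 0 < t := by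
    have : 0 < h x := by
      apply ENNReal.toReal_pos _ (hfin x)
      have := he0 x
      have : (0 : ℝ≥0∞) < min (h1m.mk h1 x + e x) 1 := by
        apply lt_min _ one_pos
        exact lt_of_lt_of_le (ENNReal.coe_pos.2 this) le_add_self
      exact this.ne'
    linarith
  set T := ENNReal.ofReal t with hT
  have hTpos : 0 < T := ENNReal.ofReal_pos.2 ht0
  have hTtop : T ≠ ∞ := ENNReal.ofReal_ne_top
  have hx1 := hgood x t hx hxt hts
  have hy1 := hgood y t hy hyt hts
  have h2T : T + T ≤ s := by
    rw [hT, ← ENNReal.ofReal_add ht0.le ht0.le]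
    rw [ENNReal.ofReal_le_iff_le_toReal ENNReal.coe_ne_top, ENNReal.coe_toReal]
    have := min_le_left ((s : ℝ) / 2) (1 / 2)
    linarith
  have key : ∀ τ : ℝ≥0, (τ : ℝ≥0∞) < phiInv φ x T → ((β' * β' * τ : ℝ≥0) : ℝ≥0∞) ≤ phiInv φ y (ENNReal.ofReal (3 * t)) := by
    intro τ hτ
    have k1 := lt_phiInv hτ
    have k2 : φ x τ ≤ s := k1.le.trans (le_trans le_self_add h2T)
    have k3 := hext2 x τ k2
    have k4 : φi (β' * τ) < T + T := k3.trans_lt (by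
      refine ENNReal.add_lt_add_of_lt_of_le ?_ k1 hx1
      exact ne_top_of_le_ne_top hTtop hx1)
    have k5 := hext1 y _ (k4.le.trans h2T)
    apply le_phiInv (hm y)
    rw [mul_assoc]
    refine k5.trans_lt ?_
    have : ENNReal.ofReal (3 * t) = T + T + T := by
      rw [hT, ← ENNReal.ofReal_add ht0.le ht0.le, ← ENNReal.ofReal_add (by linarith) ht0.le]; congr 1; ring
    rw [this]
    exact ENNReal.add_lt_add_of_lt_of_le (ne_top_of_le_ne_top hTtop hy1) k4 hy1
  have key2 : phiInv φ x T ≤ ((β' * β')⁻¹ : ℝ≥0) * phiInv φ y (ENNReal.ofReal (3 * t)) := by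
    refine ENNReal.le_of_forall_nnreal_lt fun τ hτ => ?_
    have := key τ hτ
    calc (τ : ℝ≥0∞) = ((β' * β')⁻¹ : ℝ≥0) * ((β' * β' * τ : ℝ≥0) : ℝ≥0∞) := by
          norm_cast; field_simp
      _ ≤ _ := by gcongr
  have key3 := rInv_of_le hφ key2
  have key4 := (hJ y).up t (3 * t) ht0 (by linarith)
  rw [show 3 * t / t = 3 by field_simp] at key4
  calc rInv φ x t ≤ _ := key3
    _ ≤ (((β' * β')⁻¹ : ℝ≥0) : ℝ) * (C * 3 ^ κ * rInv φ y t) := by gcongr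
    _ = _ := by push_cast; ring



theorem a1_comp {n : ℕ} {φ : RSp n → ℝ≥0 → ℝ≥0∞} (hφ : IsWeakPhi univ φ) {C κ σ : ℝ} (hC : 1 ≤ C) (hκ : 0 ≤ κ)
    (hJ : ∀ x, JGood C κ σ (rInv φ x)) (h1 : A1 φ) :
    ∃ K : ℝ, 0 < K ∧ ∀ Q : Cube n, volume Q.set ≤ 1 → ∃ P : RSp n → Prop,
      (∀ᵐ x ∂(volume.restrict Q.set), P x) ∧ ∀ x y, P x → P y → ∀ t, 1 ≤ t → t ≤ 1 / volume.real Q.set →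
        rInv φ x t ≤ K * rInv φ y t := by
  obtain ⟨β, hβ0, hβ1, hA⟩ := h1
  refine ⟨C * 2 ^ κ * (β : ℝ)⁻¹, by positivity, fun Q hQ => ?_⟩
  set μ := volume.restrict Q.set with hμ
  set f : ℕ → RSp n → ℝ≥0∞ := fun k x => phiInv φ x (ENNReal.ofReal (2 ^ k)) with hf
  refine ⟨fun x => ∀ k : ℕ, (2:ℝ) ^ k ≤ 1 / volume.real Q.set → (β : ℝ≥0∞) * f k x ≤ essInf (f k) μ ∧ essInf (f k) μ ≤ f k x, ?_, ?_⟩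
  · have e1 : ∀ᵐ x ∂μ, ∀ k, essInf (f k) μ ≤ f k x := by
      rw [ae_all_iff]; intro k; exact ae_essInf_le
    filter_upwards [hA Q hQ, e1] with x hx hx2 k hk
    refine ⟨?_, hx2 k⟩
    refine le_essInf_of_ae_le _ ?_
    filter_upwards [hx] with y hy
    refine hy _ ?_ ?_
    · rw [ENNReal.one_le_ofReal]; exact one_le_pow₀ (by norm_num)
    · rw [← Q.ofReal_real, ← ENNReal.ofReal_inv_of_pos Q.real_pos]
      exact ENNReal.ofReal_le_ofReal (by rwa [← one_div])
  · intro x y hx hy t ht1 htQ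
    obtain ⟨k, hk1, hk2⟩ := exists_nat_pow_near ht1 (y := (2:ℝ)) (by norm_num)
    have hk3 : (2:ℝ) ^ k ≤ 1 / volume.real Q.set := hk1.trans htQ
    have hs : (0:ℝ) < 2 ^ k := by positivity
    have e1 := (hJ x).up _ _ hs hk1
    have e2 := (hJ y).mono _ _ hs hk1
    have e3 : rInv φ x (2 ^ k) ≤ ((β⁻¹ : ℝ≥0) : ℝ) * rInv φ y (2 ^ k) := by
      apply rInv_of_le hφ
      have := (hx k hk3).1.trans (hy k hk3).2
      rw [ENNReal.coe_inv hβ0.ne', ← ENNReal.div_eq_inv_mul]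
      rw [ENNReal.le_div_iff_mul_le (Or.inl (by exact_mod_cast hβ0.ne')) (Or.inl ENNReal.coe_ne_top), mul_comm]
      exact this
    have e4 : t / 2 ^ k ≤ 2 := by
      rw [div_le_iff₀ hs]; rw [pow_succ] at hk2; linarith
    have p1 := (hJ x).pos _ hs
    have p2 := (hJ y).pos _ hs
    calc rInv φ x t ≤ C * (t / 2 ^ k) ^ κ * rInv φ x (2 ^ k) := e1
      _ ≤ C * 2 ^ κ * (((β⁻¹ : ℝ≥0) : ℝ) * rInv φ y t) := by
        gcongr
        exact e3.trans (by gcongr)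
      _ = _ := by push_cast; ring

/-- Comparability of the inverse functions at different points of a cube. -/
def CompOn {n : ℕ} (A K : ℝ) (h : RSp n → ℝ) (φ : RSp n → ℝ≥0 → ℝ≥0∞) : Prop :=
  ∀ Q : Cube n, ∃ P : RSp n → Prop, (∀ᵐ x ∂(volume.restrict Q.set), P x) ∧ ∀ x y, P x → P y →
    ∀ t, h x ≤ t → h y ≤ t → t ≤ max 1 (A / volume.real Q.set) → rInv φ x t ≤ K * rInv φ y t

theorem exists_compOn {n : ℕ} {φ : RSp n → ℝ≥0 → ℝ≥0∞} (hφ : IsWeakPhi univ φ) {C κ σ : ℝ} (hC : 1 ≤ C) (hκ : 0 ≤ κ)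
    (hJ : ∀ x, JGood C κ σ (rInv φ x)) (h0 : A0 univ φ) (h1 : A1 φ) (h2 : A2 φ) :
    ∃ h : RSp n → ℝ, Measurable h ∧ (∀ x, 0 < h x ∧ h x ≤ 1) ∧ (∫⁻ x, ENNReal.ofReal (h x)) < ∞ ∧
      ∀ A, 1 ≤ A → ∃ K : ℝ, 0 < K ∧ CompOn A K h φ := by
  obtain ⟨h, hm, hpos, hInth, K2, s0, hK2, hs0, hs01, P2, hP2, hc2⟩ := a2_comp hφ hC hκ hJ h2
  obtain ⟨K1, hK1, hc1⟩ := a1_comp hφ hC hκ hJ h1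
  obtain ⟨β, hβ0, hβ1, hA0⟩ := h0
  rw [Measure.restrict_univ] at hA0
  have hA0' : ∀ᵐ x ∂(volume : Measure (RSp n)), (β : ℝ) ≤ rInv φ x 1 ∧ rInv φ x 1 ≤ (β : ℝ)⁻¹ := by
    filter_upwards [hA0] with x hx
    rw [rInv, ENNReal.ofReal_one]
    have hne : phiInv φ x 1 ≠ ∞ := phiInv_ne_top hφ ENNReal.one_ne_top
    refine ⟨by simpa using ENNReal.toReal_mono hne hx.1, ?_⟩
    have := ENNReal.toReal_mono (by simpa using hβ0.ne') hx.2
    simpa using this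
  refine ⟨h, hm, hpos, hInth, fun A hA => ?_⟩
  -- constants
  set B : ℝ := (β : ℝ)⁻¹ * (β : ℝ)⁻¹ with hB
  have hβ0' : (0:ℝ) < β := hβ0
  have hBpos : 0 < B := by positivity
  set K : ℝ := K2 + B * (C * (1 / s0) ^ κ) + K1 * (C * A ^ κ) + C * A ^ κ * B + K1 with hK
  have hA0pos : 0 < A := by linarith
  refine ⟨K, by positivity, fun Q => ?_⟩
  have a0 : ∀ x y, ((β : ℝ) ≤ rInv φ x 1 ∧ rInv φ x 1 ≤ (β : ℝ)⁻¹) → ((β : ℝ) ≤ rInv φ y 1 ∧ rInv φ y 1 ≤ (β : ℝ)⁻¹) → rInv φ x 1 ≤ B * rInv φ y 1 := by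
    intro x y hx hy
    calc rInv φ x 1 ≤ (β : ℝ)⁻¹ := hx.2
      _ = B * β := by rw [hB]; field_simp
      _ ≤ _ := by gcongr; exact hy.1
  have conv : ∀ y t K', 0 < t → K' ≤ K → K' * rInv φ y t ≤ K * rInv φ y t := by
    intro y t K' ht hK'
    have := (hJ y).pos t ht
    gcongr
  have k1 : K2 ≤ K := by
    have : 0 ≤ B * (C * (1 / s0) ^ κ) + K1 * (C * A ^ κ) + C * A ^ κ * B + K1 := by positivity
    linarith
  have k2 : B * (C * (1 / s0) ^ κ) ≤ K := by
    have : 0 ≤ K2 + K1 * (C * A ^ κ) + C * A ^ κ * B + K1 := by positivity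
    linarith
  have k3 : K1 * (C * A ^ κ) ≤ K := by
    have : 0 ≤ K2 + B * (C * (1 / s0) ^ κ) + C * A ^ κ * B + K1 := by positivity
    linarith
  have k4 : C * A ^ κ * B ≤ K := by
    have : 0 ≤ K2 + B * (C * (1 / s0) ^ κ) + K1 * (C * A ^ κ) + K1 := by positivity
    linarith
  have k5 : K1 ≤ K := by
    have : 0 ≤ K2 + B * (C * (1 / s0) ^ κ) + K1 * (C * A ^ κ) + C * A ^ κ * B := by positivity
    linarith
  have small : ∀ x y, P2 x → P2 y → ((β : ℝ) ≤ rInv φ x 1 ∧ rInv φ x 1 ≤ (β : ℝ)⁻¹) → ((β : ℝ) ≤ rInv φ y 1 ∧ rInv φ y 1 ≤ (β : ℝ)⁻¹) →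
      ∀ t, h x ≤ t → h y ≤ t → t ≤ 1 → rInv φ x t ≤ K * rInv φ y t := by
    intro x y hx hy hx0 hy0 t hxt hyt ht1
    have ht0 : 0 < t := (hpos x).1.trans_le hxt
    rcases le_total t s0 with hts | hts
    · exact (hc2 x y hx hy t hxt hyt hts).trans (conv _ _ _ ht0 k1)
    · refine le_trans ?_ (conv y t _ ht0 k2)
      have p := (hJ y).pos t ht0
      calc rInv φ x t ≤ rInv φ x 1 := (hJ x).mono _ _ ht0 ht1
        _ ≤ B * rInv φ y 1 := a0 x y hx0 hy0
        _ ≤ B * (C * (1 / t) ^ κ * rInv φ y t) := by gcongr; exact (hJ y).up _ _ ht0 ht1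
        _ ≤ B * (C * (1 / s0) ^ κ * rInv φ y t) := by gcongr
        _ = _ := by ring
  have hv := Q.real_pos
  by_cases hQ : volume Q.set ≤ 1
  · obtain ⟨P1, hP1, hc1⟩ := hc1 Q hQ
    refine ⟨fun x => P1 x ∧ P2 x ∧ ((β : ℝ) ≤ rInv φ x 1 ∧ rInv φ x 1 ≤ (β : ℝ)⁻¹), ?_, ?_⟩
    · filter_upwards [hP1, ae_restrict_of_ae hP2, ae_restrict_of_ae hA0'] with x h1 h2 h3
      exact ⟨h1, h2, h3⟩
    · rintro x y ⟨hx1, hx2, hx0⟩ ⟨hy1, hy2, hy0⟩ t hxt hyt htA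
      have ht0 : 0 < t := (hpos x).1.trans_le hxt
      rcases le_total t 1 with ht1 | ht1
      · exact small x y hx2 hy2 hx0 hy0 t hxt hyt ht1
      rcases le_total t (1 / volume.real Q.set) with htQ | htQ
      · exact (hc1 x y hx1 hy1 t ht1 htQ).trans (conv _ _ _ ht0 k5)
      · refine le_trans ?_ (conv y t _ ht0 k3)
        have hQ1 : volume.real Q.set ≤ 1 := by
          have := ENNReal.toReal_mono ENNReal.one_ne_top hQ
          simpa [Measure.real] using this
        have hu1 : 1 ≤ 1 / volume.real Q.set := by rw [le_div_iff₀ hv]; linarith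
        have hu0 : 0 < 1 / volume.real Q.set := by positivity
        have htA' : t ≤ A / volume.real Q.set := by
          rcases le_max_iff.1 htA with h | h
          · have : A * 1 ≤ A * (1 / volume.real Q.set) := by gcongr
            rw [mul_one_div] at this
            linarith
          · exact h
        have hr : t / (1 / volume.real Q.set) ≤ A := by
          rw [div_le_iff₀ hu0, mul_one_div]; exact htA'
        have p := (hJ y).pos t ht0
        have p2 := (hJ x).pos _ hu0
        calc rInv φ x t ≤ C * (t / (1 / volume.real Q.set)) ^ κ * rInv φ x (1 / volume.real Q.set) := (hJ x).up _ _ hu0 htQ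
          _ ≤ C * A ^ κ * (K1 * rInv φ y (1 / volume.real Q.set)) := by
              gcongr
              exact hc1 x y hx1 hy1 _ hu1 le_rfl
          _ ≤ C * A ^ κ * (K1 * rInv φ y t) := by
              gcongr
              exact (hJ y).mono _ _ hu0 htQ
          _ = _ := by ring
  · refine ⟨fun x => P2 x ∧ ((β : ℝ) ≤ rInv φ x 1 ∧ rInv φ x 1 ≤ (β : ℝ)⁻¹), ?_, ?_⟩
    · filter_upwards [ae_restrict_of_ae hP2, ae_restrict_of_ae hA0'] with x h2 h3
      exact ⟨h2, h3⟩
    · rintro x y ⟨hx2, hx0⟩ ⟨hy2, hy0⟩ t hxt hyt htA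
      have ht0 : 0 < t := (hpos x).1.trans_le hxt
      rcases le_total t 1 with ht1 | ht1
      · exact small x y hx2 hy2 hx0 hy0 t hxt hyt ht1
      refine le_trans ?_ (conv y t _ ht0 k4)
      have hQ1 : 1 ≤ volume.real Q.set := by
        have := ENNReal.toReal_mono Q.volume_ne_top (not_le.1 hQ).le
        simpa [Measure.real] using this
      have htA' : t ≤ A := by
        refine htA.trans (max_le hA ?_)
        rw [div_le_iff₀ hv]
        nlinarith
      have p := (hJ y).pos t ht0
      have p2 := (hJ x).pos 1 one_pos
      calc rInv φ x t ≤ C * (t / 1) ^ κ * rInv φ x 1 := (hJ x).up _ _ one_pos ht1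
        _ ≤ C * A ^ κ * (B * rInv φ y 1) := by
            rw [div_one]
            gcongr
            exact a0 x y hx0 hy0
        _ ≤ C * A ^ κ * (B * rInv φ y t) := by
            gcongr
            exact (hJ y).mono _ _ one_pos ht1
        _ = _ := by ring



theorem fracInv_real {n : ℕ} {α : ℝ} {φ ψ : RSp n → ℝ≥0 → ℝ≥0∞} (hφ : IsWeakPhi univ φ) (hψ : IsWeakPhi univ ψ)
    (hinv : FracInvRel α φ ψ) : ∃ c₁ c₂ : ℝ, 0 < c₁ ∧ 0 < c₂ ∧ ∀ x t, 0 < t →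
      c₁ * (t ^ (α / (n : ℝ)) * rInv ψ x t) ≤ rInv φ x t ∧ rInv φ x t ≤ c₂ * (t ^ (α / (n : ℝ)) * rInv ψ x t) := by
  obtain ⟨c₁, c₂, hc₁, h⟩ := hinv
  have key : ∀ x t, 0 < t → c₁ * (t ^ (α / (n : ℝ)) * rInv ψ x t) ≤ rInv φ x t ∧ rInv φ x t ≤ c₂ * (t ^ (α / (n : ℝ)) * rInv ψ x t) := by
    intro x t ht
    have h' := h x t.toNNReal (Real.toNNReal_pos.2 ht)
    have hne : ((t.toNNReal : ℝ≥0∞) ^ (α / (n : ℝ))) ≠ ∞ := by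
      rw [← ENNReal.coe_rpow_of_ne_zero (Real.toNNReal_pos.2 ht).ne']; exact ENNReal.coe_ne_top
    have e : ((t.toNNReal : ℝ≥0∞) ^ (α / (n : ℝ))).toReal = t ^ (α / (n : ℝ)) := by
      rw [← ENNReal.toReal_rpow, ENNReal.coe_toReal, Real.coe_toNNReal _ ht.le]
    have h1 := ENNReal.toReal_mono (phiInv_ne_top hφ ENNReal.coe_ne_top) h'.1
    have h2 := ENNReal.toReal_mono (ENNReal.mul_ne_top ENNReal.coe_ne_top
      (ENNReal.mul_ne_top hne (phiInv_ne_top hψ ENNReal.coe_ne_top))) h'.2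
    rw [ENNReal.toReal_mul, ENNReal.toReal_mul, e, ENNReal.coe_toReal] at h1 h2
    exact ⟨h1, h2⟩
  refine ⟨c₁, max c₂ 1, hc₁, by positivity, fun x t ht => ⟨(key x t ht).1, (key x t ht).2.trans ?_⟩⟩
  have : 0 ≤ rInv ψ x t := ENNReal.toReal_nonneg
  gcongr
  exact le_max_left _ _

theorem jgood_psi {n : ℕ} {a c₁ c₂ C κ σ : ℝ} {φ ψ : RSp n → ℝ≥0 → ℝ≥0∞} (hψ : IsWeakPhi univ ψ)
    (hc₁ : 0 < c₁) (hc₂ : 0 < c₂) (hC : 1 ≤ C) (hinv : ∀ x t, 0 < t →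
      c₁ * (t ^ a * rInv ψ x t) ≤ rInv φ x t ∧ rInv φ x t ≤ c₂ * (t ^ a * rInv ψ x t))
    (hJ : ∀ x, JGood C κ σ (rInv φ x)) (x : RSp n) : JGood (C * (c₂ / c₁)) (κ - a) (σ - a) (rInv ψ x) := by
  have hpos : ∀ t, 0 < t → 0 < rInv ψ x t := fun t ht =>
    ENNReal.toReal_pos (phiInv_pos hψ (ENNReal.ofReal_pos.2 ht)).ne' (phiInv_ne_top hψ ENNReal.ofReal_ne_top)
  refine ⟨hpos, ?_, ?_, ?_⟩
  · intro s t hs hst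
    exact ENNReal.toReal_mono (phiInv_ne_top hψ ENNReal.ofReal_ne_top) (phiInv_mono (ENNReal.ofReal_le_ofReal hst))
  · intro s t hs hst
    have ht : 0 < t := hs.trans_le hst
    have h1 := (hinv x t ht).1
    have h2 := (hinv x s hs).2
    have h3 := (hJ x).up s t hs hst
    have hta : 0 < t ^ a := Real.rpow_pos_of_pos ht a
    have hsa : 0 < s ^ a := Real.rpow_pos_of_pos hs a
    rw [Real.rpow_sub (by positivity), Real.div_rpow ht.le hs.le a]
    have : c₁ * t ^ a * rInv ψ x t ≤ c₁ * t ^ a * (C * (c₂ / c₁) * ((t / s) ^ κ / (t ^ a / s ^ a)) * rInv ψ x s) := by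
      calc c₁ * t ^ a * rInv ψ x t ≤ C * (t / s) ^ κ * rInv φ x s := by linarith
        _ ≤ C * (t / s) ^ κ * (c₂ * (s ^ a * rInv ψ x s)) := by gcongr
        _ = _ := by field_simp
    exact le_of_mul_le_mul_left this (by positivity)
  · intro s t hs hst
    have ht : 0 < t := hs.trans_le hst
    have h1 := (hinv x s hs).1
    have h2 := (hinv x t ht).2
    have h3 := (hJ x).low s t hs hst
    have hta : 0 < t ^ a := Real.rpow_pos_of_pos ht a
    have hsa : 0 < s ^ a := Real.rpow_pos_of_pos hs a
    rw [Real.rpow_sub (by positivity), Real.div_rpow hs.le ht.le a]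
    have : c₁ * s ^ a * rInv ψ x s ≤ c₁ * s ^ a * (C * (c₂ / c₁) * ((s / t) ^ σ / (s ^ a / t ^ a)) * rInv ψ x t) := by
      calc c₁ * s ^ a * rInv ψ x s ≤ C * (s / t) ^ σ * rInv φ x t := by linarith
        _ ≤ C * (s / t) ^ σ * (c₂ * (t ^ a * rInv ψ x t)) := by gcongr
        _ = _ := by field_simp
    exact le_of_mul_le_mul_left this (by positivity)

theorem compOn_psi {n : ℕ} {a c₁ c₂ A K : ℝ} {h : RSp n → ℝ} {φ ψ : RSp n → ℝ≥0 → ℝ≥0∞}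
    (hc₁ : 0 < c₁) (hK : 0 < K) (hpos : ∀ x, 0 < h x) (hinv : ∀ x t, 0 < t →
      c₁ * (t ^ a * rInv ψ x t) ≤ rInv φ x t ∧ rInv φ x t ≤ c₂ * (t ^ a * rInv ψ x t))
    (hcomp : CompOn A K h φ) : CompOn A (K * (c₂ / c₁)) h ψ := by
  intro Q
  obtain ⟨P, hP, hc⟩ := hcomp Q
  refine ⟨P, hP, fun x y hx hy t hxt hyt htA => ?_⟩
  have ht : 0 < t := (hpos x).trans_le hxt
  have hta : 0 < t ^ a := Real.rpow_pos_of_pos ht a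
  have h1 := (hinv x t ht).1
  have h2 := (hinv y t ht).2
  have h3 := hc x y hx hy t hxt hyt htA
  have : c₁ * t ^ a * rInv ψ x t ≤ c₁ * t ^ a * (K * (c₂ / c₁) * rInv ψ y t) := by
    calc c₁ * t ^ a * rInv ψ x t ≤ K * rInv φ y t := by linarith
      _ ≤ K * (c₂ * (t ^ a * rInv ψ y t)) := by gcongr
      _ = _ := by field_simp
  exact le_of_mul_le_mul_left this (by positivity)

theorem pw_lemma {C K κ σ a B T g hx hy Λ : ℝ} {jx jy : ℝ → ℝ} (hC : 1 ≤ C) (hK : 0 < K) (hσ : 0 < σ) (hσκ : σ ≤ κ)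
    (ha : 0 ≤ a) (hJx : JGood C κ σ jx) (hJy : JGood C κ σ jy) (hx0 : 0 < hx) (hx1 : hx ≤ 1) (hy1 : hy ≤ 1) (hB1 : 1 ≤ B)
    (hcomp : ∀ t, hx ≤ t → hy ≤ t → t ≤ B → jy t ≤ K * jx t) (hT : 0 < T) (hTB : T ≤ B)
    (hg : 0 < g) (hyg : hy ≤ g) (hΛ : 1 ≤ Λ) :
    Λ * (g ^ a * jy g) ≤ C ^ 3 * K * T ^ a * (1 + (g / T) ^ (a + κ)) * jx (max hx (Λ ^ (1 / σ) * T)) := by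
  set S := max T hx with hS
  have hS0 : 0 < S := hT.trans_le (le_max_left _ _)
  set V := max hx (Λ ^ (1 / σ) * T) with hV
  have hSV : S ≤ V := by
    apply max_le _ (le_max_left _ _)
    refine le_trans ?_ (le_max_right _ _)
    have : 1 ≤ Λ ^ (1 / σ) := Real.one_le_rpow hΛ (by positivity)
    nlinarith
  have hV0 : 0 < V := hS0.trans_le hSV
  set g1 := max g T with hg1
  have hg10 : 0 < g1 := hg.trans_le (le_max_left _ _)
  have hκ : 0 < κ := hσ.trans_le hσκ
  have jS := hJx.pos S hS0
  have jV := hJx.pos V hV0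
  have hSB : S ≤ B := max_le hTB (hx1.trans hB1)
  have hTS1 : T / S ≤ 1 := by rw [div_le_one hS0]; exact le_max_left _ _
  have key : jy g1 ≤ C ^ 2 * K * (jx S * (T / S) ^ σ * (g1 / T) ^ κ) := by
    rcases le_or_gt S g1 with hc | hc
    · set u := max S hy with hu
      have hu0 : 0 < u := hS0.trans_le (le_max_left _ _)
      have hug : u ≤ g1 := max_le hc (hyg.trans (le_max_left _ _))
      have huB : u ≤ B := max_le hSB (hy1.trans hB1)
      have e1 := hJy.up u g1 hu0 hug
      have e2 := hcomp u ((le_max_right _ _).trans (le_max_left _ _)) (le_max_right _ _) huB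
      have e3 := hJx.up S u hS0 (le_max_left _ _)
      calc jy g1 ≤ C * (g1 / u) ^ κ * (K * (C * (u / S) ^ κ * jx S)) := e1.trans (by gcongr; exact e2.trans (by gcongr))
        _ = C ^ 2 * K * (jx S * ((g1 / u) * (u / S)) ^ κ) := by
            rw [Real.mul_rpow (by positivity) (by positivity)]; ring
        _ = C ^ 2 * K * (jx S * ((T / S) * (g1 / T)) ^ κ) := by
            rw [show (g1 / u) * (u / S) = (T / S) * (g1 / T) by field_simp]
        _ = C ^ 2 * K * (jx S * (T / S) ^ κ * (g1 / T) ^ κ) := by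
            rw [Real.mul_rpow (by positivity) (by positivity)]; ring
        _ ≤ _ := by
            have := Real.rpow_le_rpow_of_exponent_ge (by positivity) hTS1 hσκ
            gcongr
    · have e1 := hJy.low g1 S hg10 hc.le
      have e2 := hcomp S (le_max_right _ _) ((hyg.trans (le_max_left _ _)).trans hc.le) hSB
      have hgT : 1 ≤ g1 / T := by rw [one_le_div hT]; exact le_max_right _ _
      calc jy g1 ≤ C * (g1 / S) ^ σ * (K * jx S) := e1.trans (by gcongr)
        _ = C * K * (jx S * ((T / S) * (g1 / T)) ^ σ) := by
            rw [show (T / S) * (g1 / T) = g1 / S by field_simp]; ring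
        _ = C * K * (jx S * (T / S) ^ σ * (g1 / T) ^ σ) := by
            rw [Real.mul_rpow (by positivity) (by positivity)]; ring
        _ ≤ C ^ 2 * K * (jx S * (T / S) ^ σ * (g1 / T) ^ κ) := by
            have h1 := Real.rpow_le_rpow_of_exponent_le hgT hσκ
            have h2 : C ≤ C ^ 2 := by nlinarith
            gcongr
  have key2 : Λ * ((T / S) ^ σ * jx S) ≤ C * jx V := by
    have e1 := hJx.low S V hS0 hSV
    calc Λ * ((T / S) ^ σ * jx S) ≤ Λ * ((T / S) ^ σ * (C * (S / V) ^ σ * jx V)) := by gcongr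
      _ = C * ((Λ ^ (1 / σ)) ^ σ * ((T / S) ^ σ * (S / V) ^ σ)) * jx V := by
          rw [← Real.rpow_mul (by positivity), one_div_mul_cancel hσ.ne', Real.rpow_one]; ring
      _ = C * (Λ ^ (1 / σ) * T / V) ^ σ * jx V := by
          rw [← Real.mul_rpow (by positivity) (by positivity), ← Real.mul_rpow (by positivity) (by positivity)]
          congr 3; field_simp
      _ ≤ C * 1 * jx V := by
          have : (Λ ^ (1 / σ) * T / V) ^ σ ≤ 1 := by
            apply Real.rpow_le_one (by positivity) _ hσ.le
            rw [div_le_one hV0]; exact le_max_right _ _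
          gcongr
      _ = _ := by ring
  have hgT2 : (g1 / T) ^ (a + κ) ≤ 1 + (g / T) ^ (a + κ) := by
    rcases le_total g T with h | h
    · rw [hg1, max_eq_right h, div_self hT.ne', Real.one_rpow]
      have : 0 ≤ (g / T) ^ (a + κ) := by positivity
      linarith
    · rw [hg1, max_eq_left h]; linarith
  have jg := hJy.pos g hg
  calc Λ * (g ^ a * jy g) ≤ Λ * (g1 ^ a * jy g1) := by
        have := hJy.mono g g1 hg (le_max_left _ _)
        gcongr
        exact le_max_left _ _
    _ ≤ Λ * (g1 ^ a * (C ^ 2 * K * (jx S * (T / S) ^ σ * (g1 / T) ^ κ))) := by gcongr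
    _ = C ^ 2 * K * T ^ a * (g1 / T) ^ (a + κ) * (Λ * ((T / S) ^ σ * jx S)) := by
        rw [Real.rpow_add (by positivity), Real.div_rpow hg10.le hT.le a]
        have := Real.rpow_pos_of_pos hT a
        field_simp
    _ ≤ C ^ 2 * K * T ^ a * (1 + (g / T) ^ (a + κ)) * (C * jx V) := by gcongr
    _ = _ := by ring



theorem bmo_moment {n : ℕ} {b : RSp n → ℝ} (hb : IsBMO b) {N : ℝ} (hN : 0 < N) :
    ∃ C : ℝ≥0, ∀ Q : Cube n, ∫⁻ y in Q.set, ENNReal.ofReal ((1 + |b y - cubeAvg Q b|) ^ N) ≤ C * volume Q.set := by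
  obtain ⟨κ, hκ, hJN⟩ := john_nirenberg hb
  obtain ⟨c, hc⟩ := poly_le_exp N κ hN hκ
  refine ⟨c * 2 * 8, fun Q => ?_⟩
  calc ∫⁻ y in Q.set, ENNReal.ofReal ((1 + |b y - cubeAvg Q b|) ^ N)
      ≤ ∫⁻ y in Q.set, (c * 2) * ENNReal.ofReal (Real.exp (κ * |b y - cubeAvg Q b|)) := by
        refine lintegral_mono fun y => (hc _).trans ?_
        rw [mul_assoc]
        refine mul_le_mul_right ?_ _
        rw [two_mul]
        refine add_le_add (eexp_mono ?_) (eexp_mono ?_)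
        · exact mul_le_mul_of_nonneg_left (le_abs_self _) hκ.le
        · rw [neg_mul, ← mul_neg]; exact mul_le_mul_of_nonneg_left (neg_le_abs _) hκ.le
    _ = (c * 2) * ∫⁻ y in Q.set, ENNReal.ofReal (Real.exp (κ * |b y - cubeAvg Q b|)) :=
        lintegral_const_mul' _ _ (ENNReal.mul_ne_top ENNReal.coe_ne_top (by norm_num))
    _ ≤ (c * 2) * (8 * volume Q.set) := mul_le_mul_right (hJN Q) _
    _ = _ := by push_cast; ring

/-- All the structural data extracted from the hypotheses. -/
structure Pkg {n : ℕ} (a κ σ C c₁ c₂ : ℝ) (h : RSp n → ℝ) (φ ψ : RSp n → ℝ≥0 → ℝ≥0∞) : Prop where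
  hφ : IsWeakPhi univ φ
  hψ : IsWeakPhi univ ψ
  ha : 0 ≤ a
  ha1 : a < 1
  hσ : 0 < σ
  hσκ : σ ≤ κ
  haκ : a + κ < 1
  hC : 1 ≤ C
  hc₁ : 0 < c₁
  hc₂ : 0 < c₂
  inv : ∀ x t, 0 < t → c₁ * (t ^ a * rInv ψ x t) ≤ rInv φ x t ∧ rInv φ x t ≤ c₂ * (t ^ a * rInv ψ x t)
  hJ : ∀ x, JGood C κ σ (rInv ψ x)
  hm : Measurable h
  hh : ∀ x, 0 < h x ∧ h x ≤ 1
  hInth : (∫⁻ x, ENNReal.ofReal (h x)) < ∞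
  comp : ∀ A, 1 ≤ A → ∃ K : ℝ, 0 < K ∧ CompOn A K h ψ

theorem exists_pkg {n : ℕ} {p α r : ℝ} {φ ψ : RSp n → ℝ≥0 → ℝ≥0∞}
    (hp : 1 < p) (hα : 0 ≤ α / (n : ℝ)) (hφ : IsWeakPhi univ φ) (hψ : IsWeakPhi univ ψ) (hinv : FracInvRel α φ ψ)
    (hr₁ : α / (n : ℝ) < r) (hr₂ : r ≤ 1 / p)
    (ha0 : A0 univ φ) (ha1 : A1 φ) (ha2 : A2 φ) (hainc : AInc p univ φ) (hadec : ADec (1 / r) univ φ) :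
    ∃ κ σ C c₁ c₂ h, Pkg (n := n) (α / (n : ℝ)) κ σ C c₁ c₂ h φ ψ := by
  obtain ⟨c₁, c₂, hc₁, hc₂, hi⟩ := fracInv_real hφ hψ hinv
  obtain ⟨C, hC, hJ⟩ := jgood_phi hφ (by linarith) (by linarith) hainc hadec
  have hp1 : 1 / p < 1 := by rw [div_lt_one (by linarith)]; exact hp
  obtain ⟨h, hm, hh, hInth, hcomp⟩ := exists_compOn hφ hC (by positivity) hJ ha0 ha1 ha2
  have hJψ := jgood_psi hψ hc₁ hc₂ hC hi hJ
  have hle : c₁ ≤ c₂ := by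
    have := hi 0 1 one_pos
    have h2 := (hJψ 0).pos 1 one_pos
    have h3 := this.1.trans this.2
    rw [Real.one_rpow, one_mul] at h3
    exact le_of_mul_le_mul_right h3 h2
  refine ⟨1 / p - α / n, r - α / n, C * (c₂ / c₁), c₁, c₂, h, hφ, hψ, hα, by linarith, by linarith, by linarith, by linarith, ?_, hc₁, hc₂, hi, hJψ, hm, hh, hInth, ?_⟩
  · have : 1 ≤ c₂ / c₁ := by rwa [one_le_div hc₁]
    nlinarith
  · intro A hA
    obtain ⟨K, hK, hc⟩ := hcomp A hA
    exact ⟨_, by positivity, compOn_psi hc₁ hK (fun x => (hh x).1) hi hc⟩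

/-- The maximal commutator-type operator dominating everything. -/
noncomputable def bigN {n : ℕ} (a : ℝ) (b f : RSp n → ℝ) (x : RSp n) : ℝ≥0∞ :=
  ⨆ (Q : Cube n) (_ : x ∈ Q.set), volume Q.set ^ (a - 1) *
    ∫⁻ y in Q.set, ENNReal.ofReal (1 + |b x - b y|) * (‖f y‖₊ : ℝ≥0∞)

theorem holder_avg {n : ℕ} {s : ℝ} (hs : 1 < s) {G : RSp n → ℝ≥0∞} (hG : AEMeasurable G) (Q : Cube n) :
    ((volume Q.set)⁻¹ * ∫⁻ y in Q.set, G y) ^ s ≤ (volume Q.set)⁻¹ * ∫⁻ y in Q.set, G y ^ s := by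
  have hconj : s.HolderConjugate (Real.conjExponent s) := Real.HolderConjugate.conjExponent hs
  have h := ENNReal.lintegral_mul_le_Lp_mul_Lq (volume.restrict Q.set) hconj hG.restrict (g := fun _ => 1) aemeasurable_const
  simp only [Pi.mul_apply, mul_one, ENNReal.one_rpow, lintegral_one, Measure.restrict_apply_univ] at h
  have hs0 : 0 < s := by linarith
  have v0 := Q.volume_ne_zero
  have v1 := Q.volume_ne_top
  have hex : 1 / Real.conjExponent s * s = s - 1 := by
    have := hconj.inv_add_inv_eq_one
    rw [one_div]
    have h2 : (Real.conjExponent s)⁻¹ = 1 - s⁻¹ := by linarith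
    rw [h2, sub_mul, one_mul, inv_mul_cancel₀ hs0.ne']
  calc ((volume Q.set)⁻¹ * ∫⁻ y in Q.set, G y) ^ s
      ≤ ((volume Q.set)⁻¹ * ((∫⁻ y in Q.set, G y ^ s) ^ (1 / s) * volume Q.set ^ (1 / Real.conjExponent s))) ^ s :=
        ENNReal.rpow_le_rpow (mul_le_mul_right h _) hs0.le
    _ = (volume Q.set)⁻¹ ^ s * ((∫⁻ y in Q.set, G y ^ s) * volume Q.set ^ (s - 1)) := by
        rw [ENNReal.mul_rpow_of_nonneg _ _ hs0.le, ENNReal.mul_rpow_of_nonneg _ _ hs0.le, ← ENNReal.rpow_mul, ← ENNReal.rpow_mul,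
          one_div_mul_cancel hs0.ne', ENNReal.rpow_one, hex]
    _ = (volume Q.set)⁻¹ * ∫⁻ y in Q.set, G y ^ s := by
        rw [ENNReal.inv_rpow, ← ENNReal.rpow_neg, mul_left_comm, ← ENNReal.rpow_add _ _ v0 v1, mul_comm]
        congr 1
        rw [show -s + (s - 1) = -1 by ring, ENNReal.rpow_neg_one]



theorem cube_est {n : ℕ} {a κ σ C c₁ c₂ : ℝ} {h : RSp n → ℝ} {φ ψ : RSp n → ℝ≥0 → ℝ≥0∞}
    (hP : Pkg a κ σ C c₁ c₂ h φ ψ) {b : RSp n → ℝ} (hb : IsBMO b) {s A : ℝ} (hs : 1 < s) (hsκ : a + κ = 1 / s * (1 / s)) (hA : 1 ≤ A) :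
    ∃ D : ℝ≥0, ∀ Q : Cube n, ∃ P : RSp n → Prop, (∀ᵐ x ∂(volume.restrict Q.set), P x) ∧
      ∀ (g f : RSp n → ℝ), Measurable g → (∀ y, h y ≤ g y) → (∫⁻ y, ENNReal.ofReal (g y)) ≤ ENNReal.ofReal A →
        (∀ᵐ y ∂(volume : Measure (RSp n)), (‖f y‖₊ : ℝ≥0∞) ≤ phiInv φ y (ENNReal.ofReal (g y))) → ∀ x, P x →
        volume Q.set ^ (a - 1) * ∫⁻ y in Q.set, ENNReal.ofReal (1 + |b x - b y|) * (‖f y‖₊ : ℝ≥0∞) ≤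
          D * phiInv ψ x (ENNReal.ofReal (h x) + ENNReal.ofReal ((1 + |b x - cubeAvg Q b|) ^ (1 / σ)) *
            ((volume Q.set)⁻¹ * ∫⁻ y in Q.set, ENNReal.ofReal (g y) ^ (1 / s)) ^ s) := by
  obtain ⟨K, hK, hcomp⟩ := hP.comp A hA
  have hs0 : 0 < s := by linarith
  set s' := Real.conjExponent s with hs'
  have hconj : s.HolderConjugate s' := Real.HolderConjugate.conjExponent hs
  have hs'0 : 0 < s' := hconj.symm.pos
  obtain ⟨C1, hC1⟩ := bmo_moment hb one_pos
  obtain ⟨Cm, hCm⟩ := bmo_moment hb hs'0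
  have hC0 : 0 < C := lt_of_lt_of_le one_pos hP.hC
  have hc₂ := hP.hc₂
  have hA0 : 0 < A := by linarith
  set M1 : ℝ := c₂ * (C ^ 3 * K) * A ^ a with hM1
  have hM1pos : 0 < M1 := by positivity
  refine ⟨(C1 + Cm ^ (1 / s')) * M1.toNNReal, fun Q => ?_⟩
  obtain ⟨P, hPae, hPc⟩ := hcomp Q
  refine ⟨P, hPae, fun g f hgm hhg hgA hfg x hx => ?_⟩
  have v0 := Q.volume_ne_zero
  have v1 := Q.volume_ne_top
  have hgpos : ∀ y, 0 < g y := fun y => (hP.hh y).1.trans_le (hhg y)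
  set G : RSp n → ℝ≥0∞ := fun y => ENNReal.ofReal (g y) ^ (1 / s) with hG
  have hGm : Measurable G := hgm.ennreal_ofReal.pow_const _
  set τ := (volume Q.set)⁻¹ * ∫⁻ y in Q.set, G y with hτ
  have hGs : ∀ y, G y ^ s = ENNReal.ofReal (g y) := fun y => by
    rw [hG]; simp only; rw [← ENNReal.rpow_mul, one_div_mul_cancel hs0.ne', ENNReal.rpow_one]
  have hτs : τ ^ s ≤ (volume Q.set)⁻¹ * ENNReal.ofReal A := by
    refine (holder_avg hs hGm.aemeasurable Q).trans (mul_le_mul_right ?_ _)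
    simp only [hGs]
    exact (setLIntegral_le_lintegral _ _).trans hgA
  have hτs_top : τ ^ s ≠ ∞ := ne_top_of_le_ne_top (ENNReal.mul_ne_top (ENNReal.inv_ne_top.2 v0) ENNReal.ofReal_ne_top) hτs
  have hτtop : τ ≠ ∞ := fun h => by rw [h, ENNReal.top_rpow_of_pos hs0] at hτs_top; exact hτs_top rfl
  have hτ0 : τ ≠ 0 := by
    rw [hτ]
    refine mul_ne_zero (ENNReal.inv_ne_zero.2 v1) ?_
    rw [← pos_iff_ne_zero, setLIntegral_pos_iff hGm]
    have : Function.support G = univ := by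
      ext y
      simp only [Function.mem_support, mem_univ, iff_true, hG]
      exact (ENNReal.rpow_pos (ENNReal.ofReal_pos.2 (hgpos y)) ENNReal.ofReal_ne_top).ne'
    rw [this, univ_inter]
    exact pos_iff_ne_zero.2 v0
  set T := (τ ^ s).toReal with hTdef
  have hTof : ENNReal.ofReal T = τ ^ s := ENNReal.ofReal_toReal hτs_top
  have hT : 0 < T := ENNReal.toReal_pos (ENNReal.rpow_pos (pos_iff_ne_zero.2 hτ0) hτtop).ne' hτs_top
  have hTA : T ≤ A / volume.real Q.set := by
    have := ENNReal.toReal_mono (ENNReal.mul_ne_top (ENNReal.inv_ne_top.2 v0) ENNReal.ofReal_ne_top) hτs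
    rw [ENNReal.toReal_mul, ENNReal.toReal_inv, ENNReal.toReal_ofReal hA0.le] at this
    rw [div_eq_inv_mul]; exact this
  set Λ := 1 + |b x - cubeAvg Q b| with hΛ
  have hΛ1 : 1 ≤ Λ := by rw [hΛ]; linarith [abs_nonneg (b x - cubeAvg Q b)]
  set V := max (h x) (Λ ^ (1 / σ) * T) with hV
  have hV0 : 0 < V := (hP.hh x).1.trans_le (le_max_left _ _)
  set jV := rInv ψ x V with hjV
  have hjV0 : 0 < jV := (hP.hJ x).pos V hV0
  set w : RSp n → ℝ := fun y => 1 + |b y - cubeAvg Q b| with hw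
  have hw1 : ∀ y, 1 ≤ w y := fun y => by rw [hw]; simp only; linarith [abs_nonneg (b y - cubeAvg Q b)]
  set M0 : ℝ := c₂ * (C ^ 3 * K) * T ^ a * jV with hM0
  have hM0pos : 0 < M0 := by positivity
  have hpt : ∀ᵐ y ∂(volume.restrict Q.set), ENNReal.ofReal (1 + |b x - b y|) * (‖f y‖₊ : ℝ≥0∞) ≤
      ENNReal.ofReal M0 * (ENNReal.ofReal (w y) + ENNReal.ofReal (w y) * (G y / τ) ^ (1 / s)) := by
    filter_upwards [hPae, ae_restrict_of_ae hfg] with y hy hfy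
    have e1 := (hP.inv y (g y) (hgpos y)).2
    have e2 := pw_lemma (B := max 1 (A / volume.real Q.set)) (T := T) (g := g y) (hx := h x) (hy := h y) (Λ := Λ) hP.hC hK hP.hσ hP.hσκ hP.ha (hP.hJ x) (hP.hJ y)
      (hP.hh x).1 (hP.hh x).2 (hP.hh y).2 (le_max_left _ _) (fun t h1 h2 h3 => hPc y x hy hx t h2 h1 h3) hT
      (hTA.trans (le_max_right _ _)) (hgpos y) (hhg y) hΛ1
    have e3 : 1 + |b x - b y| ≤ Λ * w y := by
      rw [hΛ, hw]; simp only
      have h1 : |b x - b y| ≤ |b x - cubeAvg Q b| + |b y - cubeAvg Q b| := by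
        have := abs_sub_le (b x) (cubeAvg Q b) (b y)
        rwa [abs_sub_comm (cubeAvg Q b) (b y)] at this
      have h2 := mul_nonneg (abs_nonneg (b x - cubeAvg Q b)) (abs_nonneg (b y - cubeAvg Q b))
      nlinarith
    have hz : ENNReal.ofReal ((g y / T) ^ (a + κ)) = (G y / τ) ^ (1 / s) := by
      rw [← ENNReal.ofReal_rpow_of_pos (div_pos (hgpos y) hT), ENNReal.ofReal_div_of_pos hT, hTof, hsκ,
        ENNReal.rpow_mul, ENNReal.div_rpow_of_nonneg _ _ (by positivity : 0 ≤ 1 / s), ← ENNReal.rpow_mul,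
        mul_one_div_cancel hs0.ne', ENNReal.rpow_one]
    have hw0 : 0 < w y := by linarith [hw1 y]
    have hgn : 0 ≤ (g y / T) ^ (a + κ) := Real.rpow_nonneg (div_nonneg (hgpos y).le hT.le) _
    have hjy := (hP.hJ y).pos _ (hgpos y)
    have hgy := hgpos y
    calc ENNReal.ofReal (1 + |b x - b y|) * (‖f y‖₊ : ℝ≥0∞) ≤ ENNReal.ofReal (1 + |b x - b y|) * ENNReal.ofReal (rInv φ y (g y)) := by
          rw [ofReal_rInv hP.hφ]; exact mul_le_mul_right hfy _
      _ = ENNReal.ofReal ((1 + |b x - b y|) * rInv φ y (g y)) := (ENNReal.ofReal_mul (by positivity)).symm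
      _ ≤ ENNReal.ofReal (M0 * (w y + w y * (g y / T) ^ (a + κ))) := by
          apply ENNReal.ofReal_le_ofReal
          calc (1 + |b x - b y|) * rInv φ y (g y) ≤ (Λ * w y) * (c₂ * (g y ^ a * rInv ψ y (g y))) := by
                refine mul_le_mul e3 e1 ENNReal.toReal_nonneg (by positivity)
            _ = c₂ * w y * (Λ * (g y ^ a * rInv ψ y (g y))) := by ring
            _ ≤ c₂ * w y * (C ^ 3 * K * T ^ a * (1 + (g y / T) ^ (a + κ)) * jV) := by gcongr
            _ = _ := by rw [hM0]; ring
      _ = _ := by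
          rw [ENNReal.ofReal_mul hM0pos.le, ENNReal.ofReal_add hw0.le (by positivity), ENNReal.ofReal_mul hw0.le, hz]
  have hwm : AEMeasurable (fun y => ENNReal.ofReal (w y)) (volume.restrict Q.set) := by
    have : AEMeasurable b volume := hb.1.aestronglyMeasurable.aemeasurable
    have h2 : AEMeasurable w volume := ((this.sub_const _).abs).const_add 1
    exact h2.ennreal_ofReal.restrict
  have hI1 : ∫⁻ y in Q.set, ENNReal.ofReal (w y) ≤ C1 * volume Q.set := by
    refine le_trans (le_of_eq ?_) (hC1 Q)
    simp only [Real.rpow_one, hw]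
  have hI2 : ∫⁻ y in Q.set, ENNReal.ofReal (w y) * (G y / τ) ^ (1 / s) ≤ (Cm ^ (1 / s') : ℝ≥0) * volume Q.set := by
    have hh := ENNReal.lintegral_mul_le_Lp_mul_Lq (volume.restrict Q.set) hconj.symm hwm
      (g := fun y => (G y / τ) ^ (1 / s)) ((hGm.div_const _).pow_const _).aemeasurable
    simp only [Pi.mul_apply] at hh
    have h1 : ∫⁻ y in Q.set, ENNReal.ofReal (w y) ^ s' ≤ Cm * volume Q.set := by
      refine le_trans (le_of_eq ?_) (hCm Q)
      refine lintegral_congr fun y => ?_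
      rw [ENNReal.ofReal_rpow_of_pos (by linarith [hw1 y])]
    have h2 : ∫⁻ y in Q.set, ((G y / τ) ^ (1 / s)) ^ s = volume Q.set := by
      have : ∀ y, ((G y / τ) ^ (1 / s)) ^ s = τ⁻¹ * G y := fun y => by
        rw [← ENNReal.rpow_mul, one_div_mul_cancel hs0.ne', ENNReal.rpow_one, ENNReal.div_eq_inv_mul]
      simp only [this]
      rw [lintegral_const_mul _ hGm]
      have e : ∫⁻ y in Q.set, G y = volume Q.set * τ := by
        rw [hτ, ← mul_assoc, ENNReal.mul_inv_cancel v0 v1, one_mul]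
      rw [e, mul_left_comm, ENNReal.inv_mul_cancel hτ0 hτtop, mul_one]
    rw [h2] at hh
    refine hh.trans ?_
    calc (∫⁻ y in Q.set, ENNReal.ofReal (w y) ^ s') ^ (1 / s') * volume Q.set ^ (1 / s)
        ≤ (Cm * volume Q.set) ^ (1 / s') * volume Q.set ^ (1 / s) :=
          mul_le_mul_left (ENNReal.rpow_le_rpow h1 (by positivity)) _
      _ = _ := by
          rw [ENNReal.mul_rpow_of_nonneg _ _ (by positivity), mul_assoc, ← ENNReal.rpow_add _ _ v0 v1, ENNReal.coe_rpow_of_nonneg _ (by positivity)]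
          have := hconj.symm.inv_add_inv_eq_one
          rw [one_div, one_div, this, ENNReal.rpow_one]
  have hvol : volume Q.set ^ (a - 1) * volume Q.set = volume Q.set ^ a := by
    nth_rewrite 2 [← ENNReal.rpow_one (volume Q.set)]
    rw [← ENNReal.rpow_add _ _ v0 v1]; congr 1; ring
  have hfin : volume Q.set ^ a * ENNReal.ofReal M0 ≤ ENNReal.ofReal M1 * ENNReal.ofReal jV := by
    rw [← Q.ofReal_real, ENNReal.ofReal_rpow_of_pos Q.real_pos, ← ENNReal.ofReal_mul (by positivity), ← ENNReal.ofReal_mul (by positivity)]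
    apply ENNReal.ofReal_le_ofReal
    have hv := Q.real_pos
    calc volume.real Q.set ^ a * M0 = c₂ * (C ^ 3 * K) * (volume.real Q.set * T) ^ a * jV := by
          rw [Real.mul_rpow hv.le hT.le]; ring
      _ ≤ c₂ * (C ^ 3 * K) * A ^ a * jV := by
          have h1 : volume.real Q.set * T ≤ A := by
            rw [le_div_iff₀ hv] at hTA; linarith
          have h2 := Real.rpow_le_rpow (by positivity) h1 hP.ha
          gcongr
  have hVle : ENNReal.ofReal V ≤ ENNReal.ofReal (h x) + ENNReal.ofReal (Λ ^ (1 / σ)) * τ ^ s := by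
    rw [← hTof, ← ENNReal.ofReal_mul (by positivity), ← ENNReal.ofReal_add (hP.hh x).1.le (by positivity)]
    apply ENNReal.ofReal_le_ofReal
    have : 0 ≤ Λ ^ (1 / σ) * T := by positivity
    exact max_le (by linarith) (by linarith [(hP.hh x).1])
  calc volume Q.set ^ (a - 1) * ∫⁻ y in Q.set, ENNReal.ofReal (1 + |b x - b y|) * (‖f y‖₊ : ℝ≥0∞)
      ≤ volume Q.set ^ (a - 1) * ∫⁻ y in Q.set, ENNReal.ofReal M0 * (ENNReal.ofReal (w y) + ENNReal.ofReal (w y) * (G y / τ) ^ (1 / s)) :=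
        mul_le_mul_right (lintegral_mono_ae hpt) _
    _ = volume Q.set ^ (a - 1) * (ENNReal.ofReal M0 * ((∫⁻ y in Q.set, ENNReal.ofReal (w y)) + ∫⁻ y in Q.set, ENNReal.ofReal (w y) * (G y / τ) ^ (1 / s))) := by
        rw [lintegral_const_mul' _ _ ENNReal.ofReal_ne_top, lintegral_add_left' hwm]
    _ ≤ volume Q.set ^ (a - 1) * (ENNReal.ofReal M0 * (C1 * volume Q.set + (Cm ^ (1 / s') : ℝ≥0) * volume Q.set)) :=
        mul_le_mul_right (mul_le_mul_right (add_le_add hI1 hI2) _) _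
    _ = (C1 + (Cm ^ (1 / s') : ℝ≥0)) * ((volume Q.set ^ (a - 1) * volume Q.set) * ENNReal.ofReal M0) := by ring
    _ ≤ (C1 + (Cm ^ (1 / s') : ℝ≥0)) * (ENNReal.ofReal M1 * ENNReal.ofReal jV) := by
        rw [hvol]; exact mul_le_mul_right hfin _
    _ = ((C1 + Cm ^ (1 / s')) * M1.toNNReal : ℝ≥0) * phiInv ψ x (ENNReal.ofReal V) := by
        rw [← ofReal_rInv hP.hψ]; push_cast; rw [mul_assoc]; rfl
    _ ≤ _ := mul_le_mul_right (phiInv_mono hVle) _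



theorem phiE_le {n : ℕ} {ψ : RSp n → ℝ≥0 → ℝ≥0∞} (hψ : IsWeakPhi univ ψ) :
    ∃ L : ℝ≥0, 1 ≤ L ∧ ∀ x (N Γ : ℝ≥0∞) (D μ : ℝ≥0), 0 < D → 2 * D < μ → N ≤ D * phiInv ψ x Γ →
      phiE ψ x (N / μ) ≤ (L * (2 * D / μ) : ℝ≥0) * Γ := by
  obtain ⟨L, hL1, hL⟩ := hψ.almost_inc
  refine ⟨L, hL1, fun x N Γ D μ hD hμ hN => ?_⟩
  refine iSup₂_le fun τ hτ => ?_
  rcases eq_or_ne τ 0 with h0 | h0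
  · rw [h0, hψ.zero x (mem_univ x)]; exact zero_le
  have hτ0 : 0 < τ := pos_iff_ne_zero.2 h0
  have hμ0 : 0 < μ := lt_of_le_of_lt zero_le hμ
  set k : ℝ≥0 := 2 * D / μ with hk
  have hk0 : 0 < k := by positivity
  have hk1 : k < 1 := by rw [hk, div_lt_one hμ0]; exact hμ
  have hlt : ((τ / k : ℝ≥0) : ℝ≥0∞) < phiInv ψ x Γ := by
    by_contra hc
    rw [not_lt] at hc
    have h1 : (τ : ℝ≥0∞) ≤ (D * (τ / k) / μ : ℝ≥0) := by
      refine hτ.trans ?_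
      rw [ENNReal.coe_div hμ0.ne', ENNReal.coe_mul]
      exact ENNReal.div_le_div_right (hN.trans (mul_le_mul_right hc _)) _
    rw [ENNReal.coe_le_coe] at h1
    have h2 : D * (τ / k) / μ = τ / 2 := by rw [hk]; field_simp
    rw [h2] at h1
    exact absurd h1 (not_le.2 (NNReal.half_lt_self h0))
  have h1 := lt_phiInv hlt
  have h2 : τ < τ / k := by rw [lt_div_iff₀ hk0]; exact mul_lt_of_lt_one_right hτ0 hk1
  have h3 := hL x (mem_univ x) τ (τ / k) hτ0 h2
  have h4 := scale_aux (f1 := ψ x τ) (f2 := ψ x (τ / k)) (L := L) (a := τ) (b := τ / k) 1 hτ0 (by positivity)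
    (by rw [ENNReal.rpow_one, ENNReal.rpow_one]; exact h3)
  rw [NNReal.rpow_one, show τ / k / τ = k⁻¹ by field_simp] at h4
  calc ψ x τ = k * (ψ x τ * ((k⁻¹ : ℝ≥0) : ℝ≥0∞)) := by
        rw [mul_left_comm, ← ENNReal.coe_mul, mul_inv_cancel₀ hk0.ne', ENNReal.coe_one, mul_one]
    _ ≤ k * (L * Γ) := mul_le_mul_right (h4.trans (mul_le_mul_right h1.le _)) _
    _ = _ := by push_cast; ring

theorem bigN_le_rat {n : ℕ} {a : ℝ} (ha : 0 ≤ a) (ha1 : a < 1) (b f : RSp n → ℝ) (x : RSp n) {R : ℝ≥0∞}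
    (hR : ∀ Q ∈ ratCubes n, x ∈ Q.set → volume Q.set ^ (a - 1) *
      ∫⁻ y in Q.set, ENNReal.ofReal (1 + |b x - b y|) * (‖f y‖₊ : ℝ≥0∞) ≤ R) : bigN a b f x ≤ 2 ^ n * R := by
  refine iSup₂_le fun Q hx => ?_
  obtain ⟨Q', hQ', hsub, hvol⟩ := exists_ratCube Q
  have e1 : (volume Q.set)⁻¹ ≤ 2 ^ n * (volume Q'.set)⁻¹ := by
    rw [← ENNReal.div_eq_inv_mul.trans (mul_comm _ _), ENNReal.le_div_iff_mul_le (Or.inl Q'.volume_ne_zero) (Or.inl Q'.volume_ne_top), mul_comm,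
      ← ENNReal.div_eq_inv_mul.trans (mul_comm _ _), ENNReal.div_le_iff Q.volume_ne_zero Q.volume_ne_top]
    exact hvol
  have hpow : ∀ Q : Cube n, volume Q.set ^ (a - 1) = ((volume Q.set)⁻¹) ^ (1 - a) := fun Q => by
    rw [ENNReal.inv_rpow, ← ENNReal.rpow_neg]; congr 1; ring
  have e2 : volume Q.set ^ (a - 1) ≤ 2 ^ n * volume Q'.set ^ (a - 1) := by
    rw [hpow, hpow]
    refine (ENNReal.rpow_le_rpow e1 (by linarith)).trans ?_
    rw [ENNReal.mul_rpow_of_nonneg _ _ (by linarith)]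
    refine mul_le_mul_left ?_ _
    calc ((2:ℝ≥0∞) ^ n) ^ (1 - a) ≤ ((2:ℝ≥0∞) ^ n) ^ (1:ℝ) := ENNReal.rpow_le_rpow_of_exponent_le (one_le_pow₀ (by norm_num)) (by linarith)
      _ = _ := ENNReal.rpow_one _
  calc _ ≤ (2 ^ n * volume Q'.set ^ (a - 1)) * ∫⁻ y in Q'.set, ENNReal.ofReal (1 + |b x - b y|) * (‖f y‖₊ : ℝ≥0∞) :=
        mul_le_mul' e2 (lintegral_mono_set hsub)
    _ ≤ 2 ^ n * R := by
        rw [mul_assoc]; exact mul_le_mul_right (hR Q' hQ' (hsub hx)) _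

theorem main_modular {n : ℕ} {a κ σ C c₁ c₂ : ℝ} {h : RSp n → ℝ} {φ ψ : RSp n → ℝ≥0 → ℝ≥0∞}
    (hP : Pkg a κ σ C c₁ c₂ h φ ψ) {b : RSp n → ℝ} (hb : IsBMO b) :
    ∃ C' : ℝ≥0, 0 < C' ∧ ∀ f : RSp n → ℝ, AEMeasurable f volume → (∫⁻ x, φ x ‖f x‖₊) ≤ 1 →
      ∫⁻ x, phiE ψ x (bigN a b f x / C') ≤ 1 := by
  have haκ : 0 < a + κ := by linarith [hP.ha, hP.hσ, hP.hσκ]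
  set s := Real.sqrt (1 / (a + κ)) with hs
  have hs1 : 1 < s := by
    rw [hs, Real.lt_sqrt (by norm_num), lt_div_iff₀ haκ]; linarith [hP.haκ]
  have hsκ : a + κ = 1 / s * (1 / s) := by
    rw [one_div_mul_one_div, hs, Real.mul_self_sqrt (by positivity), one_div_one_div]
  set A : ℝ := 1 + (∫⁻ x, ENNReal.ofReal (h x)).toReal with hA
  have hA1 : 1 ≤ A := by rw [hA]; linarith [ENNReal.toReal_nonneg (a := ∫⁻ x, ENNReal.ofReal (h x))]
  have hAof : ENNReal.ofReal A = 1 + ∫⁻ x, ENNReal.ofReal (h x) := by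
    rw [hA, ENNReal.ofReal_add zero_le_one ENNReal.toReal_nonneg, ENNReal.ofReal_one, ENNReal.ofReal_toReal hP.hInth.ne]
  obtain ⟨D, hD⟩ := cube_est hP hb hs1 hsκ hA1
  choose P hPae hPest using hD
  obtain ⟨W, hW⟩ := lemmaW hb (1 / σ) s (by have := hP.hσ; positivity) hs1
  obtain ⟨L, hL1, hL⟩ := phiE_le hP.hψ
  set D' : ℝ≥0 := 2 ^ n * D + 1 with hD'
  have hD'0 : 0 < D' := by positivity
  set E : ℝ≥0 := A.toNNReal + W * A.toNNReal with hE
  set μ : ℝ≥0 := 2 * D' * L * E + 2 * D' + 1 with hμ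
  have hμ0 : 0 < μ := by positivity
  refine ⟨μ, hμ0, fun f hf hφf => ?_⟩
  -- the function g
  have hFm : AEMeasurable (fun x => φ x ‖f x‖₊) volume := by
    have h1 := hP.hφ.meas (fun x => ‖hf.mk f x‖₊) hf.measurable_mk.nnnorm
    rw [Measure.restrict_univ] at h1
    refine h1.congr ?_
    filter_upwards [hf.ae_eq_mk] with x hx
    rw [hx]
  set F := hFm.mk _ with hF
  have hFF : (fun x => φ x ‖f x‖₊) =ᵐ[volume] F := hFm.ae_eq_mk
  have hFmeas : Measurable F := hFm.measurable_mk
  have hFint : ∫⁻ x, F x ≤ 1 := by rw [← lintegral_congr_ae hFF]; exact hφf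
  have hFfin : ∀ᵐ x ∂(volume : Measure (RSp n)), F x < ∞ := ae_lt_top hFmeas (ne_top_of_le_ne_top ENNReal.one_ne_top hFint)
  set g : RSp n → ℝ := fun x => (F x).toReal + h x with hg
  have hgm : Measurable g := hFmeas.ennreal_toReal.add hP.hm
  have hhg : ∀ y, h y ≤ g y := fun y => by rw [hg]; simp only; linarith [ENNReal.toReal_nonneg (a := F y)]
  have hgof : ∀ y, ENNReal.ofReal (g y) = ENNReal.ofReal (F y).toReal + ENNReal.ofReal (h y) := fun y =>
    ENNReal.ofReal_add ENNReal.toReal_nonneg (hP.hh y).1.le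
  have hgA : (∫⁻ y, ENNReal.ofReal (g y)) ≤ ENNReal.ofReal A := by
    simp only [hgof]
    rw [lintegral_add_left hFmeas.ennreal_toReal.ennreal_ofReal, hAof]
    refine add_le_add_left ((lintegral_mono fun y => ENNReal.ofReal_toReal_le).trans hFint) _
  have hfg : ∀ᵐ y ∂(volume : Measure (RSp n)), (‖f y‖₊ : ℝ≥0∞) ≤ phiInv φ y (ENNReal.ofReal (g y)) := by
    filter_upwards [hFF, hFfin] with y h1 h2
    apply le_phiInv (hP.hφ.mono y (mem_univ y))
    rw [hgof, ENNReal.ofReal_toReal h2.ne]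
    rw [h1]
    exact ENNReal.lt_add_right h2.ne (ENNReal.ofReal_pos.2 (hP.hh y).1).ne'
  set G : RSp n → ℝ≥0∞ := fun y => ENNReal.ofReal (g y) ^ (1 / s) with hG
  have hGm : Measurable G := hgm.ennreal_ofReal.pow_const _
  set Y : RSp n → ℝ≥0∞ := fun x => ⨆ Q ∈ ratCubes n, Q.set.indicator
        (fun x => ENNReal.ofReal ((1 + |b x - cubeAvg Q b|) ^ (1 / σ)) *
          ((volume Q.set)⁻¹ * ∫⁻ y in Q.set, G y) ^ s) x with hY
  have hYint : ∫⁻ x, Y x ≤ W * ENNReal.ofReal A := by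
    refine (hW G hGm.aemeasurable).trans (mul_le_mul_right ?_ _)
    refine le_trans (le_of_eq ?_) hgA
    refine lintegral_congr fun y => ?_
    rw [hG]; simp only; rw [← ENNReal.rpow_mul, one_div_mul_cancel (by linarith), ENNReal.rpow_one]
  set Γ : RSp n → ℝ≥0∞ := fun x => ENNReal.ofReal (h x) + Y x with hΓ
  have hΓint : ∫⁻ x, Γ x ≤ E := by
    rw [hΓ, lintegral_add_left hP.hm.ennreal_ofReal, hE]
    push_cast
    refine add_le_add ?_ hYint
    change _ ≤ ENNReal.ofReal A
    rw [hAof]; exact le_add_self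
  have hae : ∀ᵐ x ∂(volume : Measure (RSp n)), ∀ Q ∈ ratCubes n, x ∈ Q.set → P Q x :=
    (ae_ball_iff (ratCubes_countable n)).2 fun Q hQ => (ae_restrict_iff' Q.measurableSet).1 (hPae Q)
  have hN : ∀ᵐ x ∂(volume : Measure (RSp n)), phiE ψ x (bigN a b f x / μ) ≤ (L * (2 * D' / μ) : ℝ≥0) * Γ x := by
    filter_upwards [hae] with x hx
    apply hL x _ _ D' μ hD'0
    · rw [hμ]
      calc 2 * D' < 2 * D' + 1 := lt_add_one _
        _ ≤ _ := by rw [add_assoc]; exact le_add_self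
    · have h1 := bigN_le_rat hP.ha hP.ha1 b f x (R := D * phiInv ψ x (Γ x)) (fun Q hQ hxQ => by
        refine (hPest Q g f hgm hhg hgA hfg x (hx Q hQ hxQ)).trans (mul_le_mul_right (phiInv_mono ?_) _)
        refine add_le_add_right ?_ _
        rw [hY]; simp only
        refine le_trans (le_of_eq ?_) (le_iSup₂ (f := fun Q _ => Q.set.indicator
        (fun x => ENNReal.ofReal ((1 + |b x - cubeAvg Q b|) ^ (1 / σ)) *
          ((volume Q.set)⁻¹ * ∫⁻ y in Q.set, G y) ^ s) x) Q hQ)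
        rw [indicator_of_mem hxQ])
      refine h1.trans ?_
      rw [← mul_assoc]
      refine mul_le_mul_left ?_ _
      rw [hD']; push_cast
      exact le_self_add
  calc ∫⁻ x, phiE ψ x (bigN a b f x / μ) ≤ ∫⁻ x, (L * (2 * D' / μ) : ℝ≥0) * Γ x := lintegral_mono_ae hN
    _ = (L * (2 * D' / μ) : ℝ≥0) * ∫⁻ x, Γ x := lintegral_const_mul' _ _ ENNReal.coe_ne_top
    _ ≤ (L * (2 * D' / μ) : ℝ≥0) * E := mul_le_mul_right hΓint _
    _ ≤ 1 := by
        rw [← ENNReal.coe_mul, ← ENNReal.coe_one, ENNReal.coe_le_coe]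
        rw [show L * (2 * D' / μ) * E = (2 * D' * L * E) / μ by ring, div_le_one hμ0, hμ, add_assoc]
        exact le_self_add

theorem bigN_smul {n : ℕ} (a : ℝ) (b f : RSp n → ℝ) (x : RSp n) (l : ℝ≥0) :
    bigN a b (fun y => l * f y) x = l * bigN a b f x := by
  unfold bigN
  simp only [ENNReal.mul_iSup]
  refine iSup_congr fun Q => iSup_congr fun _ => ?_
  have : ∀ y, ENNReal.ofReal (1 + |b x - b y|) * ((‖(l:ℝ) * f y‖₊ : ℝ≥0) : ℝ≥0∞) = l * (ENNReal.ofReal (1 + |b x - b y|) * ((‖f y‖₊ : ℝ≥0) : ℝ≥0∞)) := by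
    intro y
    rw [nnnorm_mul, ENNReal.coe_mul, NNReal.nnnorm_eq]
    ring
  simp only [this]
  rw [lintegral_const_mul' _ _ ENNReal.coe_ne_top]
  ring

/-- Norm inequality for the dominating operator. -/
theorem main_norm {n : ℕ} {a κ σ C c₁ c₂ : ℝ} {h : RSp n → ℝ} {φ ψ : RSp n → ℝ≥0 → ℝ≥0∞}
    (hP : Pkg a κ σ C c₁ c₂ h φ ψ) {b : RSp n → ℝ} (hb : IsBMO b) :
    ∃ C' : ℝ≥0, 0 < C' ∧ ∀ f : RSp n → ℝ, AEMeasurable f volume →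
      orliczNormE ψ univ (bigN a b f) ≤ C' * orliczNorm φ univ f := by
  obtain ⟨C', hC', hmod⟩ := main_modular hP hb
  refine ⟨C', hC', fun f hf => ?_⟩
  rw [← ENNReal.div_le_iff' (by exact_mod_cast hC'.ne') ENNReal.coe_ne_top]
  apply le_sInf
  rintro _ ⟨l, ⟨hl0, hl⟩, rfl⟩
  rw [ENNReal.div_le_iff' (by exact_mod_cast hC'.ne') ENNReal.coe_ne_top]
  rw [Measure.restrict_univ] at hl
  simp only
  rw [← ENNReal.coe_mul]
  refine sInf_le ⟨C' * l, ⟨by positivity, ?_⟩, rfl⟩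
  rw [Measure.restrict_univ]
  have h1 := hmod (fun y => (l⁻¹ : ℝ≥0) * f y) (hf.const_mul _) (by
    refine le_trans (le_of_eq ?_) hl
    refine lintegral_congr fun x => ?_
    rw [nnnorm_mul, NNReal.nnnorm_eq, div_eq_inv_mul])
  refine le_trans (le_of_eq ?_) h1
  refine lintegral_congr fun x => ?_
  rw [bigN_smul]
  congr 1
  rw [ENNReal.coe_mul, ENNReal.coe_inv hl0.ne', ENNReal.div_eq_inv_mul, ENNReal.mul_inv (Or.inr ENNReal.coe_ne_top) (Or.inl ENNReal.coe_ne_top),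
    ENNReal.div_eq_inv_mul, mul_assoc]



theorem le_phiE {n : ℕ} {φ : RSp n → ℝ≥0 → ℝ≥0∞} {x : RSp n} {s : ℝ≥0} {t : ℝ≥0∞} (h : (s : ℝ≥0∞) ≤ t) : φ x s ≤ phiE φ x t :=
  le_iSup₂ (f := fun (s : ℝ≥0) (_ : (s : ℝ≥0∞) ≤ t) => φ x s) s h

theorem phiE_mono {n : ℕ} {φ : RSp n → ℝ≥0 → ℝ≥0∞} {x : RSp n} {s t : ℝ≥0∞} (h : s ≤ t) : phiE φ x s ≤ phiE φ x t :=
  iSup₂_le fun _ hτ => le_phiE (hτ.trans h)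

theorem orliczNorm_le_E {n : ℕ} {ψ : RSp n → ℝ≥0 → ℝ≥0∞} {F : RSp n → ℝ} {N : RSp n → ℝ≥0∞} {c : ℝ≥0} (hc : 0 < c)
    (h : ∀ᵐ x ∂(volume : Measure (RSp n)), (‖F x‖₊ : ℝ≥0∞) ≤ c * N x) :
    orliczNorm ψ univ F ≤ c * orliczNormE ψ univ N := by
  rw [← ENNReal.div_le_iff' (by exact_mod_cast hc.ne') ENNReal.coe_ne_top]
  apply le_sInf
  rintro _ ⟨l, ⟨hl0, hl⟩, rfl⟩
  rw [ENNReal.div_le_iff' (by exact_mod_cast hc.ne') ENNReal.coe_ne_top]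
  simp only
  rw [← ENNReal.coe_mul]
  refine sInf_le ⟨c * l, ⟨by positivity, le_trans ?_ hl⟩, rfl⟩
  rw [Measure.restrict_univ]
  refine lintegral_mono_ae ?_
  filter_upwards [h] with x hx
  apply le_phiE
  rw [ENNReal.coe_div (by positivity), ENNReal.coe_mul]
  refine (ENNReal.div_le_div_right hx _).trans (le_of_eq ?_)
  exact ENNReal.mul_div_mul_left _ _ (by exact_mod_cast hc.ne') ENNReal.coe_ne_top

theorem orliczNormE_mono {n : ℕ} {ψ : RSp n → ℝ≥0 → ℝ≥0∞} {F N : RSp n → ℝ≥0∞}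
    (h : ∀ x, F x ≤ N x) : orliczNormE ψ univ F ≤ orliczNormE ψ univ N := by
  apply sInf_le_sInf
  rintro _ ⟨l, ⟨hl0, hl⟩, rfl⟩
  exact ⟨l, ⟨hl0, (lintegral_mono fun x => phiE_mono (ENNReal.div_le_div_right (h x) _)).trans hl⟩, rfl⟩

/-- Pointwise bound for the commutator. -/
theorem commutator_pw {n : ℕ} {α M : ℝ} {b : RSp n → ℝ} (hb : AEMeasurable b volume) {f : RSp n → ℝ} (hf : AEMeasurable f volume)
    (hM : 0 ≤ M) {x : RSp n} (hx : max (-(b x)) 0 ≤ M) :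
    (‖fracMaximalCommutator α b f x‖₊ : ℝ≥0∞) ≤ ((1 + 2 * M).toNNReal : ℝ≥0) * bigN (α / (n : ℝ)) b f x := by
  set N := bigN (α / (n : ℝ)) b f x with hN
  have hc : 0 < (1 + 2 * M).toNNReal := Real.toNNReal_pos.2 (by positivity)
  rcases eq_or_ne N ∞ with h | hNtop
  · rw [h, ENNReal.mul_top (by exact_mod_cast hc.ne')]; exact le_top
  set X := fracMaximal α (fun y => b y * f y) x with hX
  set Y := fracMaximal α f x with hY
  have hfm : AEMeasurable (fun y => (‖f y‖₊ : ℝ≥0∞)) volume := hf.nnnorm.coe_nnreal_ennreal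
  have hYN : Y ≤ N := by
    refine iSup₂_mono fun Q hQ => mul_le_mul_right (lintegral_mono fun y => ?_) _
    refine le_mul_of_one_le_left zero_le ?_
    rw [ENNReal.one_le_ofReal]; linarith [abs_nonneg (b x - b y)]
  have hterm : ∀ Q : Cube n, x ∈ Q.set → volume Q.set ^ (α / (n : ℝ) - 1) *
      ∫⁻ y in Q.set, (‖b x - b y‖₊ : ℝ≥0∞) * ‖f y‖₊ ≤ N := by
    intro Q hQ
    refine le_trans ?_ (le_iSup₂ (f := fun Q (_ : x ∈ Q.set) => volume Q.set ^ (α / (n : ℝ) - 1) *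
    ∫⁻ y in Q.set, ENNReal.ofReal (1 + |b x - b y|) * (‖f y‖₊ : ℝ≥0∞)) Q hQ)
    refine mul_le_mul_right (lintegral_mono fun y => mul_le_mul_left ?_ _) _
    rw [← enorm_eq_nnnorm, Real.enorm_eq_ofReal_abs]
    exact ENNReal.ofReal_le_ofReal (by linarith)
  have h1 : X ≤ ‖b x‖₊ * Y + N := by
    refine iSup₂_le fun Q hQ => ?_
    calc volume Q.set ^ (α / (n : ℝ) - 1) * ∫⁻ y in Q.set, (‖b y * f y‖₊ : ℝ≥0∞)
        ≤ volume Q.set ^ (α / (n : ℝ) - 1) * ∫⁻ y in Q.set, (‖b x‖₊ * ‖f y‖₊ + (‖b x - b y‖₊ : ℝ≥0∞) * ‖f y‖₊) := by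
          refine mul_le_mul_right (lintegral_mono fun y => ?_) _
          rw [nnnorm_mul, ENNReal.coe_mul, ← add_mul]
          refine mul_le_mul_left ?_ _
          rw [← ENNReal.coe_add, ENNReal.coe_le_coe]
          have := nnnorm_sub_le (b x) (b x - b y)
          rwa [_root_.sub_sub_cancel] at this
      _ = ‖b x‖₊ * (volume Q.set ^ (α / (n : ℝ) - 1) * ∫⁻ y in Q.set, (‖f y‖₊ : ℝ≥0∞)) + volume Q.set ^ (α / (n : ℝ) - 1) * ∫⁻ y in Q.set, (‖b x - b y‖₊ : ℝ≥0∞) * ‖f y‖₊ := by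
          rw [lintegral_add_left' (hfm.const_mul _).restrict, lintegral_const_mul' _ _ ENNReal.coe_ne_top]; ring
      _ ≤ _ := by
          refine add_le_add (mul_le_mul_right ?_ _) (hterm Q hQ)
          exact le_iSup₂ (f := fun Q (_ : x ∈ Q.set) => volume Q.set ^ (α / (n : ℝ) - 1) * ∫⁻ y in Q.set, (‖f y‖₊ : ℝ≥0∞)) Q hQ
  have h2 : ‖b x‖₊ * Y ≤ X + N := by
    rw [hY, fracMaximal]
    simp only [ENNReal.mul_iSup]
    refine iSup₂_le fun Q hQ => ?_
    calc ‖b x‖₊ * (volume Q.set ^ (α / (n : ℝ) - 1) * ∫⁻ y in Q.set, (‖f y‖₊ : ℝ≥0∞))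
        = volume Q.set ^ (α / (n : ℝ) - 1) * ∫⁻ y in Q.set, (‖b x‖₊ * ‖f y‖₊ : ℝ≥0∞) := by
          rw [lintegral_const_mul' _ _ ENNReal.coe_ne_top]; ring
      _ ≤ volume Q.set ^ (α / (n : ℝ) - 1) * ∫⁻ y in Q.set, (‖b y * f y‖₊ + (‖b x - b y‖₊ : ℝ≥0∞) * ‖f y‖₊) := by
          refine mul_le_mul_right (lintegral_mono fun y => ?_) _
          rw [nnnorm_mul, ENNReal.coe_mul, ← add_mul]
          refine mul_le_mul_left ?_ _
          rw [← ENNReal.coe_add, ENNReal.coe_le_coe]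
          have := nnnorm_add_le (b y) (b x - b y)
          rwa [add_sub_cancel] at this
      _ = volume Q.set ^ (α / (n : ℝ) - 1) * (∫⁻ y in Q.set, (‖b y * f y‖₊ : ℝ≥0∞)) + volume Q.set ^ (α / (n : ℝ) - 1) * ∫⁻ y in Q.set, (‖b x - b y‖₊ : ℝ≥0∞) * ‖f y‖₊ := by
          have hbf : AEMeasurable (fun y => (‖b y * f y‖₊:ℝ≥0∞)) volume := (hb.mul hf).nnnorm.coe_nnreal_ennreal
          rw [lintegral_add_left' hbf.restrict, mul_add]
      _ ≤ _ := by
          refine add_le_add ?_ (hterm Q hQ)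
          exact le_iSup₂ (f := fun Q (_ : x ∈ Q.set) => volume Q.set ^ (α / (n : ℝ) - 1) * ∫⁻ y in Q.set, (‖b y * f y‖₊ : ℝ≥0∞)) Q hQ
  have hYtop : Y ≠ ∞ := ne_top_of_le_ne_top hNtop hYN
  have hbY : (‖b x‖₊ : ℝ≥0∞) * Y ≠ ∞ := ENNReal.mul_ne_top ENNReal.coe_ne_top hYtop
  have hXtop : X ≠ ∞ := ne_top_of_le_ne_top (ENNReal.add_ne_top.2 ⟨hbY, hNtop⟩) h1
  have r1 := ENNReal.toReal_mono (ENNReal.add_ne_top.2 ⟨hbY, hNtop⟩) h1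
  have r2 := ENNReal.toReal_mono (ENNReal.add_ne_top.2 ⟨hXtop, hNtop⟩) h2
  have r3 := ENNReal.toReal_mono hNtop hYN
  rw [ENNReal.toReal_add hbY hNtop, ENNReal.toReal_mul, ENNReal.coe_toReal, coe_nnnorm, Real.norm_eq_abs] at r1
  rw [ENNReal.toReal_add hXtop hNtop, ENNReal.toReal_mul, ENNReal.coe_toReal, coe_nnnorm, Real.norm_eq_abs] at r2
  rw [← ENNReal.ofReal_toReal hNtop]
  change _ ≤ ENNReal.ofReal (1 + 2 * M) * _
  rw [← ENNReal.ofReal_mul (by positivity), ← enorm_eq_nnnorm, Real.enorm_eq_ofReal_abs]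
  apply ENNReal.ofReal_le_ofReal
  rw [fracMaximalCommutator]
  have hy0 : 0 ≤ Y.toReal := ENNReal.toReal_nonneg
  have hb1 : 0 ≤ |b x| - b x := by linarith [le_abs_self (b x)]
  have hb2 : |b x| - b x ≤ 2 * M := by
    have h3 := le_max_left (-(b x)) 0
    rcases abs_cases (b x) with h | h <;> linarith
  have h5 := mul_le_mul hb2 r3 hy0 (by positivity)
  have h6 := mul_nonneg hb1 hy0
  rw [abs_le]
  constructor <;> nlinarith

/-- Pointwise bound for the test function. -/
theorem test_pw {n : ℕ} {α M : ℝ} (hα : 0 ≤ α / (n : ℝ)) {b : RSp n → ℝ} (hb : AEMeasurable b volume)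
    (hM : 0 ≤ M) (Q : Cube n) {x : RSp n} (hx : max (-(b x)) 0 ≤ M) :
    (‖commTestFn α Q b x‖₊ : ℝ≥0∞) ≤ ((1 + 2 * M).toNNReal : ℝ≥0) * bigN 0 b (cubeIndicator Q) x := by
  by_cases hxQ : x ∈ Q.set
  swap
  · rw [commTestFn, indicator_of_notMem hxQ]; simp
  rw [commTestFn, indicator_of_mem hxQ]
  set N := bigN 0 b (cubeIndicator Q) x with hN
  have hc : 0 < (1 + 2 * M).toNNReal := Real.toNNReal_pos.2 (by positivity)
  rcases eq_or_ne N ∞ with h | hNtop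
  · rw [h, ENNReal.mul_top (by exact_mod_cast hc.ne')]; exact le_top
  set v := volume Q.set ^ (-(α / (n : ℝ))) with hv
  have v0 := Q.volume_ne_zero
  have v1 := Q.volume_ne_top
  have hvtop : v ≠ ∞ := ENNReal.rpow_ne_top_of_ne_zero v0 v1
  set X := restFracMaximal α Q b x with hX
  have hNQ : ∀ Q' : Cube n, x ∈ Q'.set → Q'.set ⊆ Q.set → (volume Q'.set)⁻¹ * ∫⁻ y in Q'.set, ENNReal.ofReal (1 + |b x - b y|) ≤ N := by
    intro Q' hx' hsub
    refine le_trans (le_of_eq ?_) (le_iSup₂ (f := fun Q' (_ : x ∈ Q'.set) => volume Q'.set ^ ((0:ℝ) - 1) *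
      ∫⁻ y in Q'.set, ENNReal.ofReal (1 + |b x - b y|) * (‖cubeIndicator Q y‖₊ : ℝ≥0∞)) Q' hx')
    rw [zero_sub, ENNReal.rpow_neg_one]
    congr 1
    refine setLIntegral_congr_fun Q'.measurableSet fun y hy => ?_
    rw [cubeIndicator, indicator_of_mem (hsub hy)]; simp
  have hN1 : 1 ≤ N := by
    refine le_trans ?_ (hNQ Q hxQ subset_rfl)
    calc (1 : ℝ≥0∞) = (volume Q.set)⁻¹ * ∫⁻ y in Q.set, 1 := by
          rw [setLIntegral_one, ENNReal.inv_mul_cancel v0 v1]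
      _ ≤ _ := by
          refine mul_le_mul_right (lintegral_mono fun y => ?_) _
          rw [ENNReal.one_le_ofReal]; linarith [abs_nonneg (b x - b y)]
  have hbm : AEMeasurable (fun y => (‖b y‖₊ : ℝ≥0∞)) volume := hb.nnnorm.coe_nnreal_ennreal
  have hdiff : ∀ Q' : Cube n, x ∈ Q'.set → Q'.set ⊆ Q.set → (volume Q'.set)⁻¹ * ∫⁻ y in Q'.set, (‖b x - b y‖₊ : ℝ≥0∞) ≤ N := by
    intro Q' hx' hsub
    refine le_trans (mul_le_mul_right (lintegral_mono fun y => ?_) _) (hNQ Q' hx' hsub)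
    rw [← enorm_eq_nnnorm, Real.enorm_eq_ofReal_abs]
    exact ENNReal.ofReal_le_ofReal (by linarith)
  have havg : ∀ (Q' : Cube n) (c : ℝ≥0∞), (volume Q'.set)⁻¹ * ∫⁻ _ in Q'.set, c = c := fun Q' c => by
    rw [setLIntegral_const, mul_left_comm, ENNReal.inv_mul_cancel Q'.volume_ne_zero Q'.volume_ne_top, mul_one]
  have h1 : v * X ≤ ‖b x‖₊ + N := by
    rw [hX, restFracMaximal]
    simp only [ENNReal.mul_iSup]
    refine iSup_le fun Q' => iSup₂_le fun hx' hsub => ?_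
    have w0 := Q'.volume_ne_zero
    have w1 := Q'.volume_ne_top
    calc v * (volume Q'.set ^ (α / (n : ℝ) - 1) * ∫⁻ y in Q'.set, (‖b y‖₊ : ℝ≥0∞))
        = (volume Q'.set ^ (α / (n : ℝ)) * v) * ((volume Q'.set)⁻¹ * ∫⁻ y in Q'.set, (‖b y‖₊ : ℝ≥0∞)) := by
          rw [sub_eq_add_neg, ENNReal.rpow_add _ _ w0 w1, ENNReal.rpow_neg_one]; ring
      _ ≤ 1 * ((volume Q'.set)⁻¹ * ∫⁻ y in Q'.set, (‖b x‖₊ + ‖b x - b y‖₊ : ℝ≥0∞)) := by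
          refine mul_le_mul' ?_ (mul_le_mul_right (lintegral_mono fun y => ?_) _)
          · calc volume Q'.set ^ (α / (n : ℝ)) * v ≤ volume Q.set ^ (α / (n : ℝ)) * v :=
                  mul_le_mul_left (ENNReal.rpow_le_rpow (measure_mono hsub) hα) _
              _ = 1 := by rw [hv, ← ENNReal.rpow_add _ _ v0 v1, add_neg_cancel, ENNReal.rpow_zero]
          · rw [← ENNReal.coe_add, ENNReal.coe_le_coe]
            have := nnnorm_sub_le (b x) (b x - b y)
            rwa [_root_.sub_sub_cancel] at this
      _ = ‖b x‖₊ + (volume Q'.set)⁻¹ * ∫⁻ y in Q'.set, (‖b x - b y‖₊ : ℝ≥0∞) := by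
          rw [lintegral_add_left measurable_const, mul_add, havg, one_mul]
      _ ≤ _ := add_le_add_right (hdiff Q' hx' hsub) _
  have h2 : (‖b x‖₊ : ℝ≥0∞) ≤ v * X + N := by
    calc (‖b x‖₊ : ℝ≥0∞) = (volume Q.set)⁻¹ * ∫⁻ _ in Q.set, (‖b x‖₊ : ℝ≥0∞) := (havg Q _).symm
      _ ≤ (volume Q.set)⁻¹ * ∫⁻ y in Q.set, (‖b y‖₊ + ‖b x - b y‖₊ : ℝ≥0∞) := by
          refine mul_le_mul_right (lintegral_mono fun y => ?_) _
          rw [← ENNReal.coe_add, ENNReal.coe_le_coe]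
          have := nnnorm_add_le (b y) (b x - b y)
          rwa [add_sub_cancel] at this
      _ = (volume Q.set)⁻¹ * (∫⁻ y in Q.set, (‖b y‖₊ : ℝ≥0∞)) + (volume Q.set)⁻¹ * ∫⁻ y in Q.set, (‖b x - b y‖₊ : ℝ≥0∞) := by
          rw [lintegral_add_left' hbm.restrict, mul_add]
      _ ≤ _ := by
          refine add_le_add ?_ (hdiff Q hxQ subset_rfl)
          calc (volume Q.set)⁻¹ * (∫⁻ y in Q.set, (‖b y‖₊ : ℝ≥0∞)) = v * (volume Q.set ^ (α / (n : ℝ) - 1) * ∫⁻ y in Q.set, (‖b y‖₊ : ℝ≥0∞)) := by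
                rw [← mul_assoc, hv, ← ENNReal.rpow_add _ _ v0 v1, show -(α / (n : ℝ)) + (α / (n : ℝ) - 1) = -1 by ring, ENNReal.rpow_neg_one]
            _ ≤ v * X := by
                refine mul_le_mul_right ?_ _
                exact le_iSup_of_le Q (le_iSup₂_of_le hxQ subset_rfl le_rfl)
  have hvX : v * X ≠ ∞ := ne_top_of_le_ne_top (ENNReal.add_ne_top.2 ⟨ENNReal.coe_ne_top, hNtop⟩) h1
  have r1 := ENNReal.toReal_mono (ENNReal.add_ne_top.2 ⟨ENNReal.coe_ne_top, hNtop⟩) h1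
  have r2 := ENNReal.toReal_mono (ENNReal.add_ne_top.2 ⟨hvX, hNtop⟩) h2
  have r3 := ENNReal.toReal_mono hNtop hN1
  rw [ENNReal.toReal_add ENNReal.coe_ne_top hNtop, ENNReal.toReal_mul, ENNReal.coe_toReal, coe_nnnorm, Real.norm_eq_abs] at r1
  rw [ENNReal.toReal_add hvX hNtop, ENNReal.toReal_mul, ENNReal.coe_toReal, coe_nnnorm, Real.norm_eq_abs] at r2
  rw [ENNReal.toReal_one] at r3
  rw [← ENNReal.ofReal_toReal hNtop]
  change _ ≤ ENNReal.ofReal (1 + 2 * M) * _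
  rw [← ENNReal.ofReal_mul (by positivity), ← enorm_eq_nnnorm, Real.enorm_eq_ofReal_abs]
  apply ENNReal.ofReal_le_ofReal
  have hb1 : 0 ≤ |b x| - b x := by linarith [le_abs_self (b x)]
  have hb2 : |b x| - b x ≤ 2 * M := by
    have h3 := le_max_left (-(b x)) 0
    rcases abs_cases (b x) with h | h <;> linarith
  have h5 := mul_le_mul_of_nonneg_left r3 (by positivity : 0 ≤ 2 * M)
  rw [abs_le]
  constructor <;> linarith



theorem fwd_two {n : ℕ} {p α r : ℝ} {φ ψ : RSp n → ℝ≥0 → ℝ≥0∞}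
    (hp : 1 < p) (hα : 0 ≤ α / (n : ℝ)) (hφ : IsWeakPhi univ φ) (hψ : IsWeakPhi univ ψ) (hinv : FracInvRel α φ ψ)
    (hr₁ : α / (n : ℝ) < r) (hr₂ : r ≤ 1 / p)
    (ha0 : A0 univ φ) (ha1 : A1 φ) (ha2 : A2 φ) (hainc : AInc p univ φ) (hadec : ADec (1 / r) univ φ)
    {b : RSp n → ℝ} (hb : IsBMO b) {M : ℝ} (hM : ∀ᵐ x ∂(volume : Measure (RSp n)), max (-(b x)) 0 ≤ M) :
    ∃ C : ℝ≥0, ∀ f : RSp n → ℝ, MemOrlicz φ univ f →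
        orliczNorm ψ univ (fracMaximalCommutator α b f) ≤ (C : ℝ≥0∞) * orliczNorm φ univ f := by
  obtain ⟨κ, σ, C, c₁, c₂, h, hP⟩ := exists_pkg hp hα hφ hψ hinv hr₁ hr₂ ha0 ha1 ha2 hainc hadec
  obtain ⟨C', hC', hmain⟩ := main_norm hP hb
  have hM0 : 0 ≤ max M 0 := le_max_right _ _
  refine ⟨(1 + 2 * max M 0).toNNReal * C', fun f hf => ?_⟩
  have hfm : AEMeasurable f volume := by simpa only [Measure.restrict_univ] using hf.1
  rw [ENNReal.coe_mul, mul_assoc]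
  refine le_trans (orliczNorm_le_E (Real.toNNReal_pos.2 (by positivity)) ?_) (mul_le_mul_right (hmain f hfm) _)
  filter_upwards [hM] with x hx
  exact commutator_pw hb.1.aestronglyMeasurable.aemeasurable hfm hM0 (hx.trans (le_max_left _ _))

theorem adec_mono {n : ℕ} {q q' : ℝ} (h : q ≤ q') {η : RSp n → ℝ≥0 → ℝ≥0∞} (hd : ADec q univ η) : ADec q' univ η := by
  obtain ⟨L, hL, hd⟩ := hd
  refine ⟨L, hL, fun x hx s t hs hst => ?_⟩
  have ht : 0 < t := hs.trans hst
  have e : ∀ u : ℝ≥0, 0 < u → ∀ z : ℝ≥0∞, z / (u : ℝ≥0∞) ^ q' = (z / (u : ℝ≥0∞) ^ q) / (u : ℝ≥0∞) ^ (q' - q) := by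
    intro u hu z
    have u0 : (u : ℝ≥0∞) ≠ 0 := by exact_mod_cast hu.ne'
    have e1 : (u : ℝ≥0∞) ^ q' = (u : ℝ≥0∞) ^ q * (u : ℝ≥0∞) ^ (q' - q) := by
      rw [← ENNReal.rpow_add _ _ u0 ENNReal.coe_ne_top]; congr 1; ring
    rw [e1, div_eq_mul_inv, ENNReal.mul_inv (Or.inr (ENNReal.rpow_ne_top_of_ne_zero u0 ENNReal.coe_ne_top))
      (Or.inl (ENNReal.rpow_ne_top_of_ne_zero u0 ENNReal.coe_ne_top)), ← mul_assoc]
    rfl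
  rw [e t ht, e s hs, ← mul_div_assoc]
  refine ENNReal.div_le_div (hd x hx s t hs hst) ?_
  exact ENNReal.rpow_le_rpow (by exact_mod_cast hst.le) (by linarith)

theorem fracInvRel_zero {n : ℕ} (η : RSp n → ℝ≥0 → ℝ≥0∞) : FracInvRel 0 η η := by
  refine ⟨1, 1, one_pos, fun x t ht => ?_⟩
  simp

theorem exists_pkg_zero {n : ℕ} {η : RSp n → ℝ≥0 → ℝ≥0∞} (hη : IsWeakPhi univ η)
    (ha0 : A0 univ η) (ha1 : A1 η) (ha2 : A2 η) {p q : ℝ} (hp : 1 < p) (hainc : AInc p univ η) (hadec : ADec q univ η) :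
    ∃ κ σ C c₁ c₂ h, Pkg (n := n) 0 κ σ C c₁ c₂ h η η := by
  have hm : 0 < max q p := lt_of_lt_of_le (by linarith) (le_max_right q p)
  have := exists_pkg (r := 1 / max q p) (α := 0) hp (by simp) hη hη (fracInvRel_zero η)
    (by rw [zero_div]; positivity) (one_div_le_one_div_of_le (by linarith) (le_max_right _ _)) ha0 ha1 ha2 hainc
    (by rw [one_div_one_div]; exact adec_mono (le_max_left _ _) hadec)
  rwa [zero_div] at this

theorem fwd_four {n : ℕ} {α : ℝ} (hα : 0 ≤ α / (n : ℝ)) {η : RSp n → ℝ≥0 → ℝ≥0∞} (hη : IsWeakPhi univ η)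
    (ha0 : A0 univ η) (ha1 : A1 η) (ha2 : A2 η) {p q : ℝ} (hp : 1 < p) (hainc : AInc p univ η) (hadec : ADec q univ η)
    {b : RSp n → ℝ} (hb : IsBMO b) {M : ℝ} (hM : ∀ᵐ x ∂(volume : Measure (RSp n)), max (-(b x)) 0 ≤ M) :
    (⨆ Q : Cube n, orliczNorm η Set.univ (commTestFn α Q b) /
          orliczNorm η Set.univ (cubeIndicator Q)) < ∞ := by
  obtain ⟨κ, σ, C, c₁, c₂, h, hP⟩ := exists_pkg_zero hη ha0 ha1 ha2 hp hainc hadec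
  obtain ⟨C', hC', hmain⟩ := main_norm hP hb
  have hM0 : 0 ≤ max M 0 := le_max_right _ _
  refine lt_of_le_of_lt (b := (((1 + 2 * max M 0).toNNReal * C' : ℝ≥0) : ℝ≥0∞)) (iSup_le fun Q => ?_) ENNReal.coe_lt_top
  apply ENNReal.div_le_of_le_mul
  have hfm : AEMeasurable (cubeIndicator Q) volume := (measurable_one.indicator Q.measurableSet).aemeasurable
  rw [ENNReal.coe_mul, mul_assoc]
  refine le_trans (orliczNorm_le_E (Real.toNNReal_pos.2 (by positivity)) ?_) (mul_le_mul_right (hmain _ hfm) _)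
  filter_upwards [hM] with x hx
  exact test_pw hα hb.1.aestronglyMeasurable.aemeasurable hM0 Q (hx.trans (le_max_left _ _))

/-- The model function `t²`. -/
noncomputable def sqPhi (n : ℕ) : RSp n → ℝ≥0 → ℝ≥0∞ := fun _ t => (t : ℝ≥0∞) ^ (2 : ℝ)

theorem sqPhi_div {t : ℝ≥0} (ht : 0 < t) (n : ℕ) (x : RSp n) (p : ℝ) : sqPhi n x t / (t : ℝ≥0∞) ^ p = (t : ℝ≥0∞) ^ (2 - p) := by
  have u0 : (t : ℝ≥0∞) ≠ 0 := by exact_mod_cast ht.ne'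
  rw [sqPhi, ENNReal.rpow_sub _ _ u0 ENNReal.coe_ne_top]

theorem sqPhi_weak (n : ℕ) : IsWeakPhi univ (sqPhi n) where
  meas f hf := (hf.coe_nnreal_ennreal.pow_const 2).aemeasurable
  mono x _ s t hst := ENNReal.rpow_le_rpow (by exact_mod_cast hst) (by norm_num)
  zero x _ := by simp [sqPhi]
  lim_zero x _ := by
    have : Continuous (fun t : ℝ≥0 => sqPhi n x t) := ENNReal.continuous_rpow_const.comp ENNReal.continuous_coe
    have h := this.tendsto 0
    have e : sqPhi n x 0 = 0 := by simp [sqPhi]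
    rw [e] at h
    exact h.mono_left nhdsWithin_le_nhds
  lim_top x _ := by
    have h := (ENNReal.continuous_rpow_const (y := (2:ℝ))).tendsto ∞
    rw [ENNReal.top_rpow_of_pos (by norm_num)] at h
    exact h.comp (ENNReal.tendsto_coe_nhds_top.2 tendsto_id)
  almost_inc := by
    refine ⟨1, le_rfl, fun x _ s t hs hst => ?_⟩
    have h1 := sqPhi_div hs n x 1
    have h2 := sqPhi_div (hs.trans hst) n x 1
    rw [ENNReal.rpow_one] at h1 h2
    rw [h1, h2, ENNReal.coe_one, one_mul]
    exact ENNReal.rpow_le_rpow (by exact_mod_cast hst.le) (by norm_num)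

theorem sqPhi_inv_one (n : ℕ) (x : RSp n) : phiInv (sqPhi n) x 1 = 1 := by
  apply le_antisymm
  · exact sInf_le ⟨1, by simp [sqPhi], by simp⟩
  · apply le_sInf
    rintro _ ⟨s, hs, rfl⟩
    have hs' : (1 : ℝ≥0∞) ≤ (s : ℝ≥0∞) ^ (2:ℝ) := hs
    by_contra hc
    push Not at hc
    exact absurd hs' (not_le.2 (ENNReal.rpow_lt_one hc (by norm_num)))

theorem sqPhi_ainc (n : ℕ) : AInc 2 univ (sqPhi n) := by
  refine ⟨1, le_rfl, fun x _ s t hs hst => ?_⟩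
  rw [sqPhi_div hs, sqPhi_div (hs.trans hst)]; simp

theorem sqPhi_adec (n : ℕ) : ADec 2 univ (sqPhi n) := by
  refine ⟨1, le_rfl, fun x _ s t hs hst => ?_⟩
  rw [sqPhi_div hs, sqPhi_div (hs.trans hst)]; simp

theorem sqPhi_a0 (n : ℕ) : A0 univ (sqPhi n) := by
  refine ⟨1, one_pos, le_rfl, ?_⟩
  filter_upwards with x
  rw [sqPhi_inv_one]; simp

theorem sqPhi_a1 (n : ℕ) : A1 (sqPhi n) := by
  refine ⟨1/2, by norm_num, by rw [div_lt_one (by norm_num)]; norm_num, fun Q _ => ?_⟩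
  filter_upwards with x
  filter_upwards with y
  intro t _ _
  have : phiInv (sqPhi n) x t = phiInv (sqPhi n) y t := rfl
  rw [this]
  refine mul_le_of_le_one_left zero_le ?_
  rw [← ENNReal.coe_one, ENNReal.coe_le_coe]
  exact (by rw [div_le_one (by norm_num)]; norm_num : (1:ℝ≥0)/2 ≤ 1)

theorem sqPhi_a2 (n : ℕ) : A2 (sqPhi n) := by
  refine ⟨fun t => (t : ℝ≥0∞) ^ (2:ℝ), sqPhi_weak n, fun _ => 0, by simp, ⟨0, by simp⟩, 1, one_pos, le_rfl, 1, one_pos, ?_⟩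
  filter_upwards with x t
  simp [sqPhi]

theorem isBMO_zero (n : ℕ) : IsBMO (fun _ : RSp n => (0:ℝ)) := by
  refine ⟨locallyIntegrable_const 0, ?_⟩
  simp [bmoNorm, cubeAvg]

theorem sqPhi_max (n : ℕ) : ∃ C : ℝ≥0, ∀ f : RSp n → ℝ, MemOrlicz (sqPhi n) Set.univ f →
          orliczNormE (sqPhi n) Set.univ (maximal f) ≤ (C : ℝ≥0∞) * orliczNorm (sqPhi n) Set.univ f := by
  obtain ⟨κ, σ, C, c₁, c₂, h, hP⟩ := exists_pkg_zero (sqPhi_weak n) (sqPhi_a0 n) (sqPhi_a1 n) (sqPhi_a2 n)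
    (by norm_num : (1:ℝ) < 2) (sqPhi_ainc n) (sqPhi_adec n)
  obtain ⟨C', hC', hmain⟩ := main_norm hP (isBMO_zero n)
  refine ⟨C', fun f hf => ?_⟩
  have hfm : AEMeasurable f volume := by simpa only [Measure.restrict_univ] using hf.1
  refine le_trans (orliczNormE_mono fun x => ?_) (hmain f hfm)
  refine iSup₂_mono fun Q hQ => ?_
  rw [zero_sub, ENNReal.rpow_neg_one]
  simp



/-- Clipping a cube to a reference cube. -/
theorem cube_clip {n : ℕ} (Q₀ Q' : Cube n) {x : RSp n} (hx : x ∈ Q₀.set) (hx' : x ∈ Q'.set) :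
    ∃ Q'' : Cube n, x ∈ Q''.set ∧ Q''.set ⊆ Q₀.set ∧ Q'.set ∩ Q₀.set ⊆ Q''.set ∧ volume Q''.set ≤ volume Q'.set := by
  rcases le_total Q₀.r Q'.r with h | h
  · refine ⟨Q₀, hx, subset_rfl, inter_subset_right, ?_⟩
    rw [Cube.volume_eq, Cube.volume_eq]
    have := Q₀.r_pos
    exact ENNReal.ofReal_le_ofReal (by gcongr)
  · set Q'' : Cube n := ⟨WithLp.toLp 2 (fun i => max (Q₀.c i - (Q₀.r - Q'.r)) (min (Q'.c i) (Q₀.c i + (Q₀.r - Q'.r)))), Q'.r, Q'.r_pos⟩ with hQ''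
    have hsub : Q'.set ∩ Q₀.set ⊆ Q''.set := by
      rintro y ⟨h1, h2⟩ i
      have h1 := abs_le.1 (h1 i)
      have h2 := abs_le.1 (h2 i)
      change |y i - max (Q₀.c i - (Q₀.r - Q'.r)) (min (Q'.c i) (Q₀.c i + (Q₀.r - Q'.r)))| ≤ Q'.r
      rw [abs_le]
      rcases max_cases (Q₀.c i - (Q₀.r - Q'.r)) (min (Q'.c i) (Q₀.c i + (Q₀.r - Q'.r))) with h3 | h3 <;>
      rcases min_cases (Q'.c i) (Q₀.c i + (Q₀.r - Q'.r)) with h4 | h4 <;> constructor <;> linarith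
    refine ⟨Q'', hsub ⟨hx', hx⟩, ?_, hsub, ?_⟩
    · apply Cube.subset_of
      intro i
      change |max (Q₀.c i - (Q₀.r - Q'.r)) (min (Q'.c i) (Q₀.c i + (Q₀.r - Q'.r))) - Q₀.c i| + Q'.r ≤ Q₀.r
      have h5 : |max (Q₀.c i - (Q₀.r - Q'.r)) (min (Q'.c i) (Q₀.c i + (Q₀.r - Q'.r))) - Q₀.c i| ≤ Q₀.r - Q'.r := by
        rw [abs_le]
        rcases max_cases (Q₀.c i - (Q₀.r - Q'.r)) (min (Q'.c i) (Q₀.c i + (Q₀.r - Q'.r))) with h3 | h3 <;>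
        rcases min_cases (Q'.c i) (Q₀.c i + (Q₀.r - Q'.r)) with h4 | h4 <;> constructor <;> linarith
      linarith
    · rw [Cube.volume_eq, Cube.volume_eq]

theorem frac_eq_rest {n : ℕ} {α : ℝ} (ha1 : α / (n : ℝ) ≤ 1) (Q : Cube n) (b : RSp n → ℝ) {x : RSp n} (hx : x ∈ Q.set) :
    fracMaximal α (fun y => b y * cubeIndicator Q y) x = restFracMaximal α Q b x := by
  have key : ∀ Q' : Cube n, ∫⁻ y in Q'.set, (‖b y * cubeIndicator Q y‖₊ : ℝ≥0∞) = ∫⁻ y in Q'.set ∩ Q.set, (‖b y‖₊ : ℝ≥0∞) := by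
    intro Q'
    rw [inter_comm, ← Measure.restrict_restrict Q.measurableSet, ← lintegral_indicator Q.measurableSet]
    refine lintegral_congr fun y => ?_
    by_cases hy : y ∈ Q.set
    · rw [cubeIndicator, indicator_of_mem hy, indicator_of_mem hy]; simp
    · rw [cubeIndicator, indicator_of_notMem hy, indicator_of_notMem hy]; simp
  apply le_antisymm
  · refine iSup₂_le fun Q' hx' => ?_
    obtain ⟨Q'', h1, h2, h3, h4⟩ := cube_clip Q Q' hx hx'
    refine le_trans ?_ (le_iSup_of_le Q'' (le_iSup₂_of_le h1 h2 le_rfl))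
    rw [key]
    refine mul_le_mul' ?_ (lintegral_mono_set h3)
    have hpow : ∀ Q : Cube n, volume Q.set ^ (α / (n : ℝ) - 1) = ((volume Q.set)⁻¹) ^ (1 - α / (n : ℝ)) := fun Q => by
      rw [ENNReal.inv_rpow, ← ENNReal.rpow_neg]; congr 1; ring
    rw [hpow, hpow]
    exact ENNReal.rpow_le_rpow (ENNReal.inv_le_inv.2 h4) (by linarith)
  · refine iSup_le fun Q' => iSup₂_le fun hx' hsub => ?_
    refine le_trans (le_of_eq ?_) (le_iSup₂_of_le Q' hx' le_rfl)
    rw [key, inter_eq_left.2 hsub]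

theorem measurable_fracMaximal {n : ℕ} (α : ℝ) (f : RSp n → ℝ) : Measurable (fracMaximal α f) := by
  refine measurable_of_Ioi fun t => IsOpen.measurableSet ?_
  rw [isOpen_iff_mem_nhds]
  intro x hx
  have hx : t < fracMaximal α f x := hx
  simp only [fracMaximal, lt_iSup_iff] at hx
  obtain ⟨Q, hxQ, hlt⟩ := hx
  set I := ∫⁻ y in Q.set, (‖f y‖₊ : ℝ≥0∞) with hI
  have hcont : Continuous fun k : ℝ => ENNReal.ofReal (k ^ n) ^ (α / (n : ℝ) - 1) :=
    ENNReal.continuous_rpow_const.comp (ENNReal.continuous_ofReal.comp (continuous_pow n))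
  have htend := hcont.tendsto 1
  simp only [one_pow, ENNReal.ofReal_one, ENNReal.one_rpow] at htend
  have ht2 := ENNReal.Tendsto.mul_const (b := volume Q.set ^ (α / (n : ℝ) - 1) * I) htend (Or.inl one_ne_zero)
  rw [one_mul] at ht2
  have ht3 := (tendsto_nhdsWithin_of_tendsto_nhds ht2 (s := Ioi 1)).eventually (lt_mem_nhds hlt)
  obtain ⟨k, hk, hk1⟩ := (ht3.and self_mem_nhdsWithin).exists
  have hk1 : 1 < k := hk1
  have hk0 : 0 < k := by linarith
  have hr := Q.r_pos
  have hopen : IsOpen {y : RSp n | ∀ i, |y i - Q.c i| < k * Q.r} := by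
    simp only [ofPred_forall]
    refine isOpen_iInter_of_finite fun i => isOpen_lt ?_ continuous_const
    fun_prop
  refine mem_of_superset (hopen.mem_nhds (x := x) fun i => (hxQ i).trans_lt (by nlinarith)) fun y hy => ?_
  have hyQ : y ∈ (Q.dil k hk0).set := fun i => (hy i).le
  change t < fracMaximal α f y
  refine lt_of_lt_of_le hk (le_trans ?_ (le_iSup₂_of_le (Q.dil k hk0) hyQ le_rfl))
  rw [Cube.volume_dil, ENNReal.mul_rpow_of_ne_zero (ENNReal.ofReal_pos.2 (by positivity)).ne' Q.volume_ne_zero, mul_assoc]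
  refine mul_le_mul_right (mul_le_mul_right (lintegral_mono_set ?_) _) _
  intro z hz i
  refine (hz i).trans ?_
  change Q.r ≤ k * Q.r
  nlinarith

theorem aemeasurable_test {n : ℕ} {α : ℝ} (ha1 : α / (n : ℝ) ≤ 1) (Q : Cube n) {b : RSp n → ℝ} (hb : AEMeasurable b volume) :
    AEMeasurable (commTestFn α Q b) volume := by
  have : commTestFn α Q b = Q.set.indicator fun z =>
    b z - (volume Q.set ^ (-(α / (n : ℝ)))).toReal * (fracMaximal α (fun y => b y * cubeIndicator Q y) z).toReal := by
    unfold commTestFn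
    refine indicator_congr fun z hz => ?_
    rw [frac_eq_rest ha1 Q b hz]
  rw [this]
  exact (hb.sub ((measurable_fracMaximal α _).ennreal_toReal.const_mul _).aemeasurable).indicator Q.measurableSet

theorem rest_finite {n : ℕ} {α : ℝ} (hα : 0 ≤ α / (n : ℝ)) (Q : Cube n) {b : RSp n → ℝ} (hb : LocallyIntegrable b volume) :
    ∀ᵐ x ∂(volume.restrict Q.set), restFracMaximal α Q b x ≠ ∞ := by
  set f : RSp n → ℝ≥0∞ := Q.set.indicator fun y => (‖b y‖₊ : ℝ≥0∞) with hf
  have hfint : ∫⁻ y, f y ≠ ∞ := by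
    rw [hf, lintegral_indicator Q.measurableSet]
    exact (Q.integrableOn hb).2.ne
  have hD : ∀ Q : Cube n, volume Q.five.set ≤ ((5 ^ n : ℝ≥0∞)) * volume Q.set := fun Q => (Q.volume_five).le
  have hnull : volume {x | maxOp volume f x = ∞} = 0 := by
    by_contra hne
    have h1 : ∀ t : ℝ≥0, (t : ℝ≥0∞) * volume {x | maxOp volume f x = ∞} ≤ (5 ^ n : ℝ≥0∞) * ∫⁻ y, f y := by
      intro t
      refine le_trans (mul_le_mul_right (measure_mono fun x hx => ?_) _) (maxOp_weak volume _ hD f t)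
      have hx : maxOp volume f x = ∞ := hx
      change (t : ℝ≥0∞) < maxOp volume f x
      rw [hx]; exact ENNReal.coe_lt_top
    set B := (5 ^ n : ℝ≥0∞) * ∫⁻ y, f y with hB
    have hBtop : B ≠ ∞ := ENNReal.mul_ne_top (by simp) hfint
    have h2 : ∀ t : ℝ≥0, (t : ℝ≥0∞) ≤ B / volume {x | maxOp volume f x = ∞} := fun t => by
      rw [ENNReal.le_div_iff_mul_le (Or.inl hne) (Or.inr hBtop)]; exact h1 t
    have h3 : B / volume {x | maxOp volume f x = ∞} = ∞ := ENNReal.eq_top_of_forall_nnreal_le h2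
    rw [ENNReal.div_eq_top] at h3
    rcases h3 with h3 | h3
    · exact hne h3.2
    · exact hBtop h3.1
  have hae : ∀ᵐ x ∂(volume : Measure (RSp n)), maxOp volume f x ≠ ∞ := by
    rw [ae_iff]; simpa using hnull
  filter_upwards [ae_restrict_of_ae hae, ae_restrict_mem Q.measurableSet] with x hx hxQ
  refine ne_top_of_le_ne_top (b := volume Q.set ^ (α / (n : ℝ)) * (2 ^ n * maxOp volume f x)) ?_ ?_
  · exact ENNReal.mul_ne_top (ENNReal.rpow_ne_top_of_nonneg hα Q.volume_ne_top) (ENNReal.mul_ne_top (by simp) hx)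
  · refine iSup_le fun Q' => iSup₂_le fun hx' hsub => ?_
    have w0 := Q'.volume_ne_zero
    have w1 := Q'.volume_ne_top
    rw [sub_eq_add_neg, ENNReal.rpow_add _ _ w0 w1, ENNReal.rpow_neg_one, mul_assoc]
    refine mul_le_mul' (ENNReal.rpow_le_rpow (measure_mono hsub) hα) ?_
    obtain ⟨R, hR, hs, hvol⟩ := exists_ratCube Q'
    refine le_trans ?_ (mul_le_mul_right (le_maxOp volume f hR (hs hx')) _)
    rw [← mul_assoc]
    refine mul_le_mul' ?_ ?_
    · rw [← ENNReal.div_eq_inv_mul.trans (mul_comm _ _), ENNReal.le_div_iff_mul_le (Or.inl R.volume_ne_zero) (Or.inl R.volume_ne_top), mul_comm,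
        ← ENNReal.div_eq_inv_mul.trans (mul_comm _ _), ENNReal.div_le_iff Q'.volume_ne_zero Q'.volume_ne_top]
      exact hvol
    · calc ∫⁻ y in Q'.set, (‖b y‖₊ : ℝ≥0∞) = ∫⁻ y in Q'.set, f y := by
            refine setLIntegral_congr_fun Q'.measurableSet fun y hy => ?_
            rw [hf, indicator_of_mem (hsub hy)]
        _ ≤ _ := lintegral_mono_set hs


/-- The test function dominates the oscillation below the average of `|b|`. -/
theorem test_lower {n : ℕ} {α : ℝ} (hα : 0 ≤ α / (n : ℝ)) (Q : Cube n) {b : RSp n → ℝ} (hb : LocallyIntegrable b volume) :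
    ∀ᵐ x ∂(volume.restrict Q.set), cubeAvg Q (fun y => |b y|) - b x ≤ |commTestFn α Q b x| := by
  filter_upwards [rest_finite hα Q hb, ae_restrict_mem Q.measurableSet] with x hx hxQ
  have v0 := Q.volume_ne_zero
  have v1 := Q.volume_ne_top
  have h1 : volume Q.set ^ (α / (n : ℝ) - 1) * ∫⁻ y in Q.set, (‖b y‖₊ : ℝ≥0∞) ≤ restFracMaximal α Q b x :=
    le_iSup_of_le Q (le_iSup₂_of_le hxQ subset_rfl le_rfl)
  have h2 : (volume Q.set)⁻¹ * ∫⁻ y in Q.set, (‖b y‖₊ : ℝ≥0∞) ≤ volume Q.set ^ (-(α / (n : ℝ))) * restFracMaximal α Q b x := by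
    refine le_trans (le_of_eq ?_) (mul_le_mul_right h1 _)
    rw [← mul_assoc, ← ENNReal.rpow_add _ _ v0 v1, show -(α / (n : ℝ)) + (α / (n : ℝ) - 1) = -1 by ring, ENNReal.rpow_neg_one]
  have h3 := ENNReal.toReal_mono (ENNReal.mul_ne_top (ENNReal.rpow_ne_top_of_ne_zero v0 v1) hx) h2
  have h4 : ((volume Q.set)⁻¹ * ∫⁻ y in Q.set, (‖b y‖₊ : ℝ≥0∞)).toReal = cubeAvg Q (fun y => |b y|) := by
    rw [cubeAvg, setAverage_eq, smul_eq_mul, ENNReal.toReal_mul, ENNReal.toReal_inv]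
    congr 1
    rw [integral_eq_lintegral_of_nonneg_ae (by filter_upwards with y; positivity) (Q.integrableOn hb).abs.aestronglyMeasurable]
    congr 1
    refine lintegral_congr fun y => ?_
    rw [← enorm_eq_nnnorm, Real.enorm_eq_ofReal_abs]
  rw [h4, ENNReal.toReal_mul] at h3
  rw [commTestFn, indicator_of_mem hxQ]
  refine le_trans ?_ (neg_le_abs _)
  linarith

theorem bmo_of_test {n : ℕ} {α : ℝ} (hα : 0 ≤ α / (n : ℝ)) {b : RSp n → ℝ} (hb : LocallyIntegrable b volume) {C : ℝ≥0}
    (hC : ∀ Q : Cube n, ∫⁻ x in Q.set, (‖commTestFn α Q b x‖₊ : ℝ≥0∞) ≤ C * volume Q.set) :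
    IsBMO b ∧ ∃ M : ℝ, ∀ᵐ x ∂(volume : Measure (RSp n)), max (-(b x)) 0 ≤ M := by
  have hconst : ∀ (Q : Cube n) (c : ℝ), Integrable (fun _ : RSp n => c) (volume.restrict Q.set) := fun Q c => integrableOn_const Q.volume_ne_top
  have hup : ∀ (Q : Cube n) (c : ℝ), c ≤ cubeAvg Q (fun y => |b y|) → ∫ y in Q.set, max (c - b y) 0 ≤ C * volume.real Q.set := by
    intro Q c hc
    have hi : IntegrableOn (fun y => c - b y) Q.set volume := (integrableOn_const Q.volume_ne_top).sub (Q.integrableOn hb)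
    rw [integral_eq_lintegral_of_nonneg_ae (by filter_upwards with y; exact le_max_right _ _) hi.pos_part.aestronglyMeasurable]
    refine le_trans (ENNReal.toReal_mono (ENNReal.mul_ne_top ENNReal.coe_ne_top Q.volume_ne_top) (le_trans (lintegral_mono_ae ?_) (hC Q))) (le_of_eq ?_)
    · filter_upwards [test_lower hα Q hb] with y hy
      rw [← enorm_eq_nnnorm, Real.enorm_eq_ofReal_abs]
      exact ENNReal.ofReal_le_ofReal (max_le (by linarith) (abs_nonneg _))
    · rw [ENNReal.toReal_mul]; rfl
  have habs : LocallyIntegrable (fun y => |b y|) volume := fun x => by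
    obtain ⟨s, hs, h⟩ := hb x
    exact ⟨s, hs, h.abs⟩
  have hle : ∀ Q : Cube n, cubeAvg Q b ≤ cubeAvg Q (fun y => |b y|) := by
    intro Q
    have h1 := cubeAvg_mul Q b
    have h2 := cubeAvg_mul Q (fun y => |b y|)
    have h3 : ∫ y in Q.set, b y ≤ ∫ y in Q.set, |b y| := integral_mono (Q.integrableOn hb) (Q.integrableOn habs) fun y => le_abs_self _
    rw [← h1, ← h2] at h3
    exact le_of_mul_le_mul_right h3 Q.real_pos
  refine ⟨⟨hb, ?_⟩, C, ?_⟩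
  · refine lt_of_le_of_lt (b := ((2 * C : ℝ≥0) : ℝ≥0∞)) (iSup_le fun Q => ?_) ENNReal.coe_lt_top
    have hi : IntegrableOn (fun y => cubeAvg Q b - b y) Q.set volume := (integrableOn_const Q.volume_ne_top).sub (Q.integrableOn hb)
    have h0 : ∫ y in Q.set, (cubeAvg Q b - b y) = 0 := by
      rw [integral_sub (hconst Q _) (Q.integrableOn hb), setIntegral_const, smul_eq_mul, ← cubeAvg_mul]; ring
    have h1 : ∫ y in Q.set, |b y - cubeAvg Q b| = 2 * ∫ y in Q.set, max (cubeAvg Q b - b y) 0 := by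
      have e : ∀ y, |b y - cubeAvg Q b| = 2 * max (cubeAvg Q b - b y) 0 - (cubeAvg Q b - b y) := fun y => by
        rcases max_cases (cubeAvg Q b - b y) 0 with h | h <;> rcases abs_cases (b y - cubeAvg Q b) with h' | h' <;> linarith
      simp only [e]
      rw [integral_sub (hi.pos_part.const_mul 2) hi, h0, sub_zero, integral_const_mul]
    have h2 := hup Q _ (hle Q)
    have h3 : ∫⁻ x in Q.set, (‖b x - cubeAvg Q b‖₊ : ℝ≥0∞) = ENNReal.ofReal (∫ y in Q.set, |b y - cubeAvg Q b|) := by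
      rw [ofReal_integral_eq_lintegral_ofReal (Q.integrableOn_abs_sub hb _) (by filter_upwards with y; positivity)]
      refine lintegral_congr fun y => ?_
      rw [← enorm_eq_nnnorm, Real.enorm_eq_ofReal_abs]
    rw [h3, h1, ← ENNReal.div_eq_inv_mul, ENNReal.div_le_iff Q.volume_ne_zero Q.volume_ne_top, ← Q.ofReal_real, ← ENNReal.ofReal_coe_nnreal,
      ← ENNReal.ofReal_mul (by positivity)]
    apply ENNReal.ofReal_le_ofReal
    push_cast
    linarith
  · have hd : LocallyIntegrable (fun y => |b y| - b y) volume := habs.sub hb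
    filter_upwards [cube_lebesgue _ hd] with x hx
    have ht := hx (fun k => 1 / ((k : ℝ) + 1)) (fun k => by positivity) tendsto_one_div_add_atTop_nhds_zero_nat
    have hlim : |b x| - b x ≤ C := by
      refine le_of_tendsto ht (Eventually.of_forall fun k => ?_)
      set Q : Cube n := ⟨x, 1 / ((k : ℝ) + 1), by positivity⟩ with hQ
      have h1 : cubeAvg Q (fun y => |b y| - b y) * volume.real Q.set = ∫ y in Q.set, (|b y| - b y) := cubeAvg_mul Q _
      rw [integral_sub (Q.integrableOn habs) (Q.integrableOn hb)] at h1
      have h2 := hup Q _ le_rfl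
      have hi : IntegrableOn (fun y => cubeAvg Q (fun y => |b y|) - b y) Q.set volume := (integrableOn_const Q.volume_ne_top).sub (Q.integrableOn hb)
      have h3 : ∫ y in Q.set, (cubeAvg Q (fun y => |b y|) - b y) ≤ ∫ y in Q.set, max (cubeAvg Q (fun y => |b y|) - b y) 0 :=
        integral_mono hi hi.pos_part fun y => le_max_left _ _
      rw [integral_sub (hconst Q _) (Q.integrableOn hb), setIntegral_const, smul_eq_mul, mul_comm, cubeAvg_mul] at h3
      have h4 : cubeAvg Q (fun y => |b y| - b y) * volume.real Q.set ≤ C * volume.real Q.set := by linarith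
      exact le_of_mul_le_mul_right h4 Q.real_pos
    have := C.coe_nonneg
    refine max_le ?_ this
    rcases abs_cases (b x) with h | h <;> linarith



theorem lintegral_cubeIndicator {n : ℕ} {φ : RSp n → ℝ≥0 → ℝ≥0∞} (hφ : IsWeakPhi univ φ) (Q : Cube n) (g : ℝ≥0 → ℝ≥0) (hg : g 0 = 0) :
    ∫⁻ x in univ, φ x (g ‖cubeIndicator Q x‖₊) = ∫⁻ x in Q.set, φ x (g 1) := by
  rw [Measure.restrict_univ, ← lintegral_indicator Q.measurableSet]
  refine lintegral_congr fun x => ?_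
  by_cases hx : x ∈ Q.set
  · rw [cubeIndicator, indicator_of_mem hx, indicator_of_mem hx]; simp
  · rw [cubeIndicator, indicator_of_notMem hx, indicator_of_notMem hx]; simp [hg, hφ.zero x (mem_univ x)]

theorem norm_ind_ne_zero {n : ℕ} {φ : RSp n → ℝ≥0 → ℝ≥0∞} (hφ : IsWeakPhi univ φ) (Q : Cube n) :
    orliczNorm φ univ (cubeIndicator Q) ≠ 0 := by
  intro h0
  have h1 : ∀ k : ℕ, ∫⁻ x in Q.set, φ x (k : ℝ≥0) ≤ 1 := by
    intro k
    have : orliczNorm φ univ (cubeIndicator Q) < (((k + 1 : ℝ≥0)⁻¹ : ℝ≥0) : ℝ≥0∞) := by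
      rw [h0]; exact_mod_cast (by positivity : (0 : ℝ≥0) < (k + 1 : ℝ≥0)⁻¹)
    obtain ⟨_, ⟨l, ⟨hl0, hl⟩, rfl⟩, hlt⟩ := sInf_lt_iff.1 this
    have hlt : l < (k + 1 : ℝ≥0)⁻¹ := ENNReal.coe_lt_coe.1 hlt
    rw [lintegral_cubeIndicator hφ Q (fun t => t / l) (by simp)] at hl
    refine le_trans (lintegral_mono fun x => hφ.mono x (mem_univ x) ?_) hl
    rw [le_div_iff₀ hl0]
    have h2 : (k : ℝ≥0) + 1 > 0 := by positivity
    calc (k : ℝ≥0) * l ≤ (k + 1) * (k + 1 : ℝ≥0)⁻¹ := mul_le_mul' (by simp) hlt.le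
      _ = 1 := mul_inv_cancel₀ h2.ne'
  have hsup : ∀ x, ⨆ k : ℕ, φ x (k : ℝ≥0) = ∞ := fun x => by
    have ht := (hφ.lim_top x (mem_univ x)).comp tendsto_natCast_atTop_atTop
    exact iSup_eq_of_tendsto (fun i j hij => hφ.mono x (mem_univ x) (by exact_mod_cast hij)) ht
  have h2 : ∫⁻ x in Q.set, ⨆ k : ℕ, φ x (k : ℝ≥0) = ⨆ k : ℕ, ∫⁻ x in Q.set, φ x (k : ℝ≥0) := by
    refine lintegral_iSup' (fun k => ?_) ?_
    · have := hφ.meas (fun _ => (k : ℝ≥0)) measurable_const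
      rw [Measure.restrict_univ] at this
      exact this.restrict
    · filter_upwards with x i j hij
      exact hφ.mono x (mem_univ x) (by exact_mod_cast hij)
  simp only [hsup] at h2
  rw [setLIntegral_const, ENNReal.top_mul Q.volume_ne_zero] at h2
  have h3 : (⨆ k : ℕ, ∫⁻ x in Q.set, φ x (k : ℝ≥0)) ≤ 1 := iSup_le h1
  rw [← h2] at h3
  exact absurd h3 (by simp)

theorem norm_ne_top_of_mem {n : ℕ} {φ : RSp n → ℝ≥0 → ℝ≥0∞} (hφ : IsWeakPhi univ φ) {f : RSp n → ℝ} (hf : MemOrlicz φ univ f) :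
    orliczNorm φ univ f ≠ ∞ := by
  obtain ⟨_, lam, hl0, hI⟩ := hf
  obtain ⟨L, hL1, hL⟩ := hφ.almost_inc
  set I := ∫⁻ x in univ, φ x (lam * ‖f x‖₊) with hIdef
  have hL0 : 0 < L := lt_of_lt_of_le one_pos hL1
  set ε : ℝ≥0 := (L * I.toNNReal + 2)⁻¹ with hε
  have hden : (0 : ℝ≥0) < L * I.toNNReal + 2 := by positivity
  have hε0 : 0 < ε := by positivity
  have hε1 : ε < 1 := by
    rw [hε]; apply inv_lt_one_of_one_lt₀
    calc (1 : ℝ≥0) < 2 := by norm_num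
      _ ≤ _ := le_add_self
  have hsc : ∀ x t, φ x (ε * t) ≤ (L * ε : ℝ≥0) * φ x t := by
    intro x t
    rcases eq_or_ne t 0 with rfl | ht
    · simp [hφ.zero x (mem_univ x)]
    have ht0 : 0 < t := pos_iff_ne_zero.2 ht
    have h1 := hL x (mem_univ x) (ε * t) t (by positivity) (by simpa using mul_lt_mul_of_pos_right hε1 ht0)
    rw [ENNReal.div_le_iff (by exact_mod_cast (by positivity : ε * t ≠ 0)) ENNReal.coe_ne_top] at h1
    refine h1.trans (le_of_eq ?_)
    push_cast
    have : φ x t / (t : ℝ≥0∞) * t = φ x t := ENNReal.div_mul_cancel (by exact_mod_cast ht) ENNReal.coe_ne_top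
    calc (L : ℝ≥0∞) * (φ x t / t) * (ε * t) = L * ε * (φ x t / t * t) := by ring
      _ = _ := by rw [this]
  refine ne_top_of_le_ne_top (b := (((ε * lam)⁻¹ : ℝ≥0) : ℝ≥0∞)) ENNReal.coe_ne_top (sInf_le ⟨_, ⟨by positivity, ?_⟩, rfl⟩)
  calc ∫⁻ x in univ, φ x (‖f x‖₊ / (ε * lam)⁻¹) ≤ ∫⁻ x in univ, (L * ε : ℝ≥0) * φ x (lam * ‖f x‖₊) := by
        refine lintegral_mono fun x => ?_
        rw [div_inv_eq_mul, show ‖f x‖₊ * (ε * lam) = ε * (lam * ‖f x‖₊) by ring]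
        exact hsc x _
    _ = (L * ε : ℝ≥0) * I := lintegral_const_mul' _ _ ENNReal.coe_ne_top
    _ ≤ 1 := by
        rw [← ENNReal.coe_toNNReal hI.ne, ← ENNReal.coe_mul, ← ENNReal.coe_one, ENNReal.coe_le_coe, hε,
          show L * (L * I.toNNReal + 2)⁻¹ * I.toNNReal = (L * I.toNNReal) / (L * I.toNNReal + 2) by rw [div_eq_mul_inv]; ring, div_le_one hden]
        exact le_self_add

theorem mem_of_norm_ne_top {n : ℕ} {φ : RSp n → ℝ≥0 → ℝ≥0∞} {f : RSp n → ℝ} (hfm : AEMeasurable f volume)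
    (hf : orliczNorm φ univ f ≠ ∞) : MemOrlicz φ univ f := by
  refine ⟨by rwa [Measure.restrict_univ], ?_⟩
  obtain ⟨_, ⟨l, ⟨hl0, hl⟩, rfl⟩, hlt⟩ := sInf_lt_iff.1 (lt_top_iff_ne_top.2 hf)
  refine ⟨l⁻¹, by positivity, lt_of_le_of_lt (le_of_eq ?_) (hl.trans_lt ENNReal.one_lt_top)⟩
  refine lintegral_congr fun x => ?_
  rw [div_eq_inv_mul]

theorem aem_ind {n : ℕ} (Q : Cube n) : AEMeasurable (cubeIndicator Q) volume :=
  (measurable_one.indicator Q.measurableSet).aemeasurable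

/-- Finiteness of the norm of `χ_Q` when the maximal operator is bounded. -/
theorem norm_ind_ne_top_of_max {n : ℕ} {η : RSp n → ℝ≥0 → ℝ≥0∞} (hη : IsWeakPhi univ η) {C : ℝ≥0}
    (hM : ∀ f : RSp n → ℝ, MemOrlicz η Set.univ f →
          orliczNormE η Set.univ (maximal f) ≤ (C : ℝ≥0∞) * orliczNorm η Set.univ f) (Q : Cube n) :
    orliczNorm η univ (cubeIndicator Q) ≠ ∞ := by
  have hm : ∀ k : ℕ, AEMeasurable (fun x => η x (1 / ((k : ℝ≥0) + 1))) volume := fun k => by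
    have := hη.meas (fun _ => 1 / ((k : ℝ≥0) + 1)) measurable_const
    rwa [Measure.restrict_univ] at this
  set E : ℕ → Set (RSp n) := fun k => Q.set ∩ {x | (hm k).mk _ x ≤ 1} with hE
  have hEm : ∀ k, MeasurableSet (E k) := fun k =>
    Q.measurableSet.inter (measurableSet_le (hm k).measurable_mk measurable_const)
  have hae : ∀ᵐ x ∂(volume : Measure (RSp n)), ∀ k : ℕ, η x (1 / ((k : ℝ≥0) + 1)) = (hm k).mk _ x :=
    ae_all_iff.2 fun k => (hm k).ae_eq_mk
  have hex : ∃ k, volume (E k) ≠ 0 := by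
    by_contra hcon
    push Not at hcon
    have h1 : volume (⋃ k, E k) = 0 := measure_iUnion_null hcon
    have h2 : Q.set ≤ᵐ[volume] (⋃ k, E k : Set (RSp n)) := by
      filter_upwards [hae] with x hx hxQ
      have ht : Tendsto (fun k : ℕ => 1 / ((k : ℝ≥0) + 1)) atTop (nhdsWithin 0 (Ioi 0)) := by
        refine tendsto_nhdsWithin_iff.2 ⟨tendsto_one_div_add_atTop_nhds_zero_nat, Eventually.of_forall fun k => ?_⟩
        change 0 < 1 / ((k : ℝ≥0) + 1)
        positivity
      have h3 := ((hη.lim_zero x (mem_univ x)).comp ht).eventually (gt_mem_nhds (one_pos (α := ℝ≥0∞)))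
      obtain ⟨k, hk⟩ := h3.exists
      refine mem_iUnion.2 ⟨k, hxQ, ?_⟩
      change (hm k).mk _ x ≤ 1
      rw [← hx k]; exact le_of_lt hk
    have h3 := measure_mono_ae h2
    rw [h1] at h3
    exact Q.volume_ne_zero (le_antisymm h3 zero_le)
  obtain ⟨k, hk⟩ := hex
  set f : RSp n → ℝ := (E k).indicator 1 with hf
  have hEtop : volume (E k) ≠ ∞ := ne_top_of_le_ne_top Q.volume_ne_top (measure_mono inter_subset_left)
  have hfmem : MemOrlicz η univ f := by
    refine ⟨(measurable_one.indicator (hEm k)).aemeasurable, 1 / ((k : ℝ≥0) + 1), by positivity, ?_⟩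
    rw [Measure.restrict_univ]
    refine lt_of_le_of_lt (b := ∫⁻ x, (E k).indicator 1 x) (lintegral_mono_ae ?_) ?_
    · filter_upwards [hae] with x hx
      by_cases hxE : x ∈ E k
      · rw [hf, indicator_of_mem hxE, indicator_of_mem hxE]
        simp only [Pi.one_apply, nnnorm_one, mul_one]
        rw [hx k]; exact hxE.2
      · rw [hf, indicator_of_notMem hxE, indicator_of_notMem hxE]
        simp [hη.zero x (mem_univ x)]
    · rw [lintegral_indicator_one (hEm k)]; exact hEtop.lt_top
  have h1 : orliczNormE η univ (maximal f) ≠ ∞ :=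
    ne_top_of_le_ne_top (ENNReal.mul_ne_top ENNReal.coe_ne_top (norm_ne_top_of_mem hη hfmem)) (hM f hfmem)
  set c : ℝ≥0∞ := (volume Q.set)⁻¹ * volume (E k) with hc
  have hc0 : c ≠ 0 := mul_ne_zero (ENNReal.inv_ne_zero.2 Q.volume_ne_top) hk
  have hctop : c ≠ ∞ := ENNReal.mul_ne_top (ENNReal.inv_ne_top.2 Q.volume_ne_zero) hEtop
  have hci : c⁻¹ ≠ ∞ := ENNReal.inv_ne_top.2 hc0
  have h2 : orliczNorm η univ (cubeIndicator Q) ≤ (c⁻¹.toNNReal : ℝ≥0∞) * orliczNormE η univ (maximal f) := by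
    refine orliczNorm_le_E (ENNReal.toNNReal_pos (ENNReal.inv_ne_zero.2 hctop) hci) ?_
    filter_upwards with x
    by_cases hx : x ∈ Q.set
    · rw [cubeIndicator, indicator_of_mem hx, ENNReal.coe_toNNReal hci]
      have : c ≤ maximal f x := by
        refine le_trans (le_of_eq ?_) (le_iSup₂_of_le Q hx le_rfl)
        rw [hc]
        congr 1
        have : ∀ y, (‖f y‖₊ : ℝ≥0∞) = (E k).indicator 1 y := fun y => by
          by_cases hy : y ∈ E k
          · rw [hf, indicator_of_mem hy, indicator_of_mem hy]; simp
          · rw [hf, indicator_of_notMem hy, indicator_of_notMem hy]; simp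
        simp only [this]
        rw [lintegral_indicator_one (hEm k), Measure.restrict_apply (hEm k), inter_eq_left.2 inter_subset_left]
      calc (‖(1 : RSp n → ℝ) x‖₊ : ℝ≥0∞) = c⁻¹ * c := by rw [ENNReal.inv_mul_cancel hc0 hctop]; simp
        _ ≤ _ := mul_le_mul_right this _
    · rw [cubeIndicator, indicator_of_notMem hx]; simp
  exact ne_top_of_le_ne_top (ENNReal.mul_ne_top ENNReal.coe_ne_top h1) h2

theorem three_one {n : ℕ} {α : ℝ} (hα : 0 ≤ α / (n : ℝ)) (hα1 : α / (n : ℝ) ≤ 1) {b : RSp n → ℝ} (hb : LocallyIntegrable b volume)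
    {η : RSp n → ℝ≥0 → ℝ≥0∞} (hη : IsWeakPhi univ η) {C : ℝ≥0}
    (hM : ∀ f : RSp n → ℝ, MemOrlicz η Set.univ f →
          orliczNormE η Set.univ (maximal f) ≤ (C : ℝ≥0∞) * orliczNorm η Set.univ f)
    (hS : (⨆ Q : Cube n, orliczNorm η Set.univ (commTestFn α Q b) /
          orliczNorm η Set.univ (cubeIndicator Q)) < ∞) :
    IsBMO b ∧ ∃ M : ℝ, ∀ᵐ x ∂(volume : Measure (RSp n)), max (-(b x)) 0 ≤ M := by
  set K := ⨆ Q : Cube n, orliczNorm η Set.univ (commTestFn α Q b) / orliczNorm η Set.univ (cubeIndicator Q) with hK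
  refine bmo_of_test hα hb (C := C * K.toNNReal) fun Q => ?_
  have N0 := norm_ind_ne_zero hη Q
  have N1 := norm_ind_ne_top_of_max hη hM Q
  set N := orliczNorm η univ (cubeIndicator Q) with hN
  have hF : orliczNorm η univ (commTestFn α Q b) ≤ K * N := by
    rw [← ENNReal.div_le_iff N0 N1]
    exact le_iSup (fun Q : Cube n => orliczNorm η Set.univ (commTestFn α Q b) / orliczNorm η Set.univ (cubeIndicator Q)) Q
  have hFm := mem_of_norm_ne_top (aemeasurable_test hα1 Q hb.aestronglyMeasurable.aemeasurable)
    (ne_top_of_le_ne_top (ENNReal.mul_ne_top hS.ne N1) hF)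
  have hMF := (hM _ hFm).trans (mul_le_mul_right hF _)
  rw [← ENNReal.div_le_iff Q.volume_ne_zero Q.volume_ne_top, ENNReal.div_eq_inv_mul]
  push_cast
  rw [ENNReal.coe_toNNReal hS.ne]
  refine ENNReal.le_of_forall_nnreal_lt fun w hw => ?_
  rcases eq_or_ne w 0 with rfl | hw0
  · simp
  have h2 : N ≤ ((w⁻¹ : ℝ≥0) : ℝ≥0∞) * orliczNormE η univ (maximal (commTestFn α Q b)) := by
    refine orliczNorm_le_E (by positivity) ?_
    filter_upwards with x
    by_cases hx : x ∈ Q.set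
    · have h3 : (w : ℝ≥0∞) ≤ maximal (commTestFn α Q b) x := hw.le.trans (le_iSup₂_of_le Q hx le_rfl)
      rw [cubeIndicator, indicator_of_mem hx]
      calc (‖(1 : RSp n → ℝ) x‖₊ : ℝ≥0∞) = ((w⁻¹ * w : ℝ≥0) : ℝ≥0∞) := by rw [inv_mul_cancel₀ hw0]; simp
        _ ≤ _ := by rw [ENNReal.coe_mul]; exact mul_le_mul_right h3 _
    · rw [cubeIndicator, indicator_of_notMem hx]; simp
  have h3 : w * N ≤ (C * K) * N := by
    calc w * N ≤ w * (((w⁻¹ : ℝ≥0) : ℝ≥0∞) * (C * (K * N))) := mul_le_mul_right (h2.trans (mul_le_mul_right hMF _)) _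
      _ = ((w * w⁻¹ : ℝ≥0) : ℝ≥0∞) * ((C * K) * N) := by push_cast; ring
      _ = _ := by rw [mul_inv_cancel₀ hw0]; simp
  exact (ENNReal.mul_le_mul_iff_left N0 N1).1 h3



theorem pkg_psi {n : ℕ} {a κ σ C c₁ c₂ : ℝ} {h : RSp n → ℝ} {φ ψ : RSp n → ℝ≥0 → ℝ≥0∞}
    (hP : Pkg a κ σ C c₁ c₂ h φ ψ) : Pkg 0 κ σ C 1 1 h ψ ψ where
  hφ := hP.hψ
  hψ := hP.hψ
  ha := le_rfl
  ha1 := one_pos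
  hσ := hP.hσ
  hσκ := hP.hσκ
  haκ := by linarith [hP.haκ, hP.ha]
  hC := hP.hC
  hc₁ := one_pos
  hc₂ := one_pos
  inv x t _ := by simp
  hJ := hP.hJ
  hm := hP.hm
  hh := hP.hh
  hInth := hP.hInth
  comp := hP.comp

/-- The averaging estimate. -/
theorem avg_modular {n : ℕ} {a κ σ C c₁ c₂ : ℝ} {h : RSp n → ℝ} {φ ψ : RSp n → ℝ≥0 → ℝ≥0∞}
    (hP : Pkg a κ σ C c₁ c₂ h φ ψ) :
    ∃ C' : ℝ≥0, 0 < C' ∧ ∀ (Q : Cube n) (f : RSp n → ℝ), AEMeasurable f volume → (∫⁻ x, ψ x ‖f x‖₊) ≤ 1 →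
      ∀ w : ℝ≥0, (w : ℝ≥0∞) ≤ volume Q.set ^ (-a) * ((volume Q.set)⁻¹ * ∫⁻ y in Q.set, (‖f y‖₊ : ℝ≥0∞)) →
      ∫⁻ x in Q.set, φ x (w / C') ≤ 1 := by
  have hP0 := pkg_psi hP
  have haκ : 0 < 0 + κ := by linarith [hP.hσ, hP.hσκ]
  set s := Real.sqrt (1 / (0 + κ)) with hs
  have hs1 : 1 < s := by
    rw [hs, Real.lt_sqrt (by norm_num), lt_div_iff₀ haκ]; linarith [hP0.haκ]
  have hsκ : 0 + κ = 1 / s * (1 / s) := by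
    rw [one_div_mul_one_div, hs, Real.mul_self_sqrt (by positivity), one_div_one_div]
  set A : ℝ := 1 + (∫⁻ x, ENNReal.ofReal (h x)).toReal with hA
  have hA1 : 1 ≤ A := by rw [hA]; linarith [ENNReal.toReal_nonneg (a := ∫⁻ x, ENNReal.ofReal (h x))]
  have hAof : ENNReal.ofReal A = 1 + ∫⁻ x, ENNReal.ofReal (h x) := by
    rw [hA, ENNReal.ofReal_add zero_le_one ENNReal.toReal_nonneg, ENNReal.ofReal_one, ENNReal.ofReal_toReal hP.hInth.ne]
  obtain ⟨D, hD⟩ := cube_est hP0 (isBMO_zero n) hs1 hsκ hA1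
  choose P hPae hPest using hD
  obtain ⟨L, hL1, hL⟩ := phiE_le hP.hφ
  have hc₁ := hP.hc₁
  set D' : ℝ≥0 := D * (c₁⁻¹).toNNReal + 1 with hD'
  have hD'0 : 0 < D' := by positivity
  set E : ℝ≥0 := A.toNNReal + A.toNNReal with hE
  set μ : ℝ≥0 := 2 * D' * L * E + 2 * D' + 1 with hμ
  have hμ0 : 0 < μ := by positivity
  refine ⟨μ, hμ0, fun Q f hf hφf w hw => ?_⟩
  have hFm : AEMeasurable (fun x => ψ x ‖f x‖₊) volume := by
    have h1 := hP.hψ.meas (fun x => ‖hf.mk f x‖₊) hf.measurable_mk.nnnorm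
    rw [Measure.restrict_univ] at h1
    refine h1.congr ?_
    filter_upwards [hf.ae_eq_mk] with x hx
    rw [hx]
  set F := hFm.mk _ with hF
  have hFF : (fun x => ψ x ‖f x‖₊) =ᵐ[volume] F := hFm.ae_eq_mk
  have hFmeas : Measurable F := hFm.measurable_mk
  have hFint : ∫⁻ x, F x ≤ 1 := by rw [← lintegral_congr_ae hFF]; exact hφf
  have hFfin : ∀ᵐ x ∂(volume : Measure (RSp n)), F x < ∞ := ae_lt_top hFmeas (ne_top_of_le_ne_top ENNReal.one_ne_top hFint)
  set g : RSp n → ℝ := fun x => (F x).toReal + h x with hg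
  have hgm : Measurable g := hFmeas.ennreal_toReal.add hP.hm
  have hhg : ∀ y, h y ≤ g y := fun y => by rw [hg]; simp only; linarith [ENNReal.toReal_nonneg (a := F y)]
  have hgof : ∀ y, ENNReal.ofReal (g y) = ENNReal.ofReal (F y).toReal + ENNReal.ofReal (h y) := fun y =>
    ENNReal.ofReal_add ENNReal.toReal_nonneg (hP.hh y).1.le
  have hgA : (∫⁻ y, ENNReal.ofReal (g y)) ≤ ENNReal.ofReal A := by
    simp only [hgof]
    rw [lintegral_add_left hFmeas.ennreal_toReal.ennreal_ofReal, hAof]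
    refine add_le_add_left ((lintegral_mono fun y => ENNReal.ofReal_toReal_le).trans hFint) _
  have hfg : ∀ᵐ y ∂(volume : Measure (RSp n)), (‖f y‖₊ : ℝ≥0∞) ≤ phiInv ψ y (ENNReal.ofReal (g y)) := by
    filter_upwards [hFF, hFfin] with y h1 h2
    apply le_phiInv (hP.hψ.mono y (mem_univ y))
    rw [hgof, ENNReal.ofReal_toReal h2.ne]
    rw [h1]
    exact ENNReal.lt_add_right h2.ne (ENNReal.ofReal_pos.2 (hP.hh y).1).ne'
  have v0 := Q.volume_ne_zero
  have v1 := Q.volume_ne_top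
  set V := volume Q.set with hV
  have hτ : (V⁻¹ * ∫⁻ y in Q.set, ENNReal.ofReal (g y) ^ (1 / s)) ^ s ≤ V⁻¹ * ENNReal.ofReal A := by
    refine (holder_avg hs1 (hgm.ennreal_ofReal.pow_const _).aemeasurable Q).trans (mul_le_mul_right ?_ _)
    refine le_trans ?_ hgA
    refine le_trans (le_of_eq ?_) (setLIntegral_le_lintegral Q.set _)
    refine lintegral_congr fun y => ?_
    rw [← ENNReal.rpow_mul, one_div_mul_cancel (by linarith), ENNReal.rpow_one]
  set S : RSp n → ℝ≥0∞ := fun x => ENNReal.ofReal (h x) + V⁻¹ * ENNReal.ofReal A with hS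
  have hSint : ∫⁻ x in Q.set, S x ≤ E := by
    rw [hS, lintegral_add_left hP.hm.ennreal_ofReal, hE, setLIntegral_const]
    push_cast
    refine add_le_add ?_ (le_of_eq ?_)
    · refine (setLIntegral_le_lintegral _ _).trans ?_
      change _ ≤ ENNReal.ofReal A
      rw [hAof]; exact le_add_self
    · change _ = ENNReal.ofReal A
      rw [mul_right_comm, ← hV, ENNReal.inv_mul_cancel v0 v1, one_mul]
  have hN : ∀ᵐ x ∂(volume.restrict Q.set), φ x (w / μ) ≤ (L * (2 * D' / μ) : ℝ≥0) * S x := by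
    filter_upwards [hPae Q] with x hx
    have hle : ((w / μ : ℝ≥0) : ℝ≥0∞) ≤ (w : ℝ≥0∞) / μ := by rw [ENNReal.coe_div hμ0.ne']
    refine (le_phiE hle).trans (hL x _ _ D' μ hD'0 ?_ ?_)
    · rw [hμ]
      calc 2 * D' < 2 * D' + 1 := lt_add_one _
        _ ≤ _ := by rw [add_assoc]; exact le_add_self
    have h1 := hPest Q g f hgm hhg hgA hfg x hx
    have hc0 : cubeAvg Q (fun _ => (0 : ℝ)) = 0 := by simp [cubeAvg]
    rw [hc0] at h1
    simp only [sub_self, abs_zero, add_zero, ENNReal.ofReal_one, one_mul, Real.one_rpow, zero_sub, ENNReal.rpow_neg_one] at h1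
    have h2 : V⁻¹ * ∫⁻ y in Q.set, (‖f y‖₊ : ℝ≥0∞) ≤ D * phiInv ψ x (S x) :=
      h1.trans (mul_le_mul_right (phiInv_mono (add_le_add_right hτ _)) _)
    have hVS : V ^ (-a) ≤ S x ^ a := by
      rw [ENNReal.rpow_neg, ← ENNReal.inv_rpow]
      refine ENNReal.rpow_le_rpow ?_ hP.ha
      calc V⁻¹ = V⁻¹ * 1 := (mul_one _).symm
        _ ≤ V⁻¹ * ENNReal.ofReal A := mul_le_mul_right (by rw [hAof]; exact le_self_add) _
        _ ≤ S x := le_add_self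
    have hStop : S x ≠ ∞ := ENNReal.add_ne_top.2 ⟨ENNReal.ofReal_ne_top, ENNReal.mul_ne_top (ENNReal.inv_ne_top.2 v0) ENNReal.ofReal_ne_top⟩
    have hS0 : S x ≠ 0 := by
      have := ENNReal.ofReal_pos.2 (hP.hh x).1
      exact (this.trans_le le_self_add).ne'
    set Sr := (S x).toReal with hSr
    have hSr0 : 0 < Sr := ENNReal.toReal_pos hS0 hStop
    have hSof : S x = ENNReal.ofReal Sr := (ENNReal.ofReal_toReal hStop).symm
    have h3 : S x ^ a * phiInv ψ x (S x) ≤ ENNReal.ofReal c₁⁻¹ * phiInv φ x (S x) := by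
      rw [hSof, ← ofReal_rInv hP.hψ, ← ofReal_rInv hP.hφ, ENNReal.ofReal_rpow_of_pos hSr0,
        ← ENNReal.ofReal_mul (by positivity), ← ENNReal.ofReal_mul (by positivity)]
      apply ENNReal.ofReal_le_ofReal
      have := (hP.inv x Sr hSr0).1
      rw [inv_mul_eq_div, le_div_iff₀ hc₁]
      linarith
    calc (w : ℝ≥0∞) ≤ _ := hw
      _ ≤ S x ^ a * (D * phiInv ψ x (S x)) := mul_le_mul' hVS h2
      _ = D * (S x ^ a * phiInv ψ x (S x)) := by ring
      _ ≤ D * (ENNReal.ofReal c₁⁻¹ * phiInv φ x (S x)) := mul_le_mul_right h3 _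
      _ = ((D * (c₁⁻¹).toNNReal : ℝ≥0) : ℝ≥0∞) * phiInv φ x (S x) := by rw [ENNReal.coe_mul, mul_assoc]; rfl
      _ ≤ D' * phiInv φ x (S x) := mul_le_mul_left (by rw [hD']; exact_mod_cast le_self_add) _
  calc ∫⁻ x in Q.set, φ x (w / μ) ≤ ∫⁻ x in Q.set, (L * (2 * D' / μ) : ℝ≥0) * S x := lintegral_mono_ae hN
    _ = (L * (2 * D' / μ) : ℝ≥0) * ∫⁻ x in Q.set, S x := lintegral_const_mul' _ _ ENNReal.coe_ne_top
    _ ≤ (L * (2 * D' / μ) : ℝ≥0) * E := mul_le_mul_right hSint _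
    _ ≤ 1 := by
        rw [← ENNReal.coe_mul, ← ENNReal.coe_one, ENNReal.coe_le_coe]
        rw [show L * (2 * D' / μ) * E = (2 * D' * L * E) / μ by ring, div_le_one hμ0, hμ, add_assoc]
        exact le_self_add

theorem avg_norm {n : ℕ} {a κ σ C c₁ c₂ : ℝ} {h : RSp n → ℝ} {φ ψ : RSp n → ℝ≥0 → ℝ≥0∞}
    (hP : Pkg a κ σ C c₁ c₂ h φ ψ) :
    ∃ C' : ℝ≥0, 0 < C' ∧ ∀ (Q : Cube n) (f : RSp n → ℝ), AEMeasurable f volume →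
      ∀ w : ℝ≥0, (w : ℝ≥0∞) ≤ volume Q.set ^ (-a) * ((volume Q.set)⁻¹ * ∫⁻ y in Q.set, (‖f y‖₊ : ℝ≥0∞)) →
      w * orliczNorm φ univ (cubeIndicator Q) ≤ C' * orliczNorm ψ univ f := by
  obtain ⟨C', hC', hmain⟩ := avg_modular hP
  refine ⟨C', hC', fun Q f hf w hw => ?_⟩
  rcases eq_or_ne w 0 with rfl | hw0
  · simp
  have hw0' : 0 < w := pos_iff_ne_zero.2 hw0
  rw [mul_comm (C' : ℝ≥0∞), ← ENNReal.div_le_iff (by exact_mod_cast hC'.ne') ENNReal.coe_ne_top]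
  refine le_sInf ?_
  rintro _ ⟨l, ⟨hl0, hl⟩, rfl⟩
  rw [ENNReal.div_le_iff (by exact_mod_cast hC'.ne') ENNReal.coe_ne_top]
  rw [Measure.restrict_univ] at hl
  have e : ∀ y, ‖f y * ((l⁻¹ : ℝ≥0) : ℝ)‖₊ = ‖f y‖₊ / l := fun y => by
    rw [nnnorm_mul, NNReal.nnnorm_eq, div_eq_mul_inv]
  have h1 := hmain Q (fun y => f y * ((l⁻¹ : ℝ≥0) : ℝ)) (hf.mul_const _) (by simp only [e]; exact hl) (w / l) (by
    simp only [e]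
    have : ∀ y, ((‖f y‖₊ / l : ℝ≥0) : ℝ≥0∞) = ((l⁻¹ : ℝ≥0) : ℝ≥0∞) * ‖f y‖₊ := fun y => by
      rw [div_eq_inv_mul, ENNReal.coe_mul]
    simp only [this]
    rw [lintegral_const_mul' _ _ ENNReal.coe_ne_top, div_eq_inv_mul, ENNReal.coe_mul]
    refine (mul_le_mul_right hw _).trans (le_of_eq ?_)
    ring)
  have h2 : orliczNorm φ univ (cubeIndicator Q) ≤ ((C' * l / w : ℝ≥0) : ℝ≥0∞) := by
    refine sInf_le ⟨_, ⟨by positivity, ?_⟩, rfl⟩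
    rw [lintegral_cubeIndicator hP.hφ Q (fun t => t / (C' * l / w)) (by simp)]
    refine le_trans (le_of_eq ?_) h1
    refine lintegral_congr fun x => ?_
    congr 1
    field_simp
  calc (w : ℝ≥0∞) * orliczNorm φ univ (cubeIndicator Q) ≤ w * ((C' * l / w : ℝ≥0) : ℝ≥0∞) := mul_le_mul_right h2 _
    _ = ((l * C' : ℝ≥0) : ℝ≥0∞) := by rw [← ENNReal.coe_mul]; congr 1; field_simp
    _ = _ := ENNReal.coe_mul _ _

theorem mem_ind_of_a0 {n : ℕ} {φ : RSp n → ℝ≥0 → ℝ≥0∞} (hφ : IsWeakPhi univ φ) (ha0 : A0 univ φ) (Q : Cube n) :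
    MemOrlicz φ univ (cubeIndicator Q) := by
  obtain ⟨β, hβ, _, hb⟩ := ha0
  rw [Measure.restrict_univ] at hb
  refine ⟨by rw [Measure.restrict_univ]; exact aem_ind Q, β / 2, by positivity, ?_⟩
  rw [lintegral_cubeIndicator hφ Q (fun t => β / 2 * t) (by simp)]
  refine lt_of_le_of_lt (b := ∫⁻ x in Q.set, 1) (lintegral_mono_ae ?_) ?_
  · filter_upwards [ae_restrict_of_ae hb] with x hx
    rw [mul_one]
    apply le_of_lt
    apply lt_phiInv
    refine lt_of_lt_of_le ?_ hx.1
    exact_mod_cast half_lt_self hβ.ne'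
  · rw [setLIntegral_const, one_mul]; exact Q.volume_ne_top.lt_top

theorem frac_ind {n : ℕ} {α : ℝ} (hα : 0 ≤ α / (n : ℝ)) (hα1 : α / (n : ℝ) ≤ 1) (Q : Cube n) {x : RSp n} (hx : x ∈ Q.set) :
    fracMaximal α (cubeIndicator Q) x = volume Q.set ^ (α / (n : ℝ)) := by
  have h1 := frac_eq_rest hα1 Q (fun _ => 1) hx
  simp only [one_mul] at h1
  have e : ∀ Q' : Cube n, volume Q'.set ^ (α / (n : ℝ) - 1) * ∫⁻ y in Q'.set, (‖(1 : ℝ)‖₊ : ℝ≥0∞) = volume Q'.set ^ (α / (n : ℝ)) := fun Q' => by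
    rw [setLIntegral_const]
    simp only [nnnorm_one, ENNReal.coe_one, one_mul]
    nth_rw 2 [← ENNReal.rpow_one (volume Q'.set)]
    rw [← ENNReal.rpow_add _ _ Q'.volume_ne_zero Q'.volume_ne_top]
    congr 1; ring
  change fracMaximal α (fun y => cubeIndicator Q y) x = _
  rw [h1, restFracMaximal]
  simp only [e]
  refine le_antisymm (iSup_le fun Q' => iSup₂_le fun _ hs => ENNReal.rpow_le_rpow (measure_mono hs) hα) ?_
  exact le_iSup_of_le Q (le_iSup₂_of_le hx Subset.rfl le_rfl)

theorem two_one {n : ℕ} {p α r : ℝ} {φ ψ : RSp n → ℝ≥0 → ℝ≥0∞}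
    (hp : 1 < p) (hα : 0 ≤ α / (n : ℝ)) (hφ : IsWeakPhi univ φ) (hψ : IsWeakPhi univ ψ) (hinv : FracInvRel α φ ψ)
    (hr₁ : α / (n : ℝ) < r) (hr₂ : r ≤ 1 / p)
    (ha0 : A0 univ φ) (ha1 : A1 φ) (ha2 : A2 φ) (hainc : AInc p univ φ) (hadec : ADec (1 / r) univ φ)
    {b : RSp n → ℝ} (hb : LocallyIntegrable b volume) {C₂ : ℝ≥0}
    (hC : ∀ f : RSp n → ℝ, MemOrlicz φ univ f →
        orliczNorm ψ univ (fracMaximalCommutator α b f) ≤ (C₂ : ℝ≥0∞) * orliczNorm φ univ f) :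
    IsBMO b ∧ ∃ M : ℝ, ∀ᵐ x ∂(volume : Measure (RSp n)), max (-(b x)) 0 ≤ M := by
  obtain ⟨κ, σ, C, c₁, c₂, h, hP⟩ := exists_pkg hp hα hφ hψ hinv hr₁ hr₂ ha0 ha1 ha2 hainc hadec
  obtain ⟨C', hC', hmain⟩ := avg_norm hP
  have hα1 : α / (n : ℝ) ≤ 1 := hP.ha1.le
  refine bmo_of_test hα hb (C := C' * C₂) fun Q => ?_
  have v0 := Q.volume_ne_zero
  have v1 := Q.volume_ne_top
  have hmem := mem_ind_of_a0 hφ ha0 Q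
  have N0 := norm_ind_ne_zero hφ Q
  have N1 := norm_ne_top_of_mem hφ hmem
  have hCQ := hC _ hmem
  set G := fracMaximalCommutator α b (cubeIndicator Q) with hG
  have hbm : AEMeasurable b volume := hb.aestronglyMeasurable.aemeasurable
  have hGm : AEMeasurable G volume :=
    (measurable_fracMaximal α _).ennreal_toReal.aemeasurable.sub
      (hbm.mul (measurable_fracMaximal α _).ennreal_toReal.aemeasurable)
  set a := α / (n : ℝ) with ha
  have hpt : ∀ x ∈ Q.set, (‖commTestFn α Q b x‖₊ : ℝ≥0∞) = volume Q.set ^ (-a) * ‖G x‖₊ := by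
    intro x hx
    set u := (volume Q.set ^ a).toReal with hu
    have hu0 : 0 < u := ENNReal.toReal_pos (by
      simp [ENNReal.rpow_eq_zero_iff, v0, v1]) (ENNReal.rpow_ne_top_of_ne_zero v0 v1)
    have hui : (volume Q.set ^ (-a)).toReal = u⁻¹ := by rw [ENNReal.rpow_neg, ENNReal.toReal_inv]
    have e1 : commTestFn α Q b x = -(u⁻¹ * G x) := by
      rw [commTestFn, indicator_of_mem hx, hG, fracMaximalCommutator, frac_eq_rest hα1 Q b hx, frac_ind hα hα1 Q hx, ← ha, hui, ← hu]
      field_simp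
      ring
    rw [e1, nnnorm_neg, nnnorm_mul, ENNReal.coe_mul]
    congr 1
    rw [← enorm_eq_nnnorm, Real.enorm_eq_ofReal_abs, abs_of_pos (by positivity), ← hui,
      ENNReal.ofReal_toReal (ENNReal.rpow_ne_top_of_ne_zero v0 v1)]
  rw [← ENNReal.div_le_iff v0 v1, ENNReal.div_eq_inv_mul]
  rw [setLIntegral_congr_fun Q.measurableSet hpt, lintegral_const_mul' _ _ (ENNReal.rpow_ne_top_of_ne_zero v0 v1)]
  refine ENNReal.le_of_forall_nnreal_lt fun w hw => ?_
  have h1 := hmain Q G hGm w (hw.le.trans (le_of_eq (by ring)))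
  have h2 := h1.trans (mul_le_mul_right hCQ _)
  rw [← mul_assoc, ← ENNReal.coe_mul] at h2
  exact (ENNReal.mul_le_mul_iff_left N0 N1).1 h2


/-- characterization of `BMO` with `b⁻ ∈ L^∞` via boundedness of
`[M_α,b] : L^φ → L^ψ` and via the uniform norm condition
`sup_Q ‖(b − |Q|^{−α/n}M_{α,Q}b)χ_Q‖_η/‖χ_Q‖_η < ∞`, for some/all suitable `η`. -/
theorem statement18 {n : ℕ} (hn : 0 < n) (p q α r : ℝ)
    (φ ψ : RSp n → ℝ≥0 → ℝ≥0∞)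
    (hp : 1 < p) (hpq : p ≤ q) (hα : α / (n : ℝ) = 1 / p - 1 / q)
    (hφ : IsWeakPhi Set.univ φ) (hψ : IsWeakPhi Set.univ ψ)
    (hinv : FracInvRel α φ ψ)
    (hr₁ : α / (n : ℝ) < r) (hr₂ : r ≤ 1 / p)
    (ha0 : A0 Set.univ φ) (ha1 : A1 φ) (ha2 : A2 φ)
    (hainc : AInc p Set.univ φ) (hadec : ADec (1 / r) Set.univ φ)
    (b : RSp n → ℝ) (hb : LocallyIntegrable b volume) :
    ((IsBMO b ∧ ∃ M : ℝ, ∀ᵐ x ∂(volume : Measure (RSp n)), max (-(b x)) 0 ≤ M) ↔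
      (∃ C : ℝ≥0, ∀ f : RSp n → ℝ, MemOrlicz φ Set.univ f →
        orliczNorm ψ Set.univ (fracMaximalCommutator α b f) ≤
          (C : ℝ≥0∞) * orliczNorm φ Set.univ f)) ∧
    ((IsBMO b ∧ ∃ M : ℝ, ∀ᵐ x ∂(volume : Measure (RSp n)), max (-(b x)) 0 ≤ M) ↔
      (∃ η : RSp n → ℝ≥0 → ℝ≥0∞, IsWeakPhi Set.univ η ∧
        (∃ C : ℝ≥0, ∀ f : RSp n → ℝ, MemOrlicz η Set.univ f →
          orliczNormE η Set.univ (maximal f) ≤ (C : ℝ≥0∞) * orliczNorm η Set.univ f) ∧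
        (⨆ Q : Cube n, orliczNorm η Set.univ (commTestFn α Q b) /
          orliczNorm η Set.univ (cubeIndicator Q)) < ∞)) ∧
    ((IsBMO b ∧ ∃ M : ℝ, ∀ᵐ x ∂(volume : Measure (RSp n)), max (-(b x)) 0 ≤ M) ↔
      (∀ η : RSp n → ℝ≥0 → ℝ≥0∞, IsWeakPhi Set.univ η →
        A0 Set.univ η → A1 η → A2 η →
        (∃ p' : ℝ, 1 < p' ∧ AInc p' Set.univ η) →
        (∃ q' : ℝ, ADec q' Set.univ η) →
        (⨆ Q : Cube n, orliczNorm η Set.univ (commTestFn α Q b) /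
          orliczNorm η Set.univ (cubeIndicator Q)) < ∞)) := by
  have hp0 : 0 < p := by linarith
  have hα0 : 0 ≤ α / (n : ℝ) := by
    rw [hα]; linarith [one_div_le_one_div_of_le hp0 hpq]
  have hp1 : 1 / p < 1 := by rw [div_lt_one hp0]; exact hp
  have hα1 : α / (n : ℝ) ≤ 1 := by linarith
  have hsq : ∀ {M : ℝ}, IsBMO b → (∀ᵐ x ∂(volume : Measure (RSp n)), max (-(b x)) 0 ≤ M) →
      (⨆ Q : Cube n, orliczNorm (sqPhi n) Set.univ (commTestFn α Q b) /
          orliczNorm (sqPhi n) Set.univ (cubeIndicator Q)) < ∞ := fun hb1 hM =>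
    fwd_four hα0 (sqPhi_weak n) (sqPhi_a0 n) (sqPhi_a1 n) (sqPhi_a2 n) one_lt_two (sqPhi_ainc n) (sqPhi_adec n) hb1 hM
  refine ⟨⟨?_, ?_⟩, ⟨?_, ?_⟩, ⟨?_, ?_⟩⟩
  · rintro ⟨hb1, M, hM⟩
    exact fwd_two hp hα0 hφ hψ hinv hr₁ hr₂ ha0 ha1 ha2 hainc hadec hb1 hM
  · rintro ⟨C, hC⟩
    exact two_one hp hα0 hφ hψ hinv hr₁ hr₂ ha0 ha1 ha2 hainc hadec hb hC
  · rintro ⟨hb1, M, hM⟩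
    exact ⟨sqPhi n, sqPhi_weak n, sqPhi_max n, hsq hb1 hM⟩
  · rintro ⟨η, hη, ⟨C, hC⟩, hS⟩
    exact three_one hα0 hα1 hb hη hC hS
  · rintro ⟨hb1, M, hM⟩ η hη h0 h1 h2 ⟨p', hp', hi⟩ ⟨q', hd⟩
    exact fwd_four hα0 hη h0 h1 h2 hp' hi hd hb1 hM
  · intro hall
    obtain ⟨C, hC⟩ := sqPhi_max n
    exact three_one hα0 hα1 hb (sqPhi_weak n) hC
      (hall _ (sqPhi_weak n) (sqPhi_a0 n) (sqPhi_a1 n) (sqPhi_a2 n) ⟨2, one_lt_two, sqPhi_ainc n⟩ ⟨2, sqPhi_adec n⟩)
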